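/- arXiv:1703.10840 — 2 statements merged into one kernel-verified Lean document; each statement's English description precedes it below -/
import Mathlib

section
/- Let T1 and T2 be two incompatible unrooted binary phylogenetic trees on the same label set X with a common split X*|X** induced by edges e_1 = {u_1,v_1} of T1 and e_2 = {u_2,v_2} of T2 (u_1,u_2 on the X* side, v_1,v_2 on the X** side). Let G* and G** be the two connected components of D(T1,T2) after deleting e_1 and e_2, with G* containing u_1,u_2 and G** containing v_1,v_2, let [G*] be G* plus the edge {u_1,u_2} and [G**] be G** plus the edge {v_1,v_2}. Let p = tw(D(T1|X*, T2|X*)), q = tw(D(T1|X**, T2|X**)) and assume without loss of generality p ≤ q. Then tw(D(T1,T2)) = max(p,q) if and only if: (1) in the case p < q, tw([G**]) = tw(G**); and (2) in the case p = q, both tw([G**]) = tw(G**) and tw([G*]) = tw(G*). -/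
open SimpleGraph

/-- `G` has a tree decomposition of width at most `k`: a tree `t` together with
bags satisfying (tw1), (tw2) and (tw3), all of whose bags have size at most `k+1`. -/
def HasTreeDecompWidthLE {V : Type*} (G : SimpleGraph V) (k : ℕ) : Prop :=
  ∃ (n : ℕ) (t : SimpleGraph (Fin (n + 1))) (bag : Fin (n + 1) → Finset V),
    t.IsTree ∧
    (∀ v : V, ∃ i, v ∈ bag i) ∧
    (∀ u v : V, G.Adj u v → ∃ i, u ∈ bag i ∧ v ∈ bag i) ∧
    (∀ v : V, (t.induce {i | v ∈ bag i}).Connected) ∧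
    (∀ i, (bag i).card ≤ k + 1)

/-- The treewidth of a graph: the least `k` such that `G` has a tree decomposition
of width `k`. -/
noncomputable def treewidth {V : Type*} (G : SimpleGraph V) : ℕ :=
  sInf {k | HasTreeDecompWidthLE G k}

/-- An unrooted binary phylogenetic graph (tree or network) on label set `X`:
a finite connected graph whose degree-1 vertices are bijectively labelled by `X`
and all of whose other vertices have degree 3. -/
structure PhyloGraph (V : Type*) (X : Type*) where
  graph : SimpleGraph V
  finite : Finite V
  connected : graph.Connected
  leaf : X → V
  leaf_inj : Function.Injective leaf
  leaf_deg : ∀ x : X, (graph.neighborSet (leaf x)).ncard = 1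
  internal_deg : ∀ v : V, (∀ x : X, leaf x ≠ v) → (graph.neighborSet v).ncard = 3

/-- An unrooted binary phylogenetic tree on label set `X`. -/
structure PhyloTree (V : Type*) (X : Type*) extends PhyloGraph V X where
  acyclic : graph.IsAcyclic

open Classical in
/-- The map identifying a leaf of the second graph with the leaf of the first
graph carrying the same label. -/
noncomputable def mergeMap {V1 V2 X : Type*} (l1 : X → V1) (l2 : X → V2) :
    V1 ⊕ V2 → V1 ⊕ V2
  | Sum.inl v => Sum.inl v
  | Sum.inr w => if h : ∃ x, l2 x = w then Sum.inl (l1 h.choose) else Sum.inr w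

lemma mergeMap_idem {V1 V2 X : Type*} (l1 : X → V1) (l2 : X → V2) (u : V1 ⊕ V2) :
    mergeMap l1 l2 (mergeMap l1 l2 u) = mergeMap l1 l2 u := by
  classical
  cases u with
  | inl v => rfl
  | inr w =>
    by_cases h : ∃ x, l2 x = w
    · simp [mergeMap, h]
    · simp [mergeMap, h]

/-- The vertex set of the display graph: the disjoint union of the vertex sets
of the two graphs, with leaves carrying the same label identified. -/
def DisplayVertex {V1 V2 X : Type*} (l1 : X → V1) (l2 : X → V2) : Type _ :=
  {u : V1 ⊕ V2 // mergeMap l1 l2 u = u}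

/-- The canonical map from `V1 ⊕ V2` to the vertex set of the display graph. -/
noncomputable def toDisplay {V1 V2 X : Type*} (l1 : X → V1) (l2 : X → V2) (u : V1 ⊕ V2) :
    DisplayVertex l1 l2 :=
  ⟨mergeMap l1 l2 u, mergeMap_idem l1 l2 u⟩

/-- The display graph of two leaf-labelled graphs: their disjoint union with the
leaves carrying the same label identified. -/
noncomputable def displayGraph {V1 V2 X : Type*} (G1 : SimpleGraph V1) (l1 : X → V1)
    (G2 : SimpleGraph V2) (l2 : X → V2) : SimpleGraph (DisplayVertex l1 l2) :=
  SimpleGraph.fromRel (fun a b =>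
    (∃ u v : V1, G1.Adj u v ∧ a = toDisplay l1 l2 (Sum.inl u) ∧ b = toDisplay l1 l2 (Sum.inl v)) ∨
    (∃ u v : V2, G2.Adj u v ∧ a = toDisplay l1 l2 (Sum.inr u) ∧ b = toDisplay l1 l2 (Sum.inr v)))

/-- The treewidth distance between two phylogenetic trees:
`d_tw(T1,T2) = tw(D(T1,T2)) - 2`. -/
noncomputable def dtw {V1 V2 X : Type*} (T1 : PhyloTree V1 X) (T2 : PhyloTree V2 X) : ℕ :=
  treewidth (displayGraph T1.graph T1.leaf T2.graph T2.leaf) - 2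

/-- Two phylogenetic trees are compatible if there is a label-preserving
isomorphism between them. -/
def Compatible {V1 V2 X : Type*} (T1 : PhyloTree V1 X) (T2 : PhyloTree V2 X) : Prop :=
  ∃ φ : T1.graph ≃g T2.graph, ∀ x : X, φ (T1.leaf x) = T2.leaf x

/-- The support of the path between `a` and `b` in `G` (in a tree or forest
there is at most one such path). -/
def pathSupport {V : Type*} (G : SimpleGraph V) (a b : V) : Set V :=
  {v | ∃ w : G.Walk a b, w.IsPath ∧ v ∈ w.support}

/-- The leaf-labelled graph `(G, l)` displays the quartet `ab|cd`: the path from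
`a` to `b` and the path from `c` to `d` are vertex-disjoint. -/
def QuartetSplit {V X : Type*} (G : SimpleGraph V) (l : X → V) (a b c d : X) : Prop :=
  pathSupport G (l a) (l b) ∩ pathSupport G (l c) (l d) = ∅

/-- `R` is the restriction `T|Y` of `T` to the label set `Y`: the tree obtained
from the minimal subtree of `T` spanning the leaves labelled by `Y` by
suppressing degree-2 vertices. (A binary tree is determined by its displayed
quartets, so this is characterised by: `R` displays exactly the quartets on `Y`
that `T` displays.) -/
def IsRestriction {V X W : Type*} (T : PhyloTree V X) (Y : Set X)
    (R : PhyloTree W {x : X // x ∈ Y}) : Prop :=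
  ∀ a b c d : {x : X // x ∈ Y},
    a ≠ b → a ≠ c → a ≠ d → b ≠ c → b ≠ d → c ≠ d →
    (QuartetSplit R.graph R.leaf a b c d ↔ QuartetSplit T.graph T.leaf a.1 b.1 c.1 d.1)

/-- The edge `{a, b}` of the tree `T` induces the split `Xs | Xss`: deleting it
separates the leaves labelled by `Xs` (on the `a` side) from those labelled by
`Xss` (on the `b` side). -/
def SplitAt {V X : Type*} (T : PhyloTree V X) (Xs Xss : Set X) (a b : V) : Prop :=
  T.graph.Adj a b ∧
  (∀ x ∈ Xs, (T.graph.deleteEdges {s(a, b)}).Reachable a (T.leaf x)) ∧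
  (∀ x ∈ Xss, (T.graph.deleteEdges {s(a, b)}).Reachable b (T.leaf x))

/-- The display graph of `T1` and `T2` with the two edges `{u1,v1}` (of `T1`)
and `{u2,v2}` (of `T2`) inducing a common split deleted. -/
noncomputable def splitDeletedDisplay {V1 V2 X : Type*} (T1 : PhyloTree V1 X)
    (T2 : PhyloTree V2 X) (u1 v1 : V1) (u2 v2 : V2) :
    SimpleGraph (DisplayVertex T1.leaf T2.leaf) :=
  (displayGraph T1.graph T1.leaf T2.graph T2.leaf).deleteEdges
    {s(toDisplay T1.leaf T2.leaf (Sum.inl u1), toDisplay T1.leaf T2.leaf (Sum.inl v1)),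
     s(toDisplay T1.leaf T2.leaf (Sum.inr u2), toDisplay T1.leaf T2.leaf (Sum.inr v2))}

/-- The connected component of the vertex `r` of `T1` in the display graph with
the two split-inducing edges deleted. -/
noncomputable def splitComponent {V1 V2 X : Type*} (T1 : PhyloTree V1 X)
    (T2 : PhyloTree V2 X) (u1 v1 : V1) (u2 v2 : V2) (r : V1) :
    Set (DisplayVertex T1.leaf T2.leaf) :=
  {w | (splitDeletedDisplay T1 T2 u1 v1 u2 v2).Reachable
    (toDisplay T1.leaf T2.leaf (Sum.inl r)) w}

/-- The "rooted" part `G*` (resp. `G**`) of the display graph on one side of a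
common split: the component of `r` after deleting the two split-inducing edges. -/
noncomputable def splitSide {V1 V2 X : Type*} (T1 : PhyloTree V1 X)
    (T2 : PhyloTree V2 X) (u1 v1 : V1) (u2 v2 : V2) (r : V1) :
    SimpleGraph (splitComponent T1 T2 u1 v1 u2 v2 r) :=
  (splitDeletedDisplay T1 T2 u1 v1 u2 v2).induce (splitComponent T1 T2 u1 v1 u2 v2 r)

/-- The graph `[G*]` (resp. `[G**]`): the side `G*` of the display graph together
with the edge joining its two "roots" `r` (a vertex of `T1`) and `s` (a vertex
of `T2`). -/
noncomputable def splitSidePlus {V1 V2 X : Type*} (T1 : PhyloTree V1 X)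
    (T2 : PhyloTree V2 X) (u1 v1 : V1) (u2 v2 : V2) (r : V1) (s : V2) :
    SimpleGraph (splitComponent T1 T2 u1 v1 u2 v2 r) :=
  SimpleGraph.fromRel (fun x y =>
    (splitDeletedDisplay T1 T2 u1 v1 u2 v2).Adj x.1 y.1 ∨
    (x.1 = toDisplay T1.leaf T2.leaf (Sum.inl r) ∧
     y.1 = toDisplay T1.leaf T2.leaf (Sum.inr s)))

section SepBasics

variable {V : Type*} {G : SimpleGraph V}

/-- `c` separates `a` from `b`: each walk from `a` to `b` goes through `c`. -/
def TSep (G : SimpleGraph V) (c a b : V) : Prop := ∀ w : G.Walk a b, c ∈ w.support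

lemma not_sep_iff {c a b : V} : ¬ TSep G c a b ↔ ∃ w : G.Walk a b, c ∉ w.support := by
  simp [TSep]

lemma TSep.symm {c a b : V} (h : TSep G c a b) : TSep G c b a := by
  intro w
  have := h w.reverse
  simpa using this

lemma sep_comm {c a b : V} : TSep G c a b ↔ TSep G c b a := ⟨TSep.symm, TSep.symm⟩

lemma sep_left (c b : V) : TSep G c c b := fun w => w.start_mem_support

lemma sep_right (c a : V) : TSep G c a c := fun w => w.end_mem_support

lemma sep_self {c a : V} : TSep G c a a ↔ c = a := by
  constructor
  · intro h
    simpa using h Walk.nil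
  · rintro rfl
    exact sep_left _ _

lemma not_sep_trans {c a b d : V} (h1 : ¬ TSep G c a b) (h2 : ¬ TSep G c b d) :
    ¬ TSep G c a d := by
  rw [not_sep_iff] at *
  obtain ⟨w1, h1⟩ := h1
  obtain ⟨w2, h2⟩ := h2
  exact ⟨w1.append w2, by simp [Walk.mem_support_append_iff, h1, h2]⟩

lemma not_sep_adj {c a b : V} (h : G.Adj a b) (ha : c ≠ a) (hb : c ≠ b) : ¬ TSep G c a b := by
  intro hs
  have := hs (Walk.cons h Walk.nil)
  simp [ha, hb] at this

lemma sep_transit {a x b m : V} (h1 : TSep G a x b) (h2 : TSep G m a b) : TSep G m x b := by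
  classical
  intro w
  have ha := h1 w
  have := h2 (w.dropUntil a ha)
  exact w.support_dropUntil_subset_support ha this

lemma ne_of_not_sep_left {c a b : V} (h : ¬ TSep G c a b) : c ≠ a := by
  rintro rfl; exact h (sep_left _ _)

lemma ne_of_not_sep_right {c a b : V} (h : ¬ TSep G c a b) : c ≠ b := by
  rintro rfl; exact h (sep_right _ _)

/-- if `y` is reachable from `u` avoiding `v`, while `c` is not, then `y` is reachable
from `u` avoiding `c`. -/
lemma not_sep_conv {v u y c : V} (h1 : ¬ TSep G v u y) (h2 : TSep G v u c) : ¬ TSep G c u y := by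
  classical
  rw [not_sep_iff] at *
  obtain ⟨w, hw⟩ := h1
  refine ⟨w, fun hc => hw ?_⟩
  exact w.support_takeUntil_subset_support hc (h2 (w.takeUntil c hc))

lemma not_sep_or (hc : G.Connected) {m m' : V} (hne : m ≠ m') (z : V) :
    ¬ TSep G m' m z ∨ ¬ TSep G m m' z := by
  classical
  by_contra! h
  obtain ⟨h1, h2⟩ := h
  obtain ⟨p, hp⟩ := hc.exists_isPath z m
  have hm := h1.symm p
  exact Walk.endpoint_notMem_support_takeUntil hp hm hne (h2.symm (p.takeUntil m' hm))

lemma tsep_or_of_adj (ha : G.IsAcyclic) {m n : V} (h : G.Adj m n) (z : V) :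
    TSep G m n z ∨ TSep G n m z := by
  by_contra! hh
  obtain ⟨h1, h2⟩ := hh
  rw [not_sep_iff] at h1 h2
  obtain ⟨w1, h1⟩ := h1
  obtain ⟨w2, h2⟩ := h2
  have hb := isAcyclic_iff_forall_adj_isBridge.1 ha h
  rw [isBridge_iff_forall_walk_mem_edges] at hb
  have := hb (w2.append w1.reverse)
  rw [Walk.edges_append, List.mem_append, Walk.edges_reverse, List.mem_reverse] at this
  rcases this with h | h
  · exact h2 (w2.snd_mem_support_of_mem_edges h)
  · exact h1 (w1.fst_mem_support_of_mem_edges h)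

lemma tsep_of_nbrs (ha : G.IsAcyclic) {u n n' : V} (h : G.Adj u n) (h' : G.Adj u n')
    (hne : n ≠ n') : TSep G u n n' := by
  rcases tsep_or_of_adj ha h n' with h1 | h1
  · exact h1
  · exact absurd h1 (not_sep_adj h' h.ne' hne)

lemma exists_dir (hc : G.Connected) {c z : V} (hne : c ≠ z) :
    ∃ n, G.Adj c n ∧ ¬ TSep G c n z := by
  obtain ⟨p, hp⟩ := hc.exists_isPath c z
  cases p with
  | nil => exact absurd rfl hne
  | cons h q =>
    rw [Walk.cons_isPath_iff] at hp
    exact ⟨_, h, not_sep_iff.2 ⟨q, hp.2⟩⟩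

lemma dist_lt_of_tsep (hc : G.Connected) {m r i : V} (h : TSep G m r i) (hne : m ≠ i) :
    G.dist r m < G.dist r i := by
  classical
  obtain ⟨w, hw⟩ := hc.exists_walk_length_eq_dist r i
  rw [← hw]
  exact (dist_le _).trans_lt (w.length_takeUntil_lt_length (h w) hne)

lemma not_tsep_of_adj_tsep (hc : G.Connected) {m n : V} (h : G.Adj m n) {z : V}
    (hs : TSep G m n z) : ¬ TSep G n m z := by
  rcases not_sep_or hc h.ne z with h1 | h1
  · exact h1
  · exact absurd hs h1

lemma exists_median (hc : G.Connected) (ha : G.IsAcyclic) (a b c : V) :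
    ∃ m, TSep G m a b ∧ TSep G m b c ∧ TSep G m a c := by
  obtain ⟨w⟩ := hc.preconnected a b
  induction w with
  | nil => exact ⟨_, sep_left _ _, sep_left _ _, sep_left _ _⟩
  | @cons a' a b h q ih =>
    obtain ⟨m, h1, h2, h3⟩ := ih
    rcases tsep_or_of_adj ha h b with hb | hb <;> rcases tsep_or_of_adj ha h c with hcc | hcc
    · -- both beyond a'
      have hb' := not_tsep_of_adj_tsep hc h hb
      have hc' := not_tsep_of_adj_tsep hc h hcc
      have hma : m ≠ a := by
        rintro rfl
        exact not_sep_trans (fun h => hb' h.symm) hc' h2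
      have key : ∀ z, TSep G m a z → TSep G m a' z := by
        intro z hz w
        have := hz (Walk.cons h.symm w)
        simpa [hma] using this
      exact ⟨m, key _ h1, h2, key _ h3⟩
    · have hc' := not_tsep_of_adj_tsep hc h.symm hcc
      refine ⟨a', sep_left _ _, ?_, sep_left _ _⟩
      by_contra hcon
      exact not_sep_trans hc' (fun h => hcon h.symm) hb
    · have hb' := not_tsep_of_adj_tsep hc h.symm hb
      refine ⟨a', sep_left _ _, ?_, sep_left _ _⟩
      by_contra hcon
      exact not_sep_trans hb' hcon hcc
    · exact ⟨m, sep_transit hb h1, h2, sep_transit hcc h3⟩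

lemma pathSupport_eq (ha : G.IsAcyclic) (hc : G.Connected) (a b : V) :
    pathSupport G a b = {c | TSep G c a b} := by
  classical
  ext c
  constructor
  · rintro ⟨w, hw, hcw⟩ w'
    have : (⟨w, hw⟩ : G.Path a b) = ⟨w'.bypass, w'.bypass_isPath⟩ := (ha.subsingleton_path a b).elim _ _
    have h2 : w = w'.bypass := congrArg Subtype.val this
    rw [h2] at hcw
    exact w'.support_bypass_subset_support hcw
  · intro h
    obtain ⟨w, hw⟩ := hc.exists_isPath a b
    exact ⟨w, hw, h w⟩

lemma adj_iff_no_between (hc : G.Connected) (ha : G.IsAcyclic) {v w : V} :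
    G.Adj v w ↔ v ≠ w ∧ ∀ c, TSep G c v w → c = v ∨ c = w := by
  constructor
  · intro h
    refine ⟨h.ne, fun c hcs => ?_⟩
    by_contra! hh
    exact not_sep_adj h hh.1 hh.2 hcs
  · rintro ⟨hne, h⟩
    obtain ⟨n, hn, hs⟩ := exists_dir hc hne
    rcases tsep_or_of_adj ha hn w with h1 | h1
    · exact absurd h1 hs
    · rcases h n h1 with rfl | rfl
      · exact absurd rfl hn.ne
      · exact hn

/-- in each direction of a finite tree there is a vertex with at most one neighbour -/
lemma exists_end [Finite V] (hc : G.Connected) (ha : G.IsAcyclic) {v n : V} (h : G.Adj v n) :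
    ∃ z, ¬ TSep G v n z ∧ ∀ a b, G.Adj z a → G.Adj z b → a = b := by
  have hfin : ({z | ¬ TSep G v n z} : Set V).Finite := Set.toFinite _
  obtain ⟨z, hz, hmax⟩ := hfin.exists_maximalFor (fun z => G.dist v z) _
    ⟨n, by simpa [sep_self] using h.ne⟩
  refine ⟨z, hz, fun a b hza hzb => ?_⟩
  by_contra hab
  have hz' : ¬ TSep G v n z := hz
  have hzv : v ≠ z := ne_of_not_sep_right hz'
  -- one of a, b is not towards v
  have key : ∀ c, G.Adj z c → ¬ TSep G z c v := by
    intro c hzc hs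
    have hcv : v ≠ c := by
      rintro rfl
      exact hzv (sep_self.1 hs).symm
    have h1 : ¬ TSep G v n c := not_sep_trans hz' (not_sep_adj hzc hzv hcv)
    have h2 := dist_lt_of_tsep hc hs.symm hzc.ne
    have h3 := hmax (show c ∈ {z | ¬ TSep G v n z} from h1) h2.le
    simp only at h3
    omega
  exact not_sep_trans (key a hza) (fun h => key b hzb h.symm) (tsep_of_nbrs ha hza hzb hab)

end SepBasics

section Quartets

/-- A tree with vertices of degree at most three, together with some labelled ends. -/
structure LTree {V Y : Type*} (G : SimpleGraph V) (l : Y → V) : Prop where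
  conn : G.Connected
  acyc : G.IsAcyclic
  inj : Function.Injective l
  leaf : ∀ y a b, TSep G (l y) a b → a = l y ∨ b = l y
  deg : ∀ v a b c d, G.Adj v a → G.Adj v b → G.Adj v c → G.Adj v d →
    a = b ∨ a = c ∨ b = c ∨ d = a ∨ d = b ∨ d = c

/-- `m` is the median of three distinct labels. -/
def Med {V Y : Type*} (G : SimpleGraph V) (l : Y → V) (m : V) (x y z : Y) : Prop :=
  (TSep G m (l x) (l y) ∧ TSep G m (l y) (l z) ∧ TSep G m (l x) (l z)) ∧ x ≠ y ∧ y ≠ z ∧ x ≠ z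

/-- Labelled vertices and medians. -/
def GoodV {V Y : Type*} (G : SimpleGraph V) (l : Y → V) (v : V) : Prop :=
  (∃ y, v = l y) ∨ ∃ x y z, Med G l v x y z

/-- Equal label betweenness. -/
def SameProf {V W Y : Type*} (G : SimpleGraph V) (l : Y → V) (H : SimpleGraph W) (k : Y → W)
    (v : V) (w : W) : Prop :=
  ∀ x y, TSep G v (l x) (l y) ↔ TSep H w (k x) (k y)

/-- The quartet `ab|cd`. -/
def QD {V Y : Type*} (G : SimpleGraph V) (l : Y → V) (a b c d : Y) : Prop :=
  ∀ m, TSep G m (l a) (l b) → ¬ TSep G m (l c) (l d)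

variable {V W Y : Type*} {G : SimpleGraph V} {l : Y → V} {H : SimpleGraph W} {k : Y → W}

lemma LTree.quartet (h : LTree G l) (a b c d : Y) :
    QuartetSplit G l a b c d ↔ QD G l a b c d := by
  rw [QuartetSplit, pathSupport_eq h.acyc h.conn, pathSupport_eq h.acyc h.conn]
  simp [QD, Set.eq_empty_iff_forall_notMem]

lemma Med.rot {m : V} {x y z : Y} (h : Med G l m x y z) : Med G l m y z x := by
  obtain ⟨⟨h1, h2, h3⟩, h4, h5, h6⟩ := h
  exact ⟨⟨h2, h3.symm, h1.symm⟩, h5, h6.symm, h4.symm⟩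

lemma LTree.med_ne (h : LTree G l) {m : V} {x y z : Y} (hm : Med G l m x y z) (t : Y) :
    m ≠ l t := by
  rintro rfl
  obtain ⟨⟨h1, h2, h3⟩, h4, h5, h6⟩ := hm
  have h1 := h.leaf _ _ _ h1
  have h2 := h.leaf _ _ _ h2
  have h3 := h.leaf _ _ _ h3
  simp only [h.inj.eq_iff] at h1 h2 h3
  grind

lemma LTree.med_block (h : LTree G l) {m : V} {x y z : Y} (hm : Med G l m x y z) (t : Y) :
    ¬ TSep G m (l t) (l x) ∨ ¬ TSep G m (l t) (l y) ∨ ¬ TSep G m (l t) (l z) := by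
  obtain ⟨a, ha, ha'⟩ := exists_dir h.conn (h.med_ne hm x)
  obtain ⟨b, hb, hb'⟩ := exists_dir h.conn (h.med_ne hm y)
  obtain ⟨c, hc, hc'⟩ := exists_dir h.conn (h.med_ne hm z)
  obtain ⟨d, hd, hd'⟩ := exists_dir h.conn (h.med_ne hm t)
  obtain ⟨⟨h1, h2, h3⟩, -⟩ := hm
  have e : ∀ {p q : Y} {r : V}, ¬ TSep G m r (l p) → ¬ TSep G m r (l q) →
      ¬ TSep G m (l p) (l q) := fun hp hq => not_sep_trans (fun h => hp h.symm) hq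
  rcases h.deg m a b c d ha hb hc hd with rfl | rfl | rfl | rfl | rfl | rfl
  · exact absurd h1 (e ha' hb')
  · exact absurd h3 (e ha' hc')
  · exact absurd h2 (e hb' hc')
  · exact Or.inl (e hd' ha')
  · exact Or.inr (Or.inl (e hd' hb'))
  · exact Or.inr (Or.inr (e hd' hc'))

lemma LTree.med_quartet (h : LTree G l) {m : V} {x y z : Y} (hm : Med G l m x y z) (t : Y) :
    ¬ TSep G m (l t) (l x) ↔ t = x ∨ QD G l t x y z := by
  have hne := h.med_ne hm x
  obtain ⟨⟨h1, h2, h3⟩, h4, h5, h6⟩ := hm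
  constructor
  · intro ht
    refine Or.inr fun c hc hc' => ?_
    by_cases hcm : c = m
    · subst hcm; exact ht hc
    -- c is in the block of x
    have hcx : ¬ TSep G m c (l x) := by
      intro hs
      have := not_sep_conv (fun h => ht h.symm) hs.symm
      exact this hc.symm
    rcases not_sep_or h.conn hcm (l y) with h7 | h7
    · exact not_sep_trans (fun h => hcx h.symm) h7 h1
    rcases not_sep_or h.conn hcm (l z) with h8 | h8
    · exact not_sep_trans (fun h => hcx h.symm) h8 h3
    exact not_sep_trans (fun h => h7 h.symm) h8 hc'
  · rintro (rfl | hq)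
    · rwa [sep_self]
    · intro hs
      exact hq m hs h2

lemma LTree.med_same_aux (h : LTree G l) (h' : LTree H k)
    (hQ : ∀ a b c d : Y, a ≠ b → a ≠ c → a ≠ d → b ≠ c → b ≠ d → c ≠ d →
      (QD G l a b c d ↔ QD H k a b c d))
    {m : V} {m' : W} {x y z : Y} (hm : Med G l m x y z) (hm' : Med H k m' x y z) (t : Y) :
    TSep G m (l t) (l x) ↔ TSep H m' (k t) (k x) := by
  rw [← not_iff_not, h.med_quartet hm, h'.med_quartet hm']
  obtain ⟨-, h4, h5, h6⟩ := hm
  by_cases htx : t = x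
  · simp [htx]
  by_cases hty : t = y
  · subst hty
    have e1 : ¬ QD G l t x t z := fun hq => hq _ (sep_left _ _) (sep_left _ _)
    have e2 : ¬ QD H k t x t z := fun hq => hq _ (sep_left _ _) (sep_left _ _)
    simp [e1, e2]
  by_cases htz : t = z
  · subst htz
    have e1 : ¬ QD G l t x y t := fun hq => hq _ (sep_left _ _) (sep_right _ _)
    have e2 : ¬ QD H k t x y t := fun hq => hq _ (sep_left _ _) (sep_right _ _)
    simp [e1, e2]
  rw [hQ t x y z htx hty htz h4 h6 h5]

lemma LTree.med_prof (h : LTree G l) {m : V} {x y z : Y} (hm : Med G l m x y z) (s t : Y) :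
    ¬ TSep G m (l s) (l t) ↔
      (¬ TSep G m (l s) (l x) ∧ ¬ TSep G m (l t) (l x)) ∨
      (¬ TSep G m (l s) (l y) ∧ ¬ TSep G m (l t) (l y)) ∨
      (¬ TSep G m (l s) (l z) ∧ ¬ TSep G m (l t) (l z)) := by
  constructor
  · intro hs
    have hs' : ¬ TSep G m (l t) (l s) := fun h => hs h.symm
    rcases h.med_block hm s with h1 | h1 | h1
    · exact Or.inl ⟨h1, not_sep_trans hs' h1⟩
    · exact Or.inr (Or.inl ⟨h1, not_sep_trans hs' h1⟩)
    · exact Or.inr (Or.inr ⟨h1, not_sep_trans hs' h1⟩)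
  · have e : ∀ {p : Y}, ¬ TSep G m (l s) (l p) → ¬ TSep G m (l t) (l p) →
        ¬ TSep G m (l s) (l t) := fun hp hq => not_sep_trans hp (fun h => hq h.symm)
    rintro (⟨h1, h2⟩ | ⟨h1, h2⟩ | ⟨h1, h2⟩) <;> exact e h1 h2

lemma LTree.med_same (h : LTree G l) (h' : LTree H k)
    (hQ : ∀ a b c d : Y, a ≠ b → a ≠ c → a ≠ d → b ≠ c → b ≠ d → c ≠ d →
      (QD G l a b c d ↔ QD H k a b c d))
    {m : V} {m' : W} {x y z : Y} (hm : Med G l m x y z) (hm' : Med H k m' x y z) :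
    SameProf G l H k m m' := by
  intro s t
  rw [← not_iff_not, h.med_prof hm, h'.med_prof hm']
  simp only [h.med_same_aux h' hQ hm hm', h.med_same_aux h' hQ hm.rot hm'.rot,
    h.med_same_aux h' hQ hm.rot.rot hm'.rot.rot]

lemma LTree.leaf_sep (h : LTree G l) (x s t : Y) : TSep G (l x) (l s) (l t) ↔ s = x ∨ t = x := by
  constructor
  · intro hs
    simpa [h.inj.eq_iff] using h.leaf _ _ _ hs
  · rintro (rfl | rfl)
    · exact sep_left _ _
    · exact sep_right _ _

lemma LTree.leaf_same (h : LTree G l) (h' : LTree H k) (x : Y) :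
    SameProf G l H k (l x) (k x) := by
  intro s t
  rw [h.leaf_sep, h'.leaf_sep]

lemma LTree.exists_same (h : LTree G l) (h' : LTree H k)
    (hQ : ∀ a b c d : Y, a ≠ b → a ≠ c → a ≠ d → b ≠ c → b ≠ d → c ≠ d →
      (QD G l a b c d ↔ QD H k a b c d))
    {v : V} (hv : GoodV G l v) : ∃ w, GoodV H k w ∧ SameProf G l H k v w := by
  rcases hv with ⟨y, rfl⟩ | ⟨x, y, z, hm⟩
  · exact ⟨k y, Or.inl ⟨y, rfl⟩, h.leaf_same h' y⟩
  · obtain ⟨m', hm'⟩ := exists_median h'.conn h'.acyc (k x) (k y) (k z)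
    have hm' : Med H k m' x y z := ⟨hm', hm.2⟩
    exact ⟨m', Or.inr ⟨x, y, z, hm'⟩, h.med_same h' hQ hm hm'⟩

/-- For `v` good and `c ≠ v` there are labels around `v` not separated by `c`. -/
lemma LTree.around (h : LTree G l) {v c : V} (hv : GoodV G l v) (hne : v ≠ c) :
    ∃ s t, TSep G v (l s) (l t) ∧ ¬ TSep G c (l s) (l t) ∧ ¬ TSep G c (l s) v := by
  rcases hv with ⟨y, rfl⟩ | ⟨x, y, z, ⟨h1, h2, h3⟩, -⟩
  · refine ⟨y, y, sep_left _ _, ?_, ?_⟩ <;> rw [sep_self] <;> exact hne.symm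
  · have key : ∀ s t, TSep G v (l s) (l t) → ¬ TSep G c v (l s) → ¬ TSep G c v (l t) →
        ∃ s t, TSep G v (l s) (l t) ∧ ¬ TSep G c (l s) (l t) ∧ ¬ TSep G c (l s) v := by
      intro s t h0 hs ht
      exact ⟨s, t, h0, not_sep_trans (fun h => hs h.symm) ht, fun h => hs h.symm⟩
    have key2 : ∀ s t, TSep G v (l s) (l t) → ¬ TSep G v c (l s) → ¬ TSep G v c (l t) → False :=
      fun s t h0 hs ht => not_sep_trans (fun h => hs h.symm) ht h0
    rcases not_sep_or h.conn hne (l x) with hx | hx <;>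
    rcases not_sep_or h.conn hne (l y) with hy | hy <;>
    rcases not_sep_or h.conn hne (l z) with hz | hz
    · exact key _ _ h1 hx hy
    · exact key _ _ h1 hx hy
    · exact key _ _ h3 hx hz
    · exact (key2 _ _ h2 hy hz).elim
    · exact key _ _ h2 hy hz
    · exact (key2 _ _ h3 hx hz).elim
    · exact (key2 _ _ h1 hx hy).elim
    · exact (key2 _ _ h1 hx hy).elim

lemma LTree.same_unique (h : LTree G l) {v w : V} (hv : GoodV G l v)
    (hs : SameProf G l G l v w) : v = w := by
  by_contra hne
  obtain ⟨s, t, h1, h2, -⟩ := h.around hv hne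
  exact h2 ((hs s t).1 h1)

lemma LTree.sep_char (h : LTree G l) {c v w : V} (hv : GoodV G l v) (hw : GoodV G l w)
    (hcv : v ≠ c) (hcw : w ≠ c) :
    TSep G c v w ↔ ∃ s t s' t', TSep G v (l s) (l t) ∧ ¬ TSep G c (l s) (l t) ∧
      TSep G w (l s') (l t') ∧ ¬ TSep G c (l s') (l t') ∧ TSep G c (l s) (l s') := by
  have key : ∀ v s t, TSep G v (l s) (l t) → ¬ TSep G c (l s) (l t) → ¬ TSep G c (l s) v := by
    intro v s t h1 h2 h3
    exact not_sep_conv h2 h3 h1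
  constructor
  · intro hs
    obtain ⟨s, t, h1, h2, h3⟩ := h.around hv hcv
    obtain ⟨s', t', h1', h2', h3'⟩ := h.around hw hcw
    refine ⟨s, t, s', t', h1, h2, h1', h2', ?_⟩
    by_contra hcon
    exact not_sep_trans (not_sep_trans (fun h => h3 h.symm) hcon) h3' hs
  · rintro ⟨s, t, s', t', h1, h2, h3, h4, h5⟩
    by_contra hcon
    have a1 := key _ _ _ h1 h2
    have a2 := key _ _ _ h3 h4
    exact not_sep_trans (not_sep_trans a1 hcon) (fun h => a2 h.symm) h5

lemma SameProf.symm {v : V} {w : W} (h : SameProf G l H k v w) : SameProf H k G l w v :=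
  fun x y => (h x y).symm

/-- Two labelled trees with the same quartets have the same good vertices. -/
theorem LTree.exists_map (h : LTree G l) (h' : LTree H k) (hall : ∀ v, GoodV G l v)
    (hQ : ∀ a b c d : Y, a ≠ b → a ≠ c → a ≠ d → b ≠ c → b ≠ d → c ≠ d →
      (QD G l a b c d ↔ QD H k a b c d)) :
    ∃ g : V → W, Function.Injective g ∧ (∀ w, (∃ v, g v = w) ↔ GoodV H k w) ∧
      (∀ y, g (l y) = k y) ∧
      (∀ c v w, TSep G c v w ↔ TSep H (g c) (g v) (g w)) := by
  choose g hg hs using fun v => h.exists_same h' hQ (hall v)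
  have hinj : Function.Injective g := by
    intro v w hvw
    refine h.same_unique (hall v) fun x y => ?_
    rw [hs v x y, hvw, hs w x y]
  refine ⟨g, hinj, fun w => ⟨?_, fun hw => ?_⟩, fun y => ?_, fun c v w => ?_⟩
  · rintro ⟨v, rfl⟩; exact hg v
  · obtain ⟨v, hv, hvs⟩ := h'.exists_same h (fun a b c d h1 h2 h3 h4 h5 h6 =>
      (hQ a b c d h1 h2 h3 h4 h5 h6).symm) hw
    refine ⟨v, h'.same_unique (hg v) fun x y => ?_⟩
    rw [← hs v x y, hvs x y]
  · refine h'.same_unique (hg _) fun x z => ?_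
    rw [← hs _ x z]
    exact h.leaf_same h' y x z
  · by_cases hcv : v = c
    · subst hcv; simp [sep_left]
    by_cases hcw : w = c
    · subst hcw; simp [sep_right]
    rw [h.sep_char (hall v) (hall w) hcv hcw,
      h'.sep_char (hg v) (hg w) (hinj.ne hcv) (hinj.ne hcw)]
    simp only [SameProf] at hs
    simp only [hs]

end Quartets

section PhyloSide

variable {V W X : Type*}

lemma PhyloTree.leaf_nbr (T : PhyloTree V X) (x : X) :
    ∃ n, ∀ m, T.graph.Adj (T.leaf x) m ↔ m = n := by
  obtain ⟨n, hn⟩ := Set.ncard_eq_one.1 (T.leaf_deg x)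
  refine ⟨n, fun m => ?_⟩
  have : m ∈ T.graph.neighborSet (T.leaf x) ↔ m ∈ ({n} : Set V) := by rw [hn]
  simpa using this

lemma PhyloTree.nbrs (T : PhyloTree V X) {v : V} (hv : ∀ x, T.leaf x ≠ v) :
    ∃ a b c, a ≠ b ∧ a ≠ c ∧ b ≠ c ∧ ∀ m, T.graph.Adj v m ↔ m = a ∨ m = b ∨ m = c := by
  obtain ⟨a, b, c, h1, h2, h3, hn⟩ := Set.ncard_eq_three.1 (T.internal_deg v hv)
  refine ⟨a, b, c, h1, h2, h3, fun m => ?_⟩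
  have : m ∈ T.graph.neighborSet v ↔ m ∈ ({a, b, c} : Set V) := by rw [hn]
  simpa using this

lemma PhyloTree.ltree (T : PhyloTree V X) : LTree T.graph T.leaf where
  conn := T.connected
  acyc := T.acyclic
  inj := T.leaf_inj
  leaf := by
    intro y a b hs
    obtain ⟨n, hn⟩ := T.leaf_nbr y
    by_contra! hh
    obtain ⟨a', ha, ha'⟩ := exists_dir T.connected hh.1.symm
    obtain ⟨b', hb, hb'⟩ := exists_dir T.connected hh.2.symm
    rw [hn] at ha hb
    subst ha hb
    exact not_sep_trans (fun h => ha' h.symm) hb' hs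
  deg := by
    intro v a b c d ha hb hc hd
    by_cases hv : ∃ x, T.leaf x = v
    · obtain ⟨x, rfl⟩ := hv
      obtain ⟨n, hn⟩ := T.leaf_nbr x
      rw [hn] at ha hb
      exact Or.inl (ha.trans hb.symm)
    · push Not at hv
      obtain ⟨p, q, r, -, -, -, hn⟩ := T.nbrs hv
      rw [hn] at ha hb hc hd
      grind

lemma LTree.comp {Y Z : Type*} {G : SimpleGraph V} {l : Y → V} (h : LTree G l) (f : Z → Y)
    (hf : Function.Injective f) : LTree G (fun z => l (f z)) where
  conn := h.conn
  acyc := h.acyc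
  inj := h.inj.comp hf
  leaf := fun z => h.leaf (f z)
  deg := h.deg

lemma PhyloTree.exists_leaf (T : PhyloTree V X) {v n : V} (h : T.graph.Adj v n) :
    ∃ x, ¬ TSep T.graph v n (T.leaf x) := by
  have := T.finite
  obtain ⟨z, hz, hend⟩ := exists_end T.connected T.acyclic h
  by_cases hv : ∃ x, T.leaf x = z
  · obtain ⟨x, rfl⟩ := hv
    exact ⟨x, hz⟩
  · push Not at hv
    obtain ⟨p, q, r, h1, -, -, hn⟩ := T.nbrs hv
    exact absurd (hend p q ((hn p).2 (by simp)) ((hn q).2 (by simp))) h1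

/-- from leaves in three different directions we get a median -/
lemma med_of_dirs {Y : Type*} {G : SimpleGraph V} {l : Y → V} (ha : G.IsAcyclic)
    {v a b c : V} {x y z : Y}
    (h1 : a ≠ b) (h2 : a ≠ c) (h3 : b ≠ c) (va : G.Adj v a) (vb : G.Adj v b) (vc : G.Adj v c)
    (hx : ¬ TSep G v a (l x)) (hy : ¬ TSep G v b (l y)) (hz : ¬ TSep G v c (l z)) :
    Med G l v x y z := by
  have key : ∀ {a b : V} {x y : Y}, a ≠ b → G.Adj v a → G.Adj v b → ¬ TSep G v a (l x) →
      ¬ TSep G v b (l y) → TSep G v (l x) (l y) ∧ x ≠ y := by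
    intro a b x y hab va vb hx hy
    have hs : TSep G v (l x) (l y) := by
      by_contra hcon
      exact not_sep_trans (not_sep_trans hx hcon) (fun h => hy h.symm) (tsep_of_nbrs ha va vb hab)
    refine ⟨hs, ?_⟩
    rintro rfl
    rw [sep_self] at hs
    exact ne_of_not_sep_right hx hs
  obtain ⟨a1, a2⟩ := key h1 va vb hx hy
  obtain ⟨b1, b2⟩ := key h3 vb vc hy hz
  obtain ⟨c1, c2⟩ := key h2 va vc hx hz
  exact ⟨⟨a1, b1, c1⟩, a2, b2, c2⟩

lemma PhyloTree.good (T : PhyloTree V X) (v : V) : GoodV T.graph T.leaf v := by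
  by_cases hv : ∃ x, T.leaf x = v
  · obtain ⟨x, rfl⟩ := hv
    exact Or.inl ⟨x, rfl⟩
  · push Not at hv
    obtain ⟨p, q, r, h1, h2, h3, hn⟩ := T.nbrs hv
    have hp := (hn p).2 (by simp)
    have hq := (hn q).2 (by simp)
    have hr := (hn r).2 (by simp)
    obtain ⟨x, hx⟩ := T.exists_leaf hp
    obtain ⟨y, hy⟩ := T.exists_leaf hq
    obtain ⟨z, hz⟩ := T.exists_leaf hr
    exact Or.inr ⟨x, y, z, med_of_dirs T.acyclic h1 h2 h3 hp hq hr hx hy hz⟩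

lemma PhyloTree.exists_ne_label (T : PhyloTree V X) (x : X) : ∃ y, y ≠ x := by
  obtain ⟨n, hn⟩ := T.leaf_nbr x
  obtain ⟨y, hy⟩ := T.exists_leaf ((hn n).2 rfl)
  exact ⟨y, fun h => ne_of_not_sep_right hy (by rw [h])⟩

lemma PhyloTree.not_adj_leaf (T : PhyloTree V X) {x y z : X} (hx : z ≠ x) (hy : z ≠ y) :
    ¬ T.graph.Adj (T.leaf x) (T.leaf y) := by
  intro h
  rcases tsep_or_of_adj T.acyclic h (T.leaf z) with h1 | h1
  · rw [T.ltree.leaf_sep] at h1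
    rcases h1 with h1 | h1
    · exact h.ne (by rw [h1])
    · exact hx h1
  · rw [T.ltree.leaf_sep] at h1
    rcases h1 with h1 | h1
    · exact h.ne (by rw [h1])
    · exact hy h1

/-- `Xs` labels the side of `u` of the edge `uv`. -/
def OnSide (T : PhyloTree V X) (Xs : Set X) (u v : V) : Prop :=
  T.graph.Adj u v ∧ ∀ x, x ∈ Xs ↔ ¬ TSep T.graph v u (T.leaf x)

lemma adj_not_tsep_iff (T : PhyloTree V X) {u v : V} (h : T.graph.Adj u v) (z : V) :
    ¬ TSep T.graph v u z ↔ TSep T.graph u v z := by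
  constructor
  · intro h1
    exact (tsep_or_of_adj T.acyclic h z).resolve_right h1
  · exact not_tsep_of_adj_tsep T.connected h

lemma reachable_delete_iff (T : PhyloTree V X) {u v : V} (h : T.graph.Adj u v) (z : V) :
    (T.graph.deleteEdges {s(u, v)}).Reachable u z ↔ ¬ TSep T.graph v u z := by
  classical
  constructor
  · rintro ⟨w⟩ hs
    have hle : T.graph.deleteEdges {s(u, v)} ≤ T.graph := deleteEdges_le _
    have hv := hs (w.mapLe hle)
    have hv' : v ∈ w.support := by simpa using hv
    have hb := isBridge_iff.1 (isAcyclic_iff_forall_adj_isBridge.1 T.acyclic h)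
    apply hb
    exact ⟨w.takeUntil v hv'⟩
  · intro hs
    rw [not_sep_iff] at hs
    obtain ⟨w, hw⟩ := hs
    refine ⟨w.toDeleteEdges {s(u, v)} ?_⟩
    intro e he
    rintro rfl
    exact hw (w.snd_mem_support_of_mem_edges he)

lemma SplitAt.onSide {T : PhyloTree V X} {Xs Xss : Set X} {u v : V} (h : SplitAt T Xs Xss u v)
    (hcover : Xs ∪ Xss = Set.univ) : OnSide T Xs u v := by
  obtain ⟨h1, h2, h3⟩ := h
  refine ⟨h1, fun x => ⟨fun hx => (reachable_delete_iff T h1 _).1 (h2 x hx), fun hx => ?_⟩⟩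
  by_contra hxs
  have hx2 : x ∈ Xss := by
    have : x ∈ Xs ∪ Xss := by rw [hcover]; trivial
    exact this.resolve_left hxs
  have := h3 x hx2
  rw [Sym2.eq_swap, reachable_delete_iff T h1.symm, adj_not_tsep_iff T h1.symm] at this
  exact hx this

lemma SplitAt.swap {T : PhyloTree V X} {Xs Xss : Set X} {u v : V} (h : SplitAt T Xs Xss u v) :
    SplitAt T Xss Xs v u := by
  obtain ⟨h1, h2, h3⟩ := h
  refine ⟨h1.symm, ?_, ?_⟩ <;> rw [Sym2.eq_swap] <;> assumption

lemma OnSide.not_leaf {T : PhyloTree V X} {Xs : Set X} {u v : V} (h : OnSide T Xs u v)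
    {x y : X} (hx : x ∈ Xs) (hy : y ∈ Xs) (hxy : x ≠ y) (z : X) : T.leaf z ≠ u := by
  rintro rfl
  have key : ∀ x ∈ Xs, x = z := by
    intro x hx
    have h1 := (adj_not_tsep_iff T h.1 _).1 ((h.2 x).1 hx)
    rcases T.ltree.leaf _ _ _ h1 with h2 | h2
    · exact absurd h2 h.1.ne'
    · exact T.leaf_inj h2
  exact hxy ((key x hx).trans (key y hy).symm)

/-- the good vertices of a side. -/
lemma OnSide.good_iff {T : PhyloTree V X} {Xs : Set X} {u v : V} (h : OnSide T Xs u v)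
    (hu : ∀ x, T.leaf x ≠ u) (c : V) :
    GoodV T.graph (fun x : {x // x ∈ Xs} => T.leaf x.1) c ↔ ¬ TSep T.graph v u c ∧ c ≠ u := by
  have hL : LTree T.graph (fun x : {x // x ∈ Xs} => T.leaf x.1) :=
    T.ltree.comp Subtype.val Subtype.val_injective
  obtain ⟨p, q, r, hpq, hpr, hqr, hn⟩ := T.nbrs hu
  obtain ⟨a, b, hab, hav, hbv, hn⟩ : ∃ a b, a ≠ b ∧ a ≠ v ∧ b ≠ v ∧
      ∀ m, T.graph.Adj u m ↔ m = v ∨ m = a ∨ m = b := by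
    rcases (hn v).1 h.1 with rfl | rfl | rfl
    · exact ⟨q, r, hqr, hpq.symm, hpr.symm, hn⟩
    · exact ⟨p, r, hpr, hpq, hqr.symm, fun m => by rw [hn]; tauto⟩
    · exact ⟨p, q, hpq, hpr, hqr, fun m => by rw [hn]; tauto⟩
  have hua := (hn a).2 (by simp)
  have hub := (hn b).2 (by simp)
  constructor
  · rintro (⟨y, rfl⟩ | ⟨x, y, z, hm⟩)
    · exact ⟨(h.2 _).1 y.2, hu _⟩
    · constructor
      · intro hs
        have h1 := not_sep_conv ((h.2 _).1 x.2) hs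
        have h2 := not_sep_conv ((h.2 _).1 y.2) hs
        exact not_sep_trans (fun h => h1 h.symm) h2 hm.1.1
      · rintro rfl
        have key : ∀ x : {x // x ∈ Xs}, ¬ TSep T.graph c a (T.leaf x) ∨
            ¬ TSep T.graph c b (T.leaf x) := by
          intro x
          obtain ⟨n, hcn, hs⟩ := exists_dir T.connected (hu x).symm
          rcases (hn n).1 hcn with rfl | rfl | rfl
          · exact absurd ((adj_not_tsep_iff T h.1 _).1 ((h.2 _).1 x.2)) hs
          · exact Or.inl hs
          · exact Or.inr hs
        have e : ∀ {d : V} {x y : {x // x ∈ Xs}}, ¬ TSep T.graph c d (T.leaf x) →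
            ¬ TSep T.graph c d (T.leaf y) → TSep T.graph c (T.leaf x) (T.leaf y) → False :=
          fun h1 h2 h3 => not_sep_trans (fun h => h1 h.symm) h2 h3
        obtain ⟨⟨h1, h2, h3⟩, -⟩ := hm
        rcases key x with hx | hx <;> rcases key y with hy | hy <;> rcases key z with hz | hz
        · exact e hx hy h1
        · exact e hx hy h1
        · exact e hx hz h3
        · exact e hy hz h2
        · exact e hy hz h2
        · exact e hx hz h3
        · exact e hx hy h1
        · exact e hx hy h1
  · rintro ⟨hc, hcu⟩
    by_cases hv : ∃ x, T.leaf x = c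
    · obtain ⟨x, rfl⟩ := hv
      exact Or.inl ⟨⟨x, (h.2 x).2 hc⟩, rfl⟩
    · push Not at hv
      have hcv : c ≠ v := (ne_of_not_sep_right hc).symm
      have key : ∀ n, T.graph.Adj c n → ∃ x : {x // x ∈ Xs}, ¬ TSep T.graph c n (T.leaf x) := by
        intro n hcn
        obtain ⟨x, hx⟩ := T.exists_leaf hcn
        by_cases hxs : x ∈ Xs
        · exact ⟨⟨x, hxs⟩, hx⟩
        · -- then `u` is in the direction of `n`
          have h1 : ¬ TSep T.graph u v (T.leaf x) := by
            rw [adj_not_tsep_iff T h.1.symm]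
            by_contra hcon
            exact hxs ((h.2 x).2 hcon)
          have h2 : ¬ TSep T.graph c v (T.leaf x) :=
            not_sep_conv h1 ((adj_not_tsep_iff T h.1 _).1 hc)
          have h3 : ¬ TSep T.graph c n u :=
            not_sep_trans (not_sep_trans hx (fun h => h2 h.symm)) (not_sep_adj h.1.symm hcv hcu)
          obtain ⟨d, hud, hdv, hd⟩ : ∃ d, T.graph.Adj u d ∧ d ≠ v ∧ TSep T.graph u d c := by
            by_contra! hcon
            exact not_sep_trans (hcon a hua hav) (fun h => hcon b hub hbv h.symm)
              (tsep_of_nbrs T.acyclic hua hub hab)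
          obtain ⟨y, hy⟩ := T.exists_leaf hud
          have hyC : y ∈ Xs := by
            rw [h.2, adj_not_tsep_iff T h.1]
            by_contra hcon
            exact not_sep_trans hy (fun h => hcon h.symm) (tsep_of_nbrs T.acyclic hud h.1 hdv)
          refine ⟨⟨y, hyC⟩, ?_⟩
          have hcd : c ≠ d := by
            rintro rfl
            rw [sep_self] at hd
            exact hcu hd.symm
          exact not_sep_trans h3 (not_sep_trans (not_sep_adj hud hcu hcd) (not_sep_conv hy hd))
      obtain ⟨p, q, r, hpq, hpr, hqr, hn⟩ := T.nbrs hv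
      have hp := (hn p).2 (by simp)
      have hq := (hn q).2 (by simp)
      have hr := (hn r).2 (by simp)
      obtain ⟨x, hx⟩ := key p hp
      obtain ⟨y, hy⟩ := key q hq
      obtain ⟨z, hz⟩ := key r hr
      exact Or.inr ⟨x, y, z, med_of_dirs (l := fun x : {x // x ∈ Xs} => T.leaf x.1)
        T.acyclic hpq hpr hqr hp hq hr hx hy hz⟩

/-- The restriction to a side is the side with its root suppressed. -/
theorem OnSide.exists_map {T : PhyloTree V X} {Xs : Set X} {u v : V} (h : OnSide T Xs u v)
    (hu : ∀ x, T.leaf x ≠ u) {R : PhyloTree W {x : X // x ∈ Xs}} (hR : IsRestriction T Xs R) :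
    ∃ (g : W → V) (a b : V), Function.Injective g ∧
      (∀ c, (∃ w, g w = c) ↔ ¬ TSep T.graph v u c ∧ c ≠ u) ∧
      (∀ x, g (R.leaf x) = T.leaf x.1) ∧
      a ≠ b ∧ a ≠ v ∧ b ≠ v ∧ (∀ m, T.graph.Adj u m ↔ m = v ∨ m = a ∨ m = b) ∧
      (∀ w w', R.graph.Adj w w' ↔ T.graph.Adj (g w) (g w') ∨ (g w = a ∧ g w' = b) ∨
        (g w = b ∧ g w' = a)) := by
  have hL : LTree T.graph (fun x : {x // x ∈ Xs} => T.leaf x.1) :=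
    T.ltree.comp Subtype.val Subtype.val_injective
  obtain ⟨p, q, r, hpq, hpr, hqr, hn⟩ := T.nbrs hu
  obtain ⟨a, b, hab, hav, hbv, hn⟩ : ∃ a b, a ≠ b ∧ a ≠ v ∧ b ≠ v ∧
      ∀ m, T.graph.Adj u m ↔ m = v ∨ m = a ∨ m = b := by
    rcases (hn v).1 h.1 with rfl | rfl | rfl
    · exact ⟨q, r, hqr, hpq.symm, hpr.symm, hn⟩
    · exact ⟨p, r, hpr, hpq, hqr.symm, fun m => by rw [hn]; tauto⟩
    · exact ⟨p, q, hpq, hpr, hqr, fun m => by rw [hn]; tauto⟩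
  have hua := (hn a).2 (by simp)
  have hub := (hn b).2 (by simp)
  obtain ⟨g, hinj, hrange, hleaf, hsep⟩ := R.ltree.exists_map hL R.good (by
    intro a b c d h1 h2 h3 h4 h5 h6
    rw [← R.ltree.quartet, ← hL.quartet]
    exact hR a b c d h1 h2 h3 h4 h5 h6)
  simp only [h.good_iff hu] at hrange
  refine ⟨g, a, b, hinj, hrange, hleaf, hab, hav, hbv, hn, fun w w' => ?_⟩
  have hC : ∀ n, T.graph.Adj u n → n ≠ v → ∃ z, g z = n := by
    intro n hun hnv
    refine (hrange n).2 ⟨not_sep_adj hun h.1.ne' hnv.symm, hun.ne'⟩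
  rw [adj_iff_no_between R.connected R.acyclic]
  constructor
  · rintro ⟨hne, hbt⟩
    have hbt' : ∀ c, ¬ TSep T.graph v u c → c ≠ u → TSep T.graph c (g w) (g w') →
        c = g w ∨ c = g w' := by
      intro c hc hcu hs
      obtain ⟨z, rfl⟩ := (hrange c).2 ⟨hc, hcu⟩
      rcases hbt z ((hsep _ _ _).2 hs) with rfl | rfl <;> simp
    have hw := (hrange (g w)).1 ⟨w, rfl⟩
    have hw' := (hrange (g w')).1 ⟨w', rfl⟩
    by_cases hus : TSep T.graph u (g w) (g w')
    · right
      have hdir : ∀ w w', ¬ TSep T.graph v u (g w) → g w ≠ u → TSep T.graph u (g w) (g w') →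
          (∀ c, ¬ TSep T.graph v u c → c ≠ u → TSep T.graph c (g w) (g w') →
            c = g w ∨ c = g w') → g w = a ∨ g w = b := by
        intro w w' hw hwu hus hbt
        obtain ⟨n, hun, hns⟩ := exists_dir T.connected hwu.symm
        have hnv : n ≠ v := by
          rintro rfl
          exact hns ((adj_not_tsep_iff T h.1 _).1 hw)
        have h1 : TSep T.graph n u (g w) :=
          (tsep_or_of_adj T.acyclic hun (g w)).resolve_left hns
        have h2 : TSep T.graph n (g w) (g w') := (sep_transit hus.symm h1).symm
        rcases hbt n (not_sep_adj hun h.1.ne' hnv.symm) hun.ne' h2 with h3 | h3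
        · rcases (hn n).1 hun with h4 | h4 | h4
          · exact absurd h4 hnv
          · exact Or.inl (h3.symm.trans h4)
          · exact Or.inr (h3.symm.trans h4)
        · rw [h3] at hns
          exact absurd hus.symm hns
      have e1 := hdir w w' hw.1 hw.2 hus hbt'
      have e2 := hdir w' w hw'.1 hw'.2 hus.symm (fun c h1 h2 h3 => (hbt' c h1 h2 h3.symm).symm)
      have hne' := hinj.ne hne
      grind
    · left
      rw [adj_iff_no_between T.connected T.acyclic]
      refine ⟨hinj.ne hne, fun c hc => ?_⟩
      have hcu : c ≠ u := by
        rintro rfl; exact hus hc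
      refine hbt' c ?_ hcu hc
      intro hs
      have h1 := not_sep_conv hw.1 hs
      have h2 := not_sep_conv hw'.1 hs
      exact not_sep_trans (fun h => h1 h.symm) h2 hc
  · intro hadj
    have hab' : ∀ c, TSep T.graph c a b → c = a ∨ c = b ∨ c = u := by
      intro c hc
      by_contra! hh
      exact not_sep_trans (not_sep_adj hua.symm hh.1 hh.2.2) (not_sep_adj hub hh.2.2 hh.2.1) hc
    have hgu : ∀ z, g z ≠ u := fun z => ((hrange (g z)).1 ⟨z, rfl⟩).2
    rcases hadj with hadj | ⟨h1, h2⟩ | ⟨h1, h2⟩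
    · rw [adj_iff_no_between T.connected T.acyclic] at hadj
      refine ⟨fun h => hadj.1 (by rw [h]), fun c hc => ?_⟩
      rw [hsep] at hc
      rcases hadj.2 _ hc with h | h
      · exact Or.inl (hinj h)
      · exact Or.inr (hinj h)
    · refine ⟨fun h => hab (by rw [← h1, ← h2, h]), fun c hc => ?_⟩
      rw [hsep, h1, h2] at hc
      rcases hab' _ hc with h | h | h
      · exact Or.inl (hinj (h.trans h1.symm))
      · exact Or.inr (hinj (h.trans h2.symm))
      · exact absurd h (hgu c)
    · refine ⟨fun h => hab (by rw [← h1, ← h2, h]), fun c hc => ?_⟩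
      rw [hsep, h1, h2] at hc
      rcases hab' _ hc.symm with h | h | h
      · exact Or.inr (hinj (h.trans h2.symm))
      · exact Or.inl (hinj (h.trans h1.symm))
      · exact absurd h (hgu c)

/-- Trees with the same quartets are compatible. -/
theorem compatible_of_quartets {V' : Type*} (T1 : PhyloTree V X) (T2 : PhyloTree V' X)
    (hQ : ∀ a b c d : X, a ≠ b → a ≠ c → a ≠ d → b ≠ c → b ≠ d → c ≠ d →
      (QD T1.graph T1.leaf a b c d ↔ QD T2.graph T2.leaf a b c d)) : Compatible T1 T2 := by
  obtain ⟨g, hinj, hrange, hleaf, hsep⟩ := T1.ltree.exists_map T2.ltree T1.good hQ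
  have hsurj : Function.Surjective g := fun w => (hrange w).2 (T2.good w)
  refine ⟨⟨Equiv.ofBijective g ⟨hinj, hsurj⟩, ?_⟩, hleaf⟩
  intro v w
  change T2.graph.Adj (g v) (g w) ↔ T1.graph.Adj v w
  rw [adj_iff_no_between T1.connected T1.acyclic, adj_iff_no_between T2.connected T2.acyclic]
  simp only [hsep, hsurj.forall, hinj.eq_iff, hinj.ne_iff]

/-- quartets across a split with two labels on each side -/
lemma OnSide.quartet {T : PhyloTree V X} {Xs : Set X} {u v : V} (HH : OnSide T Xs u v)
    {a b c d : X} (ha : a ∈ Xs) (hb : b ∈ Xs) (hc : c ∉ Xs) (hd : d ∉ Xs) :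
    QD T.graph T.leaf a b c d := by
  intro m h1 h2
  have key : ∀ x ∉ Xs, ¬ TSep T.graph u v (T.leaf x) := by
    intro x hx
    rw [adj_not_tsep_iff T HH.1.symm]
    by_contra hcon
    exact hx ((HH.2 x).2 hcon)
  by_cases hm : TSep T.graph v u m
  · exact not_sep_trans (fun h => not_sep_conv ((HH.2 a).1 ha) hm h.symm)
      (not_sep_conv ((HH.2 b).1 hb) hm) h1
  · rw [adj_not_tsep_iff T HH.1] at hm
    exact not_sep_trans (fun h => not_sep_conv (key c hc) hm h.symm)
      (not_sep_conv (key d hd) hm) h2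

end PhyloSide

section TreewidthLib

/-- Tree decompositions of the relation `E` on the vertex set `S`, inside an ambient type. -/
def TDOn {V : Type*} (S : Set V) (E : V → V → Prop) (k : ℕ) : Prop :=
  ∃ (n : ℕ) (t : SimpleGraph (Fin (n + 1))) (bag : Fin (n + 1) → Finset V),
    t.IsTree ∧
    (∀ i, ∀ v ∈ bag i, v ∈ S) ∧
    (∀ v ∈ S, ∃ i, v ∈ bag i) ∧
    (∀ u ∈ S, ∀ v ∈ S, E u v → ∃ i, u ∈ bag i ∧ v ∈ bag i) ∧
    (∀ v ∈ S, (t.induce {i | v ∈ bag i}).Connected) ∧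
    (∀ i, (bag i).card ≤ k + 1)

variable {V W : Type*}

/-- an arbitrary finite index type suffices -/
lemma TDOn.of_index {S : Set V} {E : V → V → Prop} {k : ℕ} {ι : Type} [Finite ι] [Nonempty ι]
    (t : SimpleGraph ι) (bag : ι → Finset V) (ht : t.IsTree)
    (h0 : ∀ i, ∀ v ∈ bag i, v ∈ S)
    (h1 : ∀ v ∈ S, ∃ i, v ∈ bag i)
    (h2 : ∀ u ∈ S, ∀ v ∈ S, E u v → ∃ i, u ∈ bag i ∧ v ∈ bag i)
    (h3 : ∀ v ∈ S, (t.induce {i | v ∈ bag i}).Connected)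
    (h4 : ∀ i, (bag i).card ≤ k + 1) : TDOn S E k := by
  have hpos : 0 < Nat.card ι := Nat.card_pos
  obtain ⟨n, hn⟩ : ∃ n, Nat.card ι = n + 1 := ⟨Nat.card ι - 1, by omega⟩
  have e : Fin (n + 1) ≃ ι := (Finite.equivFinOfCardEq hn).symm
  refine ⟨n, t.comap e, fun i => bag (e i), ?_, fun i => h0 _, ?_, ?_, ?_, fun i => h4 _⟩
  · exact (SimpleGraph.Iso.comap e t).isTree_iff.2 ht
  · intro v hv
    obtain ⟨i, hi⟩ := h1 v hv
    exact ⟨e.symm i, by simpa using hi⟩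
  · intro u hu v hv he
    obtain ⟨i, hi⟩ := h2 u hu v hv he
    exact ⟨e.symm i, by simpa using hi⟩
  · intro v hv
    refine (Iso.connected_iff ?_).2 (h3 v hv)
    exact
      { toEquiv := e.subtypeEquiv (fun i => by simp)
        map_rel_iff' := by intro a b; rfl }

/-- image of a tree decomposition under a map with connected fibres -/
lemma HasTreeDecompWidthLE.map {G : SimpleGraph V} {k : ℕ} (h : HasTreeDecompWidthLE G k)
    (f : V → W) {S : Set W} (hS : ∀ w, w ∈ S ↔ ∃ v, f v = w) (E : W → W → Prop)
    (hf : ∀ w, (G.induce {x | f x = w}).Preconnected)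
    (hE : ∀ a ∈ S, ∀ b ∈ S, E a b → a = b ∨ ∃ v v', f v = a ∧ f v' = b ∧ G.Adj v v') :
    TDOn S E k := by
  classical
  obtain ⟨n, t, bag, ht, h1, h2, h3, h4⟩ := h
  refine ⟨n, t, fun i => (bag i).image f, ht, ?_, ?_, ?_, ?_, ?_⟩
  · intro i w hw
    obtain ⟨v, -, rfl⟩ := Finset.mem_image.1 hw
    exact (hS _).2 ⟨v, rfl⟩
  · intro w hw
    obtain ⟨v, rfl⟩ := (hS _).1 hw
    obtain ⟨i, hi⟩ := h1 v
    exact ⟨i, Finset.mem_image_of_mem _ hi⟩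
  · intro a ha b hb hab
    rcases hE a ha b hb hab with rfl | ⟨v, v', rfl, rfl, hvv⟩
    · obtain ⟨v, rfl⟩ := (hS _).1 ha
      obtain ⟨i, hi⟩ := h1 v
      exact ⟨i, Finset.mem_image_of_mem _ hi, Finset.mem_image_of_mem _ hi⟩
    · obtain ⟨i, hi, hi'⟩ := h2 _ _ hvv
      exact ⟨i, Finset.mem_image_of_mem _ hi, Finset.mem_image_of_mem _ hi'⟩
  · intro w hw
    obtain ⟨v0, rfl⟩ := (hS _).1 hw
    -- reachability inside the nodes of one vertex
    have hin : ∀ v (hv : f v = f v0) i j (hi : v ∈ bag i) (hj : v ∈ bag j),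
        (t.induce {i | f v0 ∈ (bag i).image f}).Reachable
          ⟨i, Finset.mem_image.2 ⟨v, hi, hv⟩⟩ ⟨j, Finset.mem_image.2 ⟨v, hj, hv⟩⟩ := by
      intro v hv i j hi hj
      have hr := (h3 v).preconnected ⟨i, hi⟩ ⟨j, hj⟩
      exact hr.map (G' := t.induce {i | f v0 ∈ (bag i).image f})
        ⟨fun x => ⟨x.1, Finset.mem_image.2 ⟨v, x.2, hv⟩⟩, fun {a b} h => h⟩
    have hwalk : ∀ (x y : {x | f x = f v0}), (G.induce {x | f x = f v0}).Reachable x y →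
        ∀ i j (hi : x.1 ∈ bag i) (hj : y.1 ∈ bag j),
        (t.induce {i | f v0 ∈ (bag i).image f}).Reachable
          ⟨i, Finset.mem_image.2 ⟨_, hi, x.2⟩⟩ ⟨j, Finset.mem_image.2 ⟨_, hj, y.2⟩⟩ := by
      rintro x y ⟨w⟩
      induction w with
      | @nil x => intro i j hi hj; exact hin _ x.2 i j hi hj
      | @cons x z y hxz q ih =>
        intro i j hi hj
        obtain ⟨m, hm, hm'⟩ := h2 _ _ hxz
        exact (hin _ x.2 i m hi hm).trans (ih m j hm' hj)
    rw [connected_iff]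
    constructor
    · rintro ⟨i, hi⟩ ⟨j, hj⟩
      obtain ⟨v, hv, hvf⟩ := Finset.mem_image.1 hi
      obtain ⟨v', hv', hvf'⟩ := Finset.mem_image.1 hj
      exact hwalk _ _ (hf (f v0) ⟨v, hvf⟩ ⟨v', hvf'⟩) i j hv hv'
    · obtain ⟨i, hi⟩ := h1 v0
      exact ⟨⟨i, Finset.mem_image_of_mem _ hi⟩⟩
  · intro i
    exact Finset.card_image_le.trans (h4 i)

lemma HasTreeDecompWidthLE.map_inj {G : SimpleGraph V} {k : ℕ} (h : HasTreeDecompWidthLE G k)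
    (f : V → W) (hinj : Function.Injective f) {S : Set W} (hS : ∀ w, w ∈ S ↔ ∃ v, f v = w)
    (E : W → W → Prop)
    (hE : ∀ a ∈ S, ∀ b ∈ S, E a b → a = b ∨ ∃ v v', f v = a ∧ f v' = b ∧ G.Adj v v') :
    TDOn S E k := by
  refine h.map f hS E (fun w => ?_) hE
  rintro ⟨v, hv⟩ ⟨v', hv'⟩
  obtain rfl := hinj (hv.trans hv'.symm)
  exact Reachable.refl _

/-- pulling back along an injective map -/
lemma TDOn.pull {S : Set W} {E : W → W → Prop} {k : ℕ} (h : TDOn S E k)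
    {G : SimpleGraph V} (f : V → W) (hinj : Function.Injective f) (hS : ∀ v, f v ∈ S)
    (hE : ∀ a b, G.Adj a b → E (f a) (f b)) : HasTreeDecompWidthLE G k := by
  classical
  obtain ⟨n, t, bag, ht, h0, h1, h2, h3, h4⟩ := h
  refine ⟨n, t, fun i => (bag i).preimage f hinj.injOn, ht, ?_, ?_, ?_, ?_⟩
  · intro v
    obtain ⟨i, hi⟩ := h1 _ (hS v)
    exact ⟨i, by simpa using hi⟩
  · intro u v huv
    obtain ⟨i, hi⟩ := h2 _ (hS u) _ (hS v) (hE _ _ huv)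
    exact ⟨i, by simpa using hi⟩
  · intro v
    have : {i | v ∈ (bag i).preimage f hinj.injOn} = {i | f v ∈ bag i} := by ext; simp
    rw [this]
    exact h3 _ (hS v)
  · intro i
    refine le_trans ?_ (h4 i)
    exact Finset.card_le_card_of_injOn f (by intro x hx; simpa using hx) hinj.injOn

lemma TDOn.small {s : Finset V} (E : V → V → Prop) {k : ℕ} (hs : s.card ≤ k + 1) :
    TDOn (s : Set V) E k := by
  refine TDOn.of_index (ι := Unit) ⊥ (fun _ => s) IsTree.of_subsingleton ?_ ?_ ?_ ?_ ?_
  · intro i v hv; exact hv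
  · intro v hv; exact ⟨(), hv⟩
  · intro u hu v hv _; exact ⟨(), hu, hv⟩
  · intro v hv
    have : Nonempty {i : Unit | v ∈ s} := ⟨⟨(), hv⟩⟩
    exact Connected.of_subsingleton
  · intro _; exact hs

lemma isTree_sum_edge {ι κ : Type} [Finite ι] [Finite κ] {t1 : SimpleGraph ι} {t2 : SimpleGraph κ}
    (h1 : t1.IsTree) (h2 : t2.IsTree) (i : ι) (j : κ) :
    ((t1 ⊕g t2) ⊔ edge (Sum.inl i) (Sum.inr j)).IsTree := by
  have hc := h1.connected.sum_sup_edge (v := i) (w := j) h2.connected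
  rw [isTree_iff_connected_and_card] at h1 h2 ⊢
  refine ⟨hc, ?_⟩
  have e1 : ((t1 ⊕g t2) ⊔ edge (Sum.inl i) (Sum.inr j)).edgeSet =
      insert s(Sum.inl i, Sum.inr j) (t1 ⊕g t2).edgeSet := by
    rw [edgeSet_sup, edgeSet_edge]
    ext x
    simp only [Set.mem_union, Set.mem_sdiff, Set.mem_singleton_iff, Set.mem_insert_iff]
    constructor
    · rintro (h | ⟨h, -⟩)
      · exact Or.inr h
      · exact Or.inl h
    · rintro (h | h)
      · refine Or.inr ⟨h, ?_⟩
        rw [h]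
        simp
      · exact Or.inl h
  rw [e1, Nat.card_coe_set_eq, Set.ncard_insert_of_notMem (by simp) (Set.toFinite _),
    ← Nat.card_coe_set_eq, Nat.card_congr (edgeSetSumEquiv (G := t1) (H := t2)), Nat.card_sum,
    Nat.card_sum]
  omega

/-- gluing along an edge -/
lemma TDOn.glue {S1 S2 : Set V} {E : V → V → Prop} {k : ℕ} (h1 : TDOn S1 E k) (h2 : TDOn S2 E k)
    {a b : V} (ha1 : a ∈ S1) (ha2 : a ∈ S2) (hb1 : b ∈ S1) (hb2 : b ∈ S2) (hab : E a b)
    (hS : ∀ x, x ∈ S1 → x ∈ S2 → x = a ∨ x = b)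
    (hE : ∀ x ∈ S1 ∪ S2, ∀ y ∈ S1 ∪ S2, E x y → (x ∈ S1 ∧ y ∈ S1) ∨ (x ∈ S2 ∧ y ∈ S2)) :
    TDOn (S1 ∪ S2) E k := by
  obtain ⟨n, t, bag, ht, p0, p1, p2, p3, p4⟩ := h1
  obtain ⟨m, t', bag', ht', q0, q1, q2, q3, q4⟩ := h2
  obtain ⟨i0, hai, hbi⟩ := p2 a ha1 b hb1 hab
  obtain ⟨j0, haj, hbj⟩ := q2 a ha2 b hb2 hab
  refine TDOn.of_index ((t ⊕g t') ⊔ edge (Sum.inl i0) (Sum.inr j0)) (Sum.elim bag bag')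
    (isTree_sum_edge ht ht' i0 j0) ?_ ?_ ?_ ?_ ?_
  · rintro (i | i) v hv
    · exact Or.inl (p0 i v hv)
    · exact Or.inr (q0 i v hv)
  · rintro v (hv | hv)
    · obtain ⟨i, hi⟩ := p1 v hv
      exact ⟨Sum.inl i, hi⟩
    · obtain ⟨i, hi⟩ := q1 v hv
      exact ⟨Sum.inr i, hi⟩
  · intro x hx y hy hxy
    rcases hE x hx y hy hxy with ⟨h1, h2⟩ | ⟨h1, h2⟩
    · obtain ⟨i, hi⟩ := p2 x h1 y h2 hxy
      exact ⟨Sum.inl i, hi⟩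
    · obtain ⟨i, hi⟩ := q2 x h1 y h2 hxy
      exact ⟨Sum.inr i, hi⟩
  · intro v hv
    set T := ((t ⊕g t') ⊔ edge (Sum.inl i0) (Sum.inr j0)) with hT
    set N : Set (Fin (n+1) ⊕ Fin (m+1)) := {i | v ∈ Sum.elim bag bag' i} with hN
    have rl : ∀ i i' (hi : v ∈ bag i) (hi' : v ∈ bag i'),
        (T.induce N).Reachable ⟨Sum.inl i, hi⟩ ⟨Sum.inl i', hi'⟩ := by
      intro i i' hi hi'
      have hr := (p3 v (p0 _ _ hi)).preconnected ⟨i, hi⟩ ⟨i', hi'⟩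
      exact hr.map (G' := T.induce N)
        ⟨fun x => ⟨Sum.inl x.1, x.2⟩, fun {a b} h => by
          have h' : t.Adj a.1 b.1 := h
          simp [hT, h']⟩
    have rr : ∀ i i' (hi : v ∈ bag' i) (hi' : v ∈ bag' i'),
        (T.induce N).Reachable ⟨Sum.inr i, hi⟩ ⟨Sum.inr i', hi'⟩ := by
      intro i i' hi hi'
      have hr := (q3 v (q0 _ _ hi)).preconnected ⟨i, hi⟩ ⟨i', hi'⟩
      exact hr.map (G' := T.induce N)
        ⟨fun x => ⟨Sum.inr x.1, x.2⟩, fun {a b} h => by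
          have h' : t'.Adj a.1 b.1 := h
          simp [hT, h']⟩
    have rlr : ∀ i i' (hi : v ∈ bag i) (hi' : v ∈ bag' i'),
        (T.induce N).Reachable ⟨Sum.inl i, hi⟩ ⟨Sum.inr i', hi'⟩ := by
      intro i i' hi hi'
      have hv0 : v ∈ bag i0 ∧ v ∈ bag' j0 := by
        rcases hS v (p0 _ _ hi) (q0 _ _ hi') with rfl | rfl
        · exact ⟨hai, haj⟩
        · exact ⟨hbi, hbj⟩
      have : (T.induce N).Adj ⟨Sum.inl i0, hv0.1⟩ ⟨Sum.inr j0, hv0.2⟩ := by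
        simp [hT, edge_adj]
      exact ((rl _ _ hi hv0.1).trans this.reachable).trans (rr _ _ hv0.2 hi')
    rw [connected_iff]
    constructor
    · rintro ⟨i | i, hi⟩ ⟨j | j, hj⟩
      · exact rl _ _ hi hj
      · exact rlr _ _ hi hj
      · exact (rlr _ _ hj hi).symm
      · exact rr _ _ hi hj
    · rcases hv with hv | hv
      · obtain ⟨i, hi⟩ := p1 v hv
        exact ⟨⟨Sum.inl i, hi⟩⟩
      · obtain ⟨i, hi⟩ := q1 v hv
        exact ⟨⟨Sum.inr i, hi⟩⟩
  · rintro (i | i)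
    · exact p4 i
    · exact q4 i

lemma HasTreeDecompWidthLE.mono {G : SimpleGraph V} {k l : ℕ} (h : HasTreeDecompWidthLE G k)
    (hkl : k ≤ l) : HasTreeDecompWidthLE G l := by
  obtain ⟨n, t, bag, ht, h1, h2, h3, h4⟩ := h
  exact ⟨n, t, bag, ht, h1, h2, h3, fun i => (h4 i).trans (by omega)⟩

lemma HasTreeDecompWidthLE.of_card [Finite V] (G : SimpleGraph V) {k : ℕ} (h : Nat.card V ≤ k + 1) :
    HasTreeDecompWidthLE G k := by
  have := Fintype.ofFinite V
  refine (TDOn.small (s := Finset.univ) G.Adj ?_).pull (G := G) id Function.injective_id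
    (by simp) (by simp)
  rwa [Finset.card_univ, ← Nat.card_eq_fintype_card]

lemma treewidth_le_iff [Finite V] (G : SimpleGraph V) (k : ℕ) :
    treewidth G ≤ k ↔ HasTreeDecompWidthLE G k := by
  constructor
  · intro h
    have hm : treewidth G ∈ {k | HasTreeDecompWidthLE G k} :=
      Nat.sInf_mem ⟨Nat.card V, HasTreeDecompWidthLE.of_card G (by omega)⟩
    exact HasTreeDecompWidthLE.mono hm h
  · intro h
    exact Nat.sInf_le h

lemma HasTreeDecompWidthLE.add_vertex {G G' : SimpleGraph V} {k : ℕ}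
    (h : HasTreeDecompWidthLE G k) (u : V)
    (hG : ∀ a b, G'.Adj a b → G.Adj a b ∨ a = u ∨ b = u) : HasTreeDecompWidthLE G' (k + 1) := by
  classical
  obtain ⟨n, t, bag, ht, h1, h2, h3, h4⟩ := h
  refine ⟨n, t, fun i => insert u (bag i), ht, ?_, ?_, ?_, ?_⟩
  · intro v
    obtain ⟨i, hi⟩ := h1 v
    exact ⟨i, Finset.mem_insert_of_mem hi⟩
  · intro a b hab
    rcases hG a b hab with h | rfl | rfl
    · obtain ⟨i, hi, hi'⟩ := h2 a b h
      exact ⟨i, Finset.mem_insert_of_mem hi, Finset.mem_insert_of_mem hi'⟩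
    · obtain ⟨i, hi⟩ := h1 b
      exact ⟨i, Finset.mem_insert_self _ _, Finset.mem_insert_of_mem hi⟩
    · obtain ⟨i, hi⟩ := h1 a
      exact ⟨i, Finset.mem_insert_of_mem hi, Finset.mem_insert_self _ _⟩
  · intro v
    by_cases hv : v = u
    · subst hv
      have : {i | v ∈ insert v (bag i)} = Set.univ := by ext; simp
      rw [this]
      exact (induceUnivIso t).connected_iff.2 ht.connected
    · have : {i | v ∈ insert u (bag i)} = {i | v ∈ bag i} := by ext; simp [hv]
      rw [this]
      exact h3 v
  · intro i
    exact (Finset.card_insert_le _ _).trans (by have := h4 i; omega)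

lemma mem_of_tsep_induce {t : SimpleGraph V} {N : Set V} {a b : N} (w : (t.induce N).Walk a b)
    {c : V} (h : TSep t c a.1 b.1) : c ∈ N := by
  have h1 : ∀ {a b : N} (w : (t.induce N).Walk a b),
      ∃ w' : t.Walk a.1 b.1, ∀ c ∈ w'.support, c ∈ N := by
    intro a b w
    induction w with
    | @nil x => exact ⟨Walk.nil, by simp⟩
    | @cons x y z hxy q ih =>
      obtain ⟨w', hw'⟩ := ih
      have hadj : t.Adj x.1 y.1 := hxy
      refine ⟨Walk.cons hadj w', ?_⟩
      intro c hc
      rw [Walk.support_cons, List.mem_cons] at hc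
      rcases hc with rfl | hc
      · exact x.2
      · exact hw' c hc
  obtain ⟨w', hw'⟩ := h1 w
  exact hw' c (h w')

/-- a nonempty graph of treewidth at most one has a vertex with at most one neighbour -/
lemma HasTreeDecompWidthLE.exists_end [Finite V] [Nonempty V] {G : SimpleGraph V}
    (h : HasTreeDecompWidthLE G 1) : ∃ v, ∀ a b, G.Adj v a → G.Adj v b → a = b := by
  classical
  obtain ⟨n, t, bag, ht, h1, h2, h3, h4⟩ := h
  have htop : ∀ v, ∃ i, v ∈ bag i ∧ ∀ j, v ∈ bag j → t.dist 0 i ≤ t.dist 0 j := by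
    intro v
    obtain ⟨i, hi, hmin⟩ := (Set.toFinite {i | v ∈ bag i}).exists_minimalFor (fun i => t.dist 0 i) _
      (h1 v)
    refine ⟨i, hi, fun j hj => ?_⟩
    by_contra hcon
    have := hmin (show j ∈ {i | v ∈ bag i} from hj) (by simp only; omega)
    simp only at this
    omega
  choose top htop1 htop2 using htop
  have hgate : ∀ v j, v ∈ bag j → TSep t (top v) 0 j := by
    intro v j hj
    obtain ⟨m, m1, m2, m3⟩ := exists_median ht.connected ht.isAcyclic 0 (top v) j
    have hm : v ∈ bag m := by
      obtain ⟨w⟩ := (h3 v).preconnected ⟨top v, htop1 v⟩ ⟨j, hj⟩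
      exact mem_of_tsep_induce w m2
    by_cases hmt : m = top v
    · rw [← hmt]; exact m3
    · have := dist_lt_of_tsep ht.connected m1 hmt
      have := htop2 v m hm
      omega
  obtain ⟨v, -, hmax⟩ := (Set.toFinite (Set.univ : Set V)).exists_maximalFor
    (fun v => t.dist 0 (top v)) _ Set.univ_nonempty
  have key : ∀ w, G.Adj v w → w ∈ bag (top v) := by
    intro w hw
    by_contra hcon
    obtain ⟨k, hk, hk'⟩ := h2 _ _ hw
    have g1 := hgate v k hk
    have g2 := hgate w k hk'
    have hle : ∀ {x y}, TSep t x 0 y → t.dist 0 x ≤ t.dist 0 y := by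
      intro x y hxy
      by_cases he : x = y
      · rw [he]
      · exact (dist_lt_of_tsep ht.connected hxy he).le
    have hmx : t.dist 0 (top w) ≤ t.dist 0 (top v) := by
      by_contra hc
      have := hmax (Set.mem_univ w) (by simp only; omega)
      simp only at this
      omega
    -- `top v` separates `top w` from `k`, hence lies in the nodes of `w`
    have hs : TSep t (top v) (top w) k := by
      by_contra hs
      have h5 : TSep t (top v) 0 (top w) := by
        by_contra h5
        exact not_sep_trans h5 hs g1
      have hne : top v ≠ top w := by
        rintro he
        exact hcon (he ▸ htop1 w)
      have := dist_lt_of_tsep ht.connected h5 hne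
      omega
    obtain ⟨p⟩ := (h3 w).preconnected ⟨top w, htop1 w⟩ ⟨k, hk'⟩
    exact hcon (mem_of_tsep_induce p hs)
  refine ⟨v, fun a b ha hb => ?_⟩
  by_contra hab
  have hsub : ({v, a, b} : Finset V) ⊆ bag (top v) := by
    intro x hx
    simp only [Finset.mem_insert, Finset.mem_singleton] at hx
    rcases hx with rfl | rfl | rfl
    · exact htop1 _
    · exact key _ ha
    · exact key _ hb
  have hc := (Finset.card_le_card hsub).trans (h4 _)
  rw [Finset.card_eq_three.2 ⟨v, a, b, ha.ne, hb.ne, hab, rfl⟩] at hc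
  omega

end TreewidthLib

section DisplayLib

variable {V1 V2 X : Type*}

/-- first embedding into the display graph -/
noncomputable def jl (l1 : X → V1) (l2 : X → V2) (a : V1) : DisplayVertex l1 l2 :=
  toDisplay l1 l2 (Sum.inl a)

/-- second embedding into the display graph -/
noncomputable def jr (l1 : X → V1) (l2 : X → V2) (a : V2) : DisplayVertex l1 l2 :=
  toDisplay l1 l2 (Sum.inr a)

variable {l1 : X → V1} {l2 : X → V2}

lemma jl_inj {a b : V1} : jl l1 l2 a = jl l1 l2 b ↔ a = b := by
  constructor
  · intro h
    have := congrArg Subtype.val h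
    simpa [jl, toDisplay, mergeMap] using this
  · rintro rfl; rfl

lemma jr_leaf (h2 : Function.Injective l2) (x : X) : jr l1 l2 (l2 x) = jl l1 l2 (l1 x) := by
  apply Subtype.ext
  have hex : ∃ y, l2 y = l2 x := ⟨x, rfl⟩
  have : hex.choose = x := h2 hex.choose_spec
  simp only [jr, jl, toDisplay, mergeMap]
  rw [dif_pos hex, this]

lemma jr_val {b : V2} (h : ∀ x, l2 x ≠ b) : (jr l1 l2 b).1 = Sum.inr b := by
  have : ¬ ∃ y, l2 y = b := fun ⟨y, hy⟩ => h y hy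
  simp only [jr, toDisplay, mergeMap]
  rw [dif_neg this]

lemma jl_val (a : V1) : (jl l1 l2 a).1 = Sum.inl a := rfl

lemma jl_eq_jr (h2 : Function.Injective l2) {a : V1} {b : V2} :
    jl l1 l2 a = jr l1 l2 b ↔ ∃ x, a = l1 x ∧ b = l2 x := by
  constructor
  · intro h
    by_cases hb : ∃ x, l2 x = b
    · obtain ⟨x, rfl⟩ := hb
      rw [jr_leaf h2, jl_inj] at h
      exact ⟨x, h, rfl⟩
    · push Not at hb
      have := congrArg Subtype.val h
      rw [jl_val, jr_val hb] at this
      simp at this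
  · rintro ⟨x, rfl, rfl⟩
    exact (jr_leaf h2 x).symm

lemma jr_inj (h1 : Function.Injective l1) (h2 : Function.Injective l2) {a b : V2} :
    jr l1 l2 a = jr l1 l2 b ↔ a = b := by
  constructor
  · intro h
    by_cases ha : ∃ x, l2 x = a
    · obtain ⟨x, rfl⟩ := ha
      rw [jr_leaf h2, jl_eq_jr h2] at h
      obtain ⟨y, hy, rfl⟩ := h
      rw [h1 hy]
    · push Not at ha
      by_cases hb : ∃ x, l2 x = b
      · obtain ⟨x, rfl⟩ := hb
        rw [jr_leaf h2, eq_comm, jl_eq_jr h2] at h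
        obtain ⟨y, hy, rfl⟩ := h
        rw [h1 hy]
      · push Not at hb
        have := congrArg Subtype.val h
        rw [jr_val ha, jr_val hb] at this
        exact Sum.inr_injective this
  · rintro rfl; rfl

lemma j_cover (d : DisplayVertex l1 l2) : (∃ a, d = jl l1 l2 a) ∨ ∃ b, d = jr l1 l2 b := by
  obtain ⟨a | b, h⟩ := d
  · exact Or.inl ⟨a, rfl⟩
  · exact Or.inr ⟨b, Subtype.ext h.symm⟩

lemma display_adj {G1 : SimpleGraph V1} {G2 : SimpleGraph V2} (h1 : Function.Injective l1)
    (h2 : Function.Injective l2) {d e : DisplayVertex l1 l2} :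
    (displayGraph G1 l1 G2 l2).Adj d e ↔
      (∃ a b, G1.Adj a b ∧ d = jl l1 l2 a ∧ e = jl l1 l2 b) ∨
      (∃ a b, G2.Adj a b ∧ d = jr l1 l2 a ∧ e = jr l1 l2 b) := by
  rw [displayGraph, fromRel_adj]
  constructor
  · rintro ⟨-, (h | h) | (⟨a, b, h, rfl, rfl⟩ | ⟨a, b, h, rfl, rfl⟩)⟩
    · exact Or.inl h
    · exact Or.inr h
    · exact Or.inl ⟨b, a, h.symm, rfl, rfl⟩
    · exact Or.inr ⟨b, a, h.symm, rfl, rfl⟩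
  · intro h
    refine ⟨?_, Or.inl h⟩
    rcases h with ⟨a, b, h, rfl, rfl⟩ | ⟨a, b, h, rfl, rfl⟩
    · exact fun he => h.ne (jl_inj.1 he)
    · exact fun he => h.ne ((jr_inj h1 h2).1 he)

instance displayFinite [Finite V1] [Finite V2] : Finite (DisplayVertex l1 l2) := by
  unfold DisplayVertex
  infer_instance

/-- with at least three labels the display graph has minimum degree two -/
lemma display_not_td_one (T1 : PhyloTree V1 X) (T2 : PhyloTree V2 X)
    (h3 : ∀ x y : X, ∃ z, z ≠ x ∧ z ≠ y) :
    ¬ HasTreeDecompWidthLE (displayGraph T1.graph T1.leaf T2.graph T2.leaf) 1 := by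
  intro h
  have := T1.finite
  have := T2.finite
  have hne : Nonempty (DisplayVertex T1.leaf T2.leaf) := by
    obtain ⟨v⟩ := T1.connected.nonempty
    exact ⟨jl _ _ v⟩
  obtain ⟨d, hd⟩ := h.exists_end
  have i1 := T1.leaf_inj
  have i2 := T2.leaf_inj
  have hleaf : ∀ x, d ≠ jl T1.leaf T2.leaf (T1.leaf x) := by
    rintro x rfl
    obtain ⟨n, hn⟩ := T1.leaf_nbr x
    obtain ⟨m, hm⟩ := T2.leaf_nbr x
    have e := hd (jl T1.leaf T2.leaf n) (jr T1.leaf T2.leaf m)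
      ((display_adj i1 i2).2 (Or.inl ⟨_, _, (hn n).2 rfl, rfl, rfl⟩))
      ((display_adj i1 i2).2 (Or.inr ⟨_, _, (hm m).2 rfl, (jr_leaf i2 x).symm, rfl⟩))
    rw [jl_eq_jr i2] at e
    obtain ⟨y, rfl, -⟩ := e
    obtain ⟨z, hz1, hz2⟩ := h3 x y
    exact T1.not_adj_leaf hz1 hz2 ((hn _).2 rfl)
  rcases j_cover d with ⟨a, rfl⟩ | ⟨a, rfl⟩
  · obtain ⟨p, q, r, h1, h2, h3, hn⟩ := T1.nbrs (v := a) (fun x hx => hleaf x (by rw [hx]))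
    have e := hd (jl T1.leaf T2.leaf p) (jl T1.leaf T2.leaf q)
      ((display_adj i1 i2).2 (Or.inl ⟨_, _, (hn p).2 (by simp), rfl, rfl⟩))
      ((display_adj i1 i2).2 (Or.inl ⟨_, _, (hn q).2 (by simp), rfl, rfl⟩))
    exact h1 (jl_inj.1 e)
  · obtain ⟨p, q, r, h1, h2, h3, hn⟩ := T2.nbrs (v := a)
      (fun x hx => hleaf x (by rw [← hx, jr_leaf i2]))
    have e := hd (jr T1.leaf T2.leaf p) (jr T1.leaf T2.leaf q)
      ((display_adj i1 i2).2 (Or.inr ⟨_, _, (hn p).2 (by simp), rfl, rfl⟩))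
      ((display_adj i1 i2).2 (Or.inr ⟨_, _, (hn q).2 (by simp), rfl, rfl⟩))
    exact h1 ((jr_inj i1 i2).1 e)

/-- two labels: every vertex is a leaf -/
lemma PhyloTree.leaf_of_two (T : PhyloTree V1 X) {x y : X} (h : ∀ z, z = x ∨ z = y) (v : V1) :
    ∃ z, v = T.leaf z := by
  rcases T.good v with h1 | ⟨a, b, c, -, h1, h2, h3⟩
  · exact h1
  · rcases h a with rfl | rfl <;> rcases h b with rfl | rfl <;> rcases h c with rfl | rfl <;>
      simp_all

lemma display_td_two (T1 : PhyloTree V1 X) (T2 : PhyloTree V2 X) {x y : X}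
    (h : ∀ z, z = x ∨ z = y) :
    HasTreeDecompWidthLE (displayGraph T1.graph T1.leaf T2.graph T2.leaf) 1 := by
  have := T1.finite
  have := T2.finite
  apply HasTreeDecompWidthLE.of_card
  have hs : Function.Surjective (fun b : Bool => jl T1.leaf T2.leaf (T1.leaf (if b then x else y))) := by
    intro d
    have : ∃ z, d = jl T1.leaf T2.leaf (T1.leaf z) := by
      rcases j_cover d with ⟨a, rfl⟩ | ⟨a, rfl⟩
      · obtain ⟨z, rfl⟩ := T1.leaf_of_two h a
        exact ⟨z, rfl⟩
      · obtain ⟨z, rfl⟩ := T2.leaf_of_two h a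
        exact ⟨z, jr_leaf T2.leaf_inj z⟩
    obtain ⟨z, rfl⟩ := this
    rcases h z with rfl | rfl
    · exact ⟨true, rfl⟩
    · exact ⟨false, rfl⟩
  have := Nat.card_le_card_of_surjective _ hs
  simpa using this

lemma tree_cross {T : PhyloTree V1 X} {u v : V1} (huv : T.graph.Adj u v) {a b : V1}
    (hab : T.graph.Adj a b) (ha : ¬ TSep T.graph v u a) (hb : TSep T.graph v u b) :
    a = u ∧ b = v := by
  have hbv : b = v := by
    by_contra hbv
    exact not_sep_trans ha (not_sep_adj hab (ne_of_not_sep_right ha) (Ne.symm hbv)) hb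
  subst hbv
  refine ⟨?_, rfl⟩
  by_contra hau
  exact ha (tsep_of_nbrs T.acyclic huv.symm hab.symm (Ne.symm hau))

/-- All data on one side of a common split. -/
structure Side (T1 : PhyloTree V1 X) (T2 : PhyloTree V2 X) (Xs : Set X) (u1 v1 : V1) (u2 v2 : V2) :
    Prop where
  o1 : OnSide T1 Xs u1 v1
  o2 : OnSide T2 Xs u2 v2
  nu1 : ∀ x, T1.leaf x ≠ u1
  nu2 : ∀ x, T2.leaf x ≠ u2
  nv1 : ∀ x, T1.leaf x ≠ v1
  nv2 : ∀ x, T2.leaf x ≠ v2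
  ne : ∃ x, x ∈ Xs
  nec : ∃ x, x ∉ Xs

lemma OnSide.swap {T : PhyloTree V1 X} {Xs : Set X} {u v : V1} (h : OnSide T Xs u v) :
    OnSide T Xsᶜ v u := by
  refine ⟨h.1.symm, fun x => ?_⟩
  rw [adj_not_tsep_iff T h.1.symm, Set.mem_compl_iff, h.2 x, not_not]

lemma Side.swap {T1 : PhyloTree V1 X} {T2 : PhyloTree V2 X} {Xs : Set X} {u1 v1 : V1} {u2 v2 : V2}
    (h : Side T1 T2 Xs u1 v1 u2 v2) : Side T1 T2 Xsᶜ v1 u1 v2 u2 :=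
  ⟨h.o1.swap, h.o2.swap, h.nv1, h.nv2, h.nu1, h.nu2, h.nec, by simpa using h.ne⟩

lemma splitDeletedDisplay_swap (T1 : PhyloTree V1 X) (T2 : PhyloTree V2 X) (u1 v1 : V1)
    (u2 v2 : V2) : splitDeletedDisplay T1 T2 v1 u1 v2 u2 = splitDeletedDisplay T1 T2 u1 v1 u2 v2 := by
  unfold splitDeletedDisplay
  rw [Sym2.eq_swap, Sym2.eq_swap (a := toDisplay T1.leaf T2.leaf (Sum.inr v2))]

/-- the vertex set of one side -/
def DS (T1 : PhyloTree V1 X) (T2 : PhyloTree V2 X) (u1 v1 : V1) (u2 v2 : V2) :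
    Set (DisplayVertex T1.leaf T2.leaf) :=
  {d | (∃ a, d = jl _ _ a ∧ ¬ TSep T1.graph v1 u1 a) ∨ ∃ b, d = jr _ _ b ∧ ¬ TSep T2.graph v2 u2 b}

variable {T1 : PhyloTree V1 X} {T2 : PhyloTree V2 X} {Xs : Set X} {u1 v1 : V1} {u2 v2 : V2}

lemma Side.jl_mem (h : Side T1 T2 Xs u1 v1 u2 v2) {a : V1} :
    jl T1.leaf T2.leaf a ∈ DS T1 T2 u1 v1 u2 v2 ↔ ¬ TSep T1.graph v1 u1 a := by
  constructor
  · rintro (⟨b, hb, hb'⟩ | ⟨b, hb, hb'⟩)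
    · rwa [jl_inj.1 hb]
    · obtain ⟨x, rfl, rfl⟩ := (jl_eq_jr T2.leaf_inj).1 hb
      exact (h.o1.2 x).1 ((h.o2.2 x).2 hb')
  · intro ha
    exact Or.inl ⟨a, rfl, ha⟩

lemma Side.jr_mem (h : Side T1 T2 Xs u1 v1 u2 v2) {a : V2} :
    jr T1.leaf T2.leaf a ∈ DS T1 T2 u1 v1 u2 v2 ↔ ¬ TSep T2.graph v2 u2 a := by
  constructor
  · rintro (⟨b, hb, hb'⟩ | ⟨b, hb, hb'⟩)
    · obtain ⟨x, rfl, rfl⟩ := (jl_eq_jr T2.leaf_inj).1 hb.symm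
      exact (h.o2.2 x).1 ((h.o1.2 x).2 hb')
    · rwa [(jr_inj T1.leaf_inj T2.leaf_inj).1 hb]
  · intro ha
    exact Or.inr ⟨a, rfl, ha⟩

lemma Side.u1_mem (h : Side T1 T2 Xs u1 v1 u2 v2) :
    jl T1.leaf T2.leaf u1 ∈ DS T1 T2 u1 v1 u2 v2 := by
  rw [h.jl_mem, sep_self]
  exact h.o1.1.ne'

lemma Side.u2_mem (h : Side T1 T2 Xs u1 v1 u2 v2) :
    jr T1.leaf T2.leaf u2 ∈ DS T1 T2 u1 v1 u2 v2 := by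
  rw [h.jr_mem, sep_self]
  exact h.o2.1.ne'

lemma Side.v1_mem (h : Side T1 T2 Xs u1 v1 u2 v2) :
    jl T1.leaf T2.leaf v1 ∉ DS T1 T2 u1 v1 u2 v2 := by
  rw [h.jl_mem, not_not]
  exact sep_right _ _

lemma Side.v2_mem (h : Side T1 T2 Xs u1 v1 u2 v2) :
    jr T1.leaf T2.leaf v2 ∉ DS T1 T2 u1 v1 u2 v2 := by
  rw [h.jr_mem, not_not]
  exact sep_right _ _

lemma Side.mem_swap (h : Side T1 T2 Xs u1 v1 u2 v2) (d : DisplayVertex T1.leaf T2.leaf) :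
    d ∈ DS T1 T2 v1 u1 v2 u2 ↔ d ∉ DS T1 T2 u1 v1 u2 v2 := by
  rcases j_cover d with ⟨a, rfl⟩ | ⟨a, rfl⟩
  · rw [h.jl_mem, h.swap.jl_mem, adj_not_tsep_iff T1 h.o1.1.symm, not_not]
  · rw [h.jr_mem, h.swap.jr_mem, adj_not_tsep_iff T2 h.o2.1.symm, not_not]

/-- edges across the split -/
lemma Side.cross (h : Side T1 T2 Xs u1 v1 u2 v2) {d e : DisplayVertex T1.leaf T2.leaf}
    (hd : d ∈ DS T1 T2 u1 v1 u2 v2) (he : e ∉ DS T1 T2 u1 v1 u2 v2)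
    (hde : (displayGraph T1.graph T1.leaf T2.graph T2.leaf).Adj d e) :
    (d = jl _ _ u1 ∧ e = jl _ _ v1) ∨ (d = jr _ _ u2 ∧ e = jr _ _ v2) := by
  rcases (display_adj T1.leaf_inj T2.leaf_inj).1 hde with ⟨a, b, hab, rfl, rfl⟩ | ⟨a, b, hab, rfl, rfl⟩
  · rw [h.jl_mem] at hd he
    rw [not_not] at he
    obtain ⟨rfl, rfl⟩ := tree_cross h.o1.1 hab hd he
    exact Or.inl ⟨rfl, rfl⟩
  · rw [h.jr_mem] at hd he
    rw [not_not] at he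
    obtain ⟨rfl, rfl⟩ := tree_cross h.o2.1 hab hd he
    exact Or.inr ⟨rfl, rfl⟩

lemma sdd_adj {d e : DisplayVertex T1.leaf T2.leaf} :
    (splitDeletedDisplay T1 T2 u1 v1 u2 v2).Adj d e ↔
      (displayGraph T1.graph T1.leaf T2.graph T2.leaf).Adj d e ∧
        ¬ (s(d, e) = s(jl _ _ u1, jl _ _ v1) ∨ s(d, e) = s(jr _ _ u2, jr _ _ v2)) := by
  rw [splitDeletedDisplay, deleteEdges_adj]
  rfl

lemma Side.sdd_adj_of_mem (h : Side T1 T2 Xs u1 v1 u2 v2) {d e : DisplayVertex T1.leaf T2.leaf}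
    (hd : d ∈ DS T1 T2 u1 v1 u2 v2) (he : e ∈ DS T1 T2 u1 v1 u2 v2) :
    (splitDeletedDisplay T1 T2 u1 v1 u2 v2).Adj d e ↔
      (displayGraph T1.graph T1.leaf T2.graph T2.leaf).Adj d e := by
  rw [sdd_adj]
  refine and_iff_left ?_
  have h1 := h.v1_mem
  have h2 := h.v2_mem
  rintro (hh | hh)
  · rcases Sym2.eq_iff.1 hh with ⟨rfl, rfl⟩ | ⟨rfl, rfl⟩
    · exact h1 he
    · exact h1 hd
  · rcases Sym2.eq_iff.1 hh with ⟨rfl, rfl⟩ | ⟨rfl, rfl⟩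
    · exact h2 he
    · exact h2 hd

lemma Side.sdd_closed (h : Side T1 T2 Xs u1 v1 u2 v2) {d e : DisplayVertex T1.leaf T2.leaf}
    (hde : (splitDeletedDisplay T1 T2 u1 v1 u2 v2).Adj d e)
    (hd : d ∈ DS T1 T2 u1 v1 u2 v2) : e ∈ DS T1 T2 u1 v1 u2 v2 := by
  by_contra he
  rw [sdd_adj] at hde
  rcases h.cross hd he hde.1 with ⟨rfl, rfl⟩ | ⟨rfl, rfl⟩
  · exact hde.2 (Or.inl rfl)
  · exact hde.2 (Or.inr rfl)

lemma Side.jl_ne_u2 (h : Side T1 T2 Xs u1 v1 u2 v2) (a : V1) :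
    jl T1.leaf T2.leaf a ≠ jr T1.leaf T2.leaf u2 := by
  rw [Ne, jl_eq_jr T2.leaf_inj]
  rintro ⟨x, -, hx⟩
  exact h.nu2 x hx.symm

lemma Side.jr_ne_u1 (h : Side T1 T2 Xs u1 v1 u2 v2) (a : V2) :
    jr T1.leaf T2.leaf a ≠ jl T1.leaf T2.leaf u1 := by
  rw [Ne, eq_comm, jl_eq_jr T2.leaf_inj]
  rintro ⟨x, hx, -⟩
  exact h.nu1 x hx.symm

lemma Side.mem_comp (h : Side T1 T2 Xs u1 v1 u2 v2) (d : DisplayVertex T1.leaf T2.leaf) :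
    d ∈ splitComponent T1 T2 u1 v1 u2 v2 u1 ↔ d ∈ DS T1 T2 u1 v1 u2 v2 := by
  constructor
  · intro hd
    obtain ⟨w⟩ : (splitDeletedDisplay T1 T2 u1 v1 u2 v2).Reachable (jl _ _ u1) d := hd
    have key : ∀ {a b} (w : (splitDeletedDisplay T1 T2 u1 v1 u2 v2).Walk a b),
        a ∈ DS T1 T2 u1 v1 u2 v2 → b ∈ DS T1 T2 u1 v1 u2 v2 := by
      intro a b w
      induction w with
      | nil => exact id
      | cons hadj q ih => exact fun ha => ih (h.sdd_closed hadj ha)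
    exact key w h.u1_mem
  · have r1 : ∀ z, ¬ TSep T1.graph v1 u1 z → (splitDeletedDisplay T1 T2 u1 v1 u2 v2).Reachable
        (jl _ _ u1) (jl _ _ z) := by
      intro z hz
      rw [← reachable_delete_iff T1 h.o1.1] at hz
      refine hz.map (G' := splitDeletedDisplay T1 T2 u1 v1 u2 v2) ⟨fun a => jl _ _ a, ?_⟩
      intro a b hab
      rw [deleteEdges_adj] at hab
      rw [sdd_adj, display_adj T1.leaf_inj T2.leaf_inj]
      refine ⟨Or.inl ⟨a, b, hab.1, rfl, rfl⟩, ?_⟩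
      rintro (hh | hh)
      · apply hab.2
        rw [Set.mem_singleton_iff]
        rw [Sym2.eq_iff, jl_inj, jl_inj, jl_inj, jl_inj] at hh
        exact Sym2.eq_iff.2 hh
      · rcases Sym2.eq_iff.1 hh with ⟨h1, -⟩ | ⟨-, h1⟩ <;> exact h.jl_ne_u2 _ h1
    have r2 : ∀ z, ¬ TSep T2.graph v2 u2 z → (splitDeletedDisplay T1 T2 u1 v1 u2 v2).Reachable
        (jr _ _ u2) (jr _ _ z) := by
      intro z hz
      rw [← reachable_delete_iff T2 h.o2.1] at hz
      refine hz.map (G' := splitDeletedDisplay T1 T2 u1 v1 u2 v2) ⟨fun a => jr _ _ a, ?_⟩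
      intro a b hab
      rw [deleteEdges_adj] at hab
      rw [sdd_adj, display_adj T1.leaf_inj T2.leaf_inj]
      refine ⟨Or.inr ⟨a, b, hab.1, rfl, rfl⟩, ?_⟩
      rintro (hh | hh)
      · rcases Sym2.eq_iff.1 hh with ⟨h1, -⟩ | ⟨-, h1⟩ <;> exact h.jr_ne_u1 _ h1
      · apply hab.2
        rw [Set.mem_singleton_iff]
        have i := @jr_inj _ _ _ T1.leaf T2.leaf T1.leaf_inj T2.leaf_inj
        rw [Sym2.eq_iff, i, i, i, i] at hh
        exact Sym2.eq_iff.2 hh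
    rintro (⟨a, rfl, ha⟩ | ⟨a, rfl, ha⟩)
    · exact r1 a ha
    · obtain ⟨x, hx⟩ := h.ne
      have e1 := r1 _ ((h.o1.2 x).1 hx)
      have e2 := r2 _ ((h.o2.2 x).1 hx)
      rw [jr_leaf T2.leaf_inj] at e2
      exact (e1.trans e2.symm).trans (r2 a ha)

end DisplayLib

section SideLib

lemma HasTreeDecompWidthLE.anti {V : Type*} {G G' : SimpleGraph V} {k : ℕ}
    (h : HasTreeDecompWidthLE G k) (hle : ∀ a b, G'.Adj a b → G.Adj a b) :
    HasTreeDecompWidthLE G' k := by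
  obtain ⟨n, t, bag, ht, h1, h2, h3, h4⟩ := h
  exact ⟨n, t, bag, ht, h1, fun a b hab => h2 a b (hle a b hab), h3, h4⟩

lemma reachable_induce_of_closed {V : Type*} {H G : SimpleGraph V} {N : Set V}
    (hN : ∀ x ∈ N, ∀ y, H.Adj x y → y ∈ N ∧ G.Adj x y) {a b : V} (hab : H.Reachable a b)
    (ha : a ∈ N) : ∃ hb : b ∈ N, (G.induce N).Reachable ⟨a, ha⟩ ⟨b, hb⟩ := by
  obtain ⟨w⟩ := hab
  induction w with
  | nil => exact ⟨ha, Reachable.refl _⟩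
  | @cons x y z hxy q ih =>
    obtain ⟨hy, hg⟩ := hN _ ha _ hxy
    obtain ⟨hb, hr⟩ := ih hy
    have hadj : (G.induce N).Adj ⟨x, ha⟩ ⟨y, hy⟩ := hg
    exact ⟨hb, hadj.reachable.trans hr⟩

variable {V1 V2 X : Type*} {T1 : PhyloTree V1 X} {T2 : PhyloTree V2 X} {Xs : Set X}
  {u1 v1 : V1} {u2 v2 : V2}

lemma Side.side_adj (h : Side T1 T2 Xs u1 v1 u2 v2)
    {x y : splitComponent T1 T2 u1 v1 u2 v2 u1} :
    (splitSide T1 T2 u1 v1 u2 v2 u1).Adj x y ↔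
      (displayGraph T1.graph T1.leaf T2.graph T2.leaf).Adj x.1 y.1 := by
  rw [← h.sdd_adj_of_mem ((h.mem_comp _).1 x.2) ((h.mem_comp _).1 y.2)]
  rfl

lemma Side.plus_adj (h : Side T1 T2 Xs u1 v1 u2 v2)
    {x y : splitComponent T1 T2 u1 v1 u2 v2 u1} :
    (splitSidePlus T1 T2 u1 v1 u2 v2 u1 u2).Adj x y ↔
      (displayGraph T1.graph T1.leaf T2.graph T2.leaf).Adj x.1 y.1 ∨
      (x.1 = jl _ _ u1 ∧ y.1 = jr _ _ u2) ∨ (y.1 = jl _ _ u1 ∧ x.1 = jr _ _ u2) := by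
  have hx := (h.mem_comp _).1 x.2
  have hy := (h.mem_comp _).1 y.2
  rw [splitSidePlus, fromRel_adj, h.sdd_adj_of_mem hx hy, h.sdd_adj_of_mem hy hx]
  change x ≠ y ∧ (((displayGraph T1.graph T1.leaf T2.graph T2.leaf).Adj x.1 y.1 ∨
      (x.1 = jl _ _ u1 ∧ y.1 = jr _ _ u2)) ∨ ((displayGraph T1.graph T1.leaf T2.graph T2.leaf).Adj y.1 x.1 ∨
      (y.1 = jl _ _ u1 ∧ x.1 = jr _ _ u2))) ↔ _
  have hn := h.jl_ne_u2 u1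
  constructor
  · rintro ⟨-, (h1 | h1) | (h1 | h1)⟩
    · exact Or.inl h1
    · exact Or.inr (Or.inl h1)
    · exact Or.inl h1.symm
    · exact Or.inr (Or.inr h1)
  · rintro (h1 | h1 | h1)
    · exact ⟨fun he => h1.ne (congrArg Subtype.val he), Or.inl (Or.inl h1)⟩
    · refine ⟨?_, Or.inl (Or.inr h1)⟩
      rintro rfl
      exact hn (h1.1.symm.trans h1.2)
    · refine ⟨?_, Or.inr (Or.inr h1)⟩
      rintro rfl
      exact hn (h1.1.symm.trans h1.2)

/-- `[G*]` is a minor of the display graph. -/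
lemma Side.plus_of_display (h : Side T1 T2 Xs u1 v1 u2 v2) {k : ℕ}
    (hk : HasTreeDecompWidthLE (displayGraph T1.graph T1.leaf T2.graph T2.leaf) k) :
    HasTreeDecompWidthLE (splitSidePlus T1 T2 u1 v1 u2 v2 u1 u2) k := by
  classical
  set D := displayGraph T1.graph T1.leaf T2.graph T2.leaf with hD
  set S := DS T1 T2 u1 v1 u2 v2 with hS
  have hu1 := h.u1_mem
  have hu2 := h.u2_mem
  have hv1 := h.v1_mem
  have hv2 := h.v2_mem
  let f : DisplayVertex T1.leaf T2.leaf → DisplayVertex T1.leaf T2.leaf :=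
    fun d => if d ∈ S then d else jl _ _ u1
  have hfin : ∀ d, d ∈ S → f d = d := fun d hd => if_pos hd
  have hfout : ∀ d, d ∉ S → f d = jl _ _ u1 := fun d hd => if_neg hd
  have hmem : ∀ d, f d ∈ S := by
    intro d
    by_cases hd : d ∈ S
    · rwa [hfin d hd]
    · rwa [hfout d hd]
  have hTD : TDOn S (fun x y => D.Adj x y ∨ (x = jl _ _ u1 ∧ y = jr _ _ u2) ∨
      (y = jl _ _ u1 ∧ x = jr _ _ u2)) k := by
    refine hk.map f (S := S) ?_ _ ?_ ?_
    · intro w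
      exact ⟨fun hw => ⟨w, hfin w hw⟩, fun ⟨v, hv⟩ => hv ▸ hmem v⟩
    · intro w
      by_cases hw : w = jl _ _ u1
      · -- everything is reachable from `v1`
        have hfv1 : f (jl _ _ v1) = w := by rw [hfout _ hv1, hw]
        have hfu1 : f (jl _ _ u1) = w := by rw [hfin _ hu1, hw]
        have hadj : (D.induce {x | f x = w}).Adj ⟨jl _ _ v1, hfv1⟩ ⟨jl _ _ u1, hfu1⟩ :=
          (display_adj T1.leaf_inj T2.leaf_inj).2 (Or.inl ⟨_, _, h.o1.1.symm, rfl, rfl⟩)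
        have key : ∀ x : {x | f x = w}, (D.induce {x | f x = w}).Reachable ⟨jl _ _ v1, hfv1⟩ x := by
          rintro ⟨x, hx⟩
          by_cases hxS : x ∈ S
          · have hx' : f x = w := hx
            rw [hfin x hxS, hw] at hx'
            subst hx'
            exact hadj.reachable
          · have hcomp : (splitDeletedDisplay T1 T2 v1 u1 v2 u2).Reachable (jl _ _ v1) x :=
              (h.swap.mem_comp x).2 ((h.mem_swap x).2 hxS)
            obtain ⟨hb, hr⟩ := reachable_induce_of_closed (G := D) (N := Sᶜ) (by
              intro x hx y hxy
              have h1 := h.swap.sdd_closed hxy ((h.mem_swap x).2 hx)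
              exact ⟨(h.mem_swap y).1 h1, (sdd_adj.1 hxy).1⟩) hcomp hv1
            exact hr.map (G' := D.induce {x | f x = w})
              ⟨fun z => ⟨z.1, by simp only [Set.mem_ofPred_eq]; rw [hfout z.1 z.2, hw]⟩, fun h => h⟩
        intro x y
        exact (key x).symm.trans (key y)
      · have hin : ∀ x, f x = w → x = w := by
          intro x hx
          by_cases hxS : x ∈ S
          · rwa [hfin x hxS] at hx
          · rw [hfout x hxS] at hx
            exact absurd hx.symm hw
        rintro ⟨x, hx⟩ ⟨y, hy⟩
        obtain rfl := (hin x hx).trans (hin y hy).symm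
        exact Reachable.refl _
    · have hadj : D.Adj (jr _ _ v2) (jr _ _ u2) :=
        (display_adj T1.leaf_inj T2.leaf_inj).2 (Or.inr ⟨_, _, h.o2.1.symm, rfl, rfl⟩)
      rintro a ha b hb (hab | ⟨rfl, rfl⟩ | ⟨rfl, rfl⟩)
      · exact Or.inr ⟨a, b, hfin a ha, hfin b hb, hab⟩
      · exact Or.inr ⟨_, _, hfout _ hv2, hfin _ hu2, hadj⟩
      · exact Or.inr ⟨_, _, hfin _ hu2, hfout _ hv2, hadj.symm⟩
  refine hTD.pull Subtype.val Subtype.val_injective (fun v => (h.mem_comp _).1 v.2) ?_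
  intro a b hab
  exact h.plus_adj.1 hab

lemma Side.side_of_plus (h : Side T1 T2 Xs u1 v1 u2 v2) {k : ℕ}
    (hk : HasTreeDecompWidthLE (splitSidePlus T1 T2 u1 v1 u2 v2 u1 u2) k) :
    HasTreeDecompWidthLE (splitSide T1 T2 u1 v1 u2 v2 u1) k :=
  hk.anti fun _ _ hab => h.plus_adj.2 (Or.inl (h.side_adj.1 hab))

lemma Side.tdon_plus (h : Side T1 T2 Xs u1 v1 u2 v2) {k : ℕ}
    (hk : HasTreeDecompWidthLE (splitSidePlus T1 T2 u1 v1 u2 v2 u1 u2) k)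
    (E : DisplayVertex T1.leaf T2.leaf → DisplayVertex T1.leaf T2.leaf → Prop)
    (hE : ∀ x ∈ DS T1 T2 u1 v1 u2 v2, ∀ y ∈ DS T1 T2 u1 v1 u2 v2, E x y →
      (displayGraph T1.graph T1.leaf T2.graph T2.leaf).Adj x y ∨
      (x = jl _ _ u1 ∧ y = jr _ _ u2) ∨ (y = jl _ _ u1 ∧ x = jr _ _ u2)) :
    TDOn (DS T1 T2 u1 v1 u2 v2) E k := by
  refine hk.map_inj Subtype.val Subtype.val_injective ?_ E ?_
  · intro w
    constructor
    · intro hw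
      exact ⟨⟨w, (h.mem_comp w).2 hw⟩, rfl⟩
    · rintro ⟨v, rfl⟩
      exact (h.mem_comp _).1 v.2
  · intro a ha b hb hab
    exact Or.inr ⟨⟨a, (h.mem_comp a).2 ha⟩, ⟨b, (h.mem_comp b).2 hb⟩, rfl, rfl,
      h.plus_adj.2 (hE a ha b hb hab)⟩

lemma card_three_le {V : Type*} [DecidableEq V] (a b c : V) : ({a, b, c} : Finset V).card ≤ 3 :=
  Finset.card_le_three

/-- Joining the two sides. -/
lemma Side.display_of_plus (h : Side T1 T2 Xs u1 v1 u2 v2) {k : ℕ} (hk2 : 2 ≤ k)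
    (hk : HasTreeDecompWidthLE (splitSidePlus T1 T2 u1 v1 u2 v2 u1 u2) k)
    (hk' : HasTreeDecompWidthLE (splitSidePlus T1 T2 v1 u1 v2 u2 v1 v2) k) :
    HasTreeDecompWidthLE (displayGraph T1.graph T1.leaf T2.graph T2.leaf) k := by
  classical
  set D := displayGraph T1.graph T1.leaf T2.graph T2.leaf with hD
  set S := DS T1 T2 u1 v1 u2 v2 with hS
  set S' := DS T1 T2 v1 u1 v2 u2 with hS'
  have hSS : ∀ d, d ∈ S' ↔ d ∉ S := h.mem_swap
  have hu1 := h.u1_mem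
  have hu2 := h.u2_mem
  have hv1 := h.v1_mem
  have hv2 := h.v2_mem
  have hcr := @Side.cross _ _ _ _ _ _ _ _ _ _ h
  have n1 := h.jl_ne_u2 u1
  have n2 := h.swap.jl_ne_u2 v1
  set α := jl T1.leaf T2.leaf u1
  set β := jr T1.leaf T2.leaf u2
  set γ := jl T1.leaf T2.leaf v1
  set δ := jr T1.leaf T2.leaf v2
  let E : DisplayVertex T1.leaf T2.leaf → DisplayVertex T1.leaf T2.leaf → Prop := fun x y =>
    D.Adj x y ∨ ((x = α ∧ y = β) ∨ (y = α ∧ x = β)) ∨ ((x = γ ∧ y = δ) ∨ (y = γ ∧ x = δ)) ∨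
      ((x = β ∧ y = γ) ∨ (y = β ∧ x = γ))
  have hcr2 : ∀ x y, x ∈ S → y ∉ S → E x y →
      (x = α ∧ y = γ) ∨ (x = β ∧ y = δ) ∨ (x = β ∧ y = γ) := by
    intro x y hx hy hxy
    rcases hxy with hxy | hxy | hxy | hxy
    · rcases hcr hx hy hxy with h1 | h1
      · exact Or.inl h1
      · exact Or.inr (Or.inl h1)
    · grind
    · grind
    · grind
  have hEsymm : ∀ x y, E x y → E y x := by
    intro x y hxy
    rcases hxy with hxy | hxy | hxy | hxy
    · exact Or.inl hxy.symm
    · exact Or.inr (Or.inl hxy.symm)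
    · exact Or.inr (Or.inr (Or.inl hxy.symm))
    · exact Or.inr (Or.inr (Or.inr hxy.symm))
  have t1 : TDOn S E k := by
    refine h.tdon_plus hk E ?_
    rintro x hx y hy (hxy | hxy | hxy | hxy)
    · exact Or.inl hxy
    · exact Or.inr hxy
    · grind
    · grind
  have t2 : TDOn S' E k := by
    refine h.swap.tdon_plus hk' E ?_
    intro x hx y hy hxy
    have hx' := (hSS x).1 hx
    have hy' := (hSS y).1 hy
    rcases hxy with hxy | hxy | hxy | hxy
    · exact Or.inl hxy
    · grind
    · exact Or.inr hxy
    · grind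
  have s1 : TDOn (({α, β, γ} : Finset _) : Set (DisplayVertex T1.leaf T2.leaf)) E k :=
    TDOn.small E (Finset.card_le_three.trans (by omega))
  have s2 : TDOn (({β, γ, δ} : Finset _) : Set (DisplayVertex T1.leaf T2.leaf)) E k :=
    TDOn.small E (Finset.card_le_three.trans (by omega))
  have c1 : TDOn (S ∪ (({α, β, γ} : Finset _) : Set (DisplayVertex T1.leaf T2.leaf))) E k := by
    refine t1.glue s1 (a := α) (b := β) hu1 (by simp) hu2 (by simp)
      (Or.inr (Or.inl (Or.inl ⟨rfl, rfl⟩))) ?_ ?_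
    · intro x hx hx'
      simp only [Finset.coe_insert, Finset.coe_singleton, Set.mem_insert_iff, Set.mem_singleton_iff] at hx'
      grind
    · intro x hx y hy hxy
      have a1 := hcr2 x y
      have a2 := hcr2 y x
      have a3 := hEsymm _ _ hxy
      simp only [Finset.coe_insert, Finset.coe_singleton, Set.mem_insert_iff, Set.mem_singleton_iff,
        Set.mem_union] at hx hy ⊢
      grind
  have c2 : TDOn ((({β, γ, δ} : Finset _) : Set (DisplayVertex T1.leaf T2.leaf)) ∪ S') E k := by
    refine s2.glue t2 (a := γ) (b := δ) (by simp) ((hSS _).2 hv1) (by simp) ((hSS _).2 hv2)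
      (Or.inr (Or.inr (Or.inl (Or.inl ⟨rfl, rfl⟩)))) ?_ ?_
    · intro x hx hx'
      rw [hSS] at hx'
      simp only [Finset.coe_insert, Finset.coe_singleton, Set.mem_insert_iff, Set.mem_singleton_iff] at hx
      grind
    · intro x hx y hy hxy
      have a1 := hcr2 x y
      have a2 := hcr2 y x
      have a3 := hEsymm _ _ hxy
      simp only [Finset.coe_insert, Finset.coe_singleton, Set.mem_insert_iff, Set.mem_singleton_iff,
        Set.mem_union, hSS] at hx hy ⊢
      grind
  have c3 := c1.glue c2 (a := β) (b := γ) (by simp) (by simp) (by simp) (by simp)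
    (Or.inr (Or.inr (Or.inr (Or.inl ⟨rfl, rfl⟩)))) (by
      intro x hx hx'
      simp only [Finset.coe_insert, Finset.coe_singleton, Set.mem_insert_iff, Set.mem_singleton_iff,
        Set.mem_union, hSS] at hx hx'
      grind) (by
      intro x hx y hy hxy
      have a1 := hcr2 x y
      have a2 := hcr2 y x
      have a3 := hEsymm _ _ hxy
      simp only [Finset.coe_insert, Finset.coe_singleton, Set.mem_insert_iff, Set.mem_singleton_iff,
        Set.mem_union, hSS] at hx hy ⊢
      grind)
  refine c3.pull id Function.injective_id ?_ (fun a b hab => Or.inl hab)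
  intro v
  by_cases hv : v ∈ S
  · exact Or.inl (Or.inl hv)
  · exact Or.inr (Or.inr ((hSS v).2 hv))

end SideLib

section RestrLib

variable {V1 V2 X W1 W2 : Type*} {T1 : PhyloTree V1 X} {T2 : PhyloTree V2 X} {Xs : Set X}
  {u1 v1 : V1} {u2 v2 : V2}

/-- the augmented edge relation -/
def EX (T1 : PhyloTree V1 X) (T2 : PhyloTree V2 X) (a1 b1 : V1) (a2 b2 : V2)
    (x y : DisplayVertex T1.leaf T2.leaf) : Prop :=
  (displayGraph T1.graph T1.leaf T2.graph T2.leaf).Adj x y ∨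
    ((x = jl _ _ a1 ∧ y = jl _ _ b1) ∨ (x = jl _ _ b1 ∧ y = jl _ _ a1)) ∨
    ((x = jr _ _ a2 ∧ y = jr _ _ b2) ∨ (x = jr _ _ b2 ∧ y = jr _ _ a2))

/-- the display graph of the restrictions inside the full display graph -/
lemma Side.exists_display_map (h : Side T1 T2 Xs u1 v1 u2 v2)
    {R1 : PhyloTree W1 {x : X // x ∈ Xs}} {R2 : PhyloTree W2 {x : X // x ∈ Xs}}
    (hR1 : IsRestriction T1 Xs R1) (hR2 : IsRestriction T2 Xs R2) :
    ∃ (F : DisplayVertex R1.leaf R2.leaf → DisplayVertex T1.leaf T2.leaf) (a1 b1 : V1) (a2 b2 : V2),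
      Function.Injective F ∧
      (∀ d, (∃ w, F w = d) ↔ d ∈ DS T1 T2 u1 v1 u2 v2 ∧ d ≠ jl _ _ u1 ∧ d ≠ jr _ _ u2) ∧
      (a1 ≠ b1 ∧ a1 ≠ v1 ∧ b1 ≠ v1 ∧ (∀ m, T1.graph.Adj u1 m ↔ m = v1 ∨ m = a1 ∨ m = b1)) ∧
      (a2 ≠ b2 ∧ a2 ≠ v2 ∧ b2 ≠ v2 ∧ (∀ m, T2.graph.Adj u2 m ↔ m = v2 ∨ m = a2 ∨ m = b2)) ∧
      (∀ d e, (displayGraph R1.graph R1.leaf R2.graph R2.leaf).Adj d e ↔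
        EX T1 T2 a1 b1 a2 b2 (F d) (F e)) := by
  obtain ⟨g1, a1, b1, gi1, gr1, gl1, ab1, av1, bv1, nb1, ga1⟩ := h.o1.exists_map h.nu1 hR1
  obtain ⟨g2, a2, b2, gi2, gr2, gl2, ab2, av2, bv2, nb2, ga2⟩ := h.o2.exists_map h.nu2 hR2
  have i1 := T1.leaf_inj
  have i2 := T2.leaf_inj
  have k1 := R1.leaf_inj
  have k2 := R2.leaf_inj
  let F : DisplayVertex R1.leaf R2.leaf → DisplayVertex T1.leaf T2.leaf := fun d =>
    Sum.elim (fun w => jl T1.leaf T2.leaf (g1 w)) (fun w => jr T1.leaf T2.leaf (g2 w)) d.1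
  have Fl : ∀ w, F (jl _ _ w) = jl _ _ (g1 w) := fun w => rfl
  have Fr : ∀ w, F (jr _ _ w) = jr _ _ (g2 w) := by
    intro w
    by_cases hw : ∃ x, R2.leaf x = w
    · obtain ⟨x, rfl⟩ := hw
      rw [jr_leaf k2, Fl, gl1, gl2, jr_leaf i2]
    · push Not at hw
      change Sum.elim _ _ (jr R1.leaf R2.leaf w).1 = _
      rw [jr_val hw]
      rfl
  have lr : ∀ w w', jl T1.leaf T2.leaf (g1 w) = jr T1.leaf T2.leaf (g2 w') →
      jl R1.leaf R2.leaf w = jr R1.leaf R2.leaf w' := by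
    intro w w' hh
    obtain ⟨x, hx, hx'⟩ := (jl_eq_jr i2).1 hh
    have hxs : x ∈ Xs := by
      rw [h.o1.2 x, ← hx]
      exact ((gr1 _).1 ⟨w, rfl⟩).1
    rw [jl_eq_jr k2]
    refine ⟨⟨x, hxs⟩, gi1 ?_, gi2 ?_⟩
    · rw [gl1]; exact hx
    · rw [gl2]; exact hx'
  have Finj : Function.Injective F := by
    intro d e hde
    rcases j_cover d with ⟨w, rfl⟩ | ⟨w, rfl⟩ <;> rcases j_cover e with ⟨w', rfl⟩ | ⟨w', rfl⟩
    · rw [Fl, Fl, jl_inj] at hde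
      rw [gi1 hde]
    · rw [Fl, Fr] at hde
      exact lr _ _ hde
    · rw [Fl, Fr] at hde
      exact (lr _ _ hde.symm).symm
    · rw [Fr, Fr, jr_inj i1 i2] at hde
      rw [gi2 hde]
  refine ⟨F, a1, b1, a2, b2, Finj, ?_, ⟨ab1, av1, bv1, nb1⟩, ⟨ab2, av2, bv2, nb2⟩, ?_⟩
  · intro d
    constructor
    · rintro ⟨w, rfl⟩
      rcases j_cover w with ⟨w, rfl⟩ | ⟨w, rfl⟩
      · have := (gr1 _).1 ⟨w, rfl⟩
        rw [Fl]
        exact ⟨h.jl_mem.2 this.1, fun hh => this.2 (jl_inj.1 hh), h.jl_ne_u2 _⟩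
      · have := (gr2 _).1 ⟨w, rfl⟩
        rw [Fr]
        exact ⟨h.jr_mem.2 this.1, h.jr_ne_u1 _, fun hh => this.2 ((jr_inj i1 i2).1 hh)⟩
    · rintro ⟨hd, hd1, hd2⟩
      rcases hd with ⟨a, rfl, ha⟩ | ⟨a, rfl, ha⟩
      · obtain ⟨w, rfl⟩ := (gr1 a).2 ⟨ha, fun hh => hd1 (by rw [hh])⟩
        exact ⟨_, Fl w⟩
      · obtain ⟨w, rfl⟩ := (gr2 a).2 ⟨ha, fun hh => hd2 (by rw [hh])⟩
        exact ⟨_, Fr w⟩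
  · intro d e
    constructor
    · intro hde
      rcases (display_adj k1 k2).1 hde with ⟨w, w', hw, rfl, rfl⟩ | ⟨w, w', hw, rfl, rfl⟩
      · rw [Fl, Fl]
        rcases (ga1 w w').1 hw with h1 | ⟨h1, h2⟩ | ⟨h1, h2⟩
        · exact Or.inl ((display_adj i1 i2).2 (Or.inl ⟨_, _, h1, rfl, rfl⟩))
        · exact Or.inr (Or.inl (Or.inl ⟨by rw [h1], by rw [h2]⟩))
        · exact Or.inr (Or.inl (Or.inr ⟨by rw [h1], by rw [h2]⟩))
      · rw [Fr, Fr]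
        rcases (ga2 w w').1 hw with h1 | ⟨h1, h2⟩ | ⟨h1, h2⟩
        · exact Or.inl ((display_adj i1 i2).2 (Or.inr ⟨_, _, h1, rfl, rfl⟩))
        · exact Or.inr (Or.inr (Or.inl ⟨by rw [h1], by rw [h2]⟩))
        · exact Or.inr (Or.inr (Or.inr ⟨by rw [h1], by rw [h2]⟩))
    · -- lifting of representatives
      have gFl : ∀ w a, F w = jl _ _ a → ∃ z, g1 z = a ∧ w = jl _ _ z := by
        intro w a hw
        rcases j_cover w with ⟨z, rfl⟩ | ⟨z, rfl⟩
        · rw [Fl, jl_inj] at hw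
          exact ⟨z, hw, rfl⟩
        · rw [Fr] at hw
          obtain ⟨x, rfl, hx'⟩ := (jl_eq_jr i2).1 hw.symm
          have hxs : x ∈ Xs := by
            rw [h.o2.2 x, ← hx']
            exact ((gr2 _).1 ⟨z, rfl⟩).1
          refine ⟨R1.leaf ⟨x, hxs⟩, gl1 _, ?_⟩
          rw [← jr_leaf k2]
          congr 1
          apply gi2
          rw [gl2, hx']
      have gFr : ∀ w a, F w = jr _ _ a → ∃ z, g2 z = a ∧ w = jr _ _ z := by
        intro w a hw
        rcases j_cover w with ⟨z, rfl⟩ | ⟨z, rfl⟩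
        · rw [Fl] at hw
          obtain ⟨x, hx', rfl⟩ := (jl_eq_jr i2).1 hw
          have hxs : x ∈ Xs := by
            rw [h.o1.2 x, ← hx']
            exact ((gr1 _).1 ⟨z, rfl⟩).1
          refine ⟨R2.leaf ⟨x, hxs⟩, gl2 _, ?_⟩
          rw [jr_leaf k2]
          congr 1
          apply gi1
          rw [gl1, hx']
        · rw [Fr, jr_inj i1 i2] at hw
          exact ⟨z, hw, rfl⟩
      have L : ∀ a b, F d = jl _ _ a → F e = jl _ _ b → (T1.graph.Adj a b ∨ (a = a1 ∧ b = b1) ∨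
          (a = b1 ∧ b = a1)) → (displayGraph R1.graph R1.leaf R2.graph R2.leaf).Adj d e := by
        intro a b ha hb hab
        obtain ⟨z, rfl, rfl⟩ := gFl _ _ ha
        obtain ⟨z', rfl, rfl⟩ := gFl _ _ hb
        exact (display_adj k1 k2).2 (Or.inl ⟨z, z', (ga1 _ _).2 hab, rfl, rfl⟩)
      have L' : ∀ a b, F d = jr _ _ a → F e = jr _ _ b → (T2.graph.Adj a b ∨ (a = a2 ∧ b = b2) ∨
          (a = b2 ∧ b = a2)) → (displayGraph R1.graph R1.leaf R2.graph R2.leaf).Adj d e := by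
        intro a b ha hb hab
        obtain ⟨z, rfl, rfl⟩ := gFr _ _ ha
        obtain ⟨z', rfl, rfl⟩ := gFr _ _ hb
        exact (display_adj k1 k2).2 (Or.inr ⟨z, z', (ga2 _ _).2 hab, rfl, rfl⟩)
      rintro (hde | (⟨h1, h2⟩ | ⟨h1, h2⟩) | (⟨h1, h2⟩ | ⟨h1, h2⟩))
      · rcases (display_adj i1 i2).1 hde with ⟨a, b, hab, ha, hb⟩ | ⟨a, b, hab, ha, hb⟩
        · exact L a b ha hb (Or.inl hab)
        · exact L' a b ha hb (Or.inl hab)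
      · exact L _ _ h1 h2 (Or.inr (Or.inl ⟨rfl, rfl⟩))
      · exact L _ _ h1 h2 (Or.inr (Or.inr ⟨rfl, rfl⟩))
      · exact L' _ _ h1 h2 (Or.inr (Or.inl ⟨rfl, rfl⟩))
      · exact L' _ _ h1 h2 (Or.inr (Or.inr ⟨rfl, rfl⟩))

lemma Side.u1_nbr (h : Side T1 T2 Xs u1 v1 u2 v2) {d : DisplayVertex T1.leaf T2.leaf}
    (hd : (displayGraph T1.graph T1.leaf T2.graph T2.leaf).Adj (jl _ _ u1) d) :
    ∃ m, T1.graph.Adj u1 m ∧ d = jl _ _ m := by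
  rcases (display_adj T1.leaf_inj T2.leaf_inj).1 hd with ⟨a, b, hab, ha, hb⟩ | ⟨a, b, hab, ha, hb⟩
  · rw [jl_inj] at ha
    subst ha
    exact ⟨b, hab, hb⟩
  · exact absurd ha.symm (h.jr_ne_u1 a)

lemma Side.u2_nbr (h : Side T1 T2 Xs u1 v1 u2 v2) {d : DisplayVertex T1.leaf T2.leaf}
    (hd : (displayGraph T1.graph T1.leaf T2.graph T2.leaf).Adj (jr _ _ u2) d) :
    ∃ m, T2.graph.Adj u2 m ∧ d = jr _ _ m := by
  rcases (display_adj T1.leaf_inj T2.leaf_inj).1 hd with ⟨a, b, hab, ha, hb⟩ | ⟨a, b, hab, ha, hb⟩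
  · exact absurd ha.symm (h.jl_ne_u2 a)
  · rw [jr_inj T1.leaf_inj T2.leaf_inj] at ha
    subst ha
    exact ⟨b, hab, hb⟩

lemma Side.side_iff_restr (h : Side T1 T2 Xs u1 v1 u2 v2)
    {R1 : PhyloTree W1 {x : X // x ∈ Xs}} {R2 : PhyloTree W2 {x : X // x ∈ Xs}}
    (hR1 : IsRestriction T1 Xs R1) (hR2 : IsRestriction T2 Xs R2) (k : ℕ) :
    (HasTreeDecompWidthLE (splitSide T1 T2 u1 v1 u2 v2 u1) k →
      HasTreeDecompWidthLE (displayGraph R1.graph R1.leaf R2.graph R2.leaf) k) ∧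
    (2 ≤ k → HasTreeDecompWidthLE (displayGraph R1.graph R1.leaf R2.graph R2.leaf) k →
      HasTreeDecompWidthLE (splitSide T1 T2 u1 v1 u2 v2 u1) k) := by
  classical
  obtain ⟨F, a1, b1, a2, b2, Finj, Fr, ⟨ab1, av1, bv1, nb1⟩, ⟨ab2, av2, bv2, nb2⟩, Fadj⟩ :=
    h.exists_display_map hR1 hR2
  have hu1 := h.u1_mem
  have hu2 := h.u2_mem
  have hv1 := h.v1_mem
  have hv2 := h.v2_mem
  have hc1 : ∀ d, (displayGraph T1.graph T1.leaf T2.graph T2.leaf).Adj (jl _ _ u1) d →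
      d = jl _ _ v1 ∨ d = jl _ _ a1 ∨ d = jl _ _ b1 := by
    intro d hd
    obtain ⟨m, hm, rfl⟩ := h.u1_nbr hd
    rcases (nb1 m).1 hm with rfl | rfl | rfl <;> simp
  have hc2 : ∀ d, (displayGraph T1.graph T1.leaf T2.graph T2.leaf).Adj (jr _ _ u2) d →
      d = jr _ _ v2 ∨ d = jr _ _ a2 ∨ d = jr _ _ b2 := by
    intro d hd
    obtain ⟨m, hm, rfl⟩ := h.u2_nbr hd
    rcases (nb2 m).1 hm with rfl | rfl | rfl <;> simp
  have e1 : ∀ m, T1.graph.Adj u1 m →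
      (displayGraph T1.graph T1.leaf T2.graph T2.leaf).Adj (jl _ _ u1) (jl _ _ m) := fun m hm =>
    (display_adj T1.leaf_inj T2.leaf_inj).2 (Or.inl ⟨_, _, hm, rfl, rfl⟩)
  have e2 : ∀ m, T2.graph.Adj u2 m →
      (displayGraph T1.graph T1.leaf T2.graph T2.leaf).Adj (jr _ _ u2) (jr _ _ m) := fun m hm =>
    (display_adj T1.leaf_inj T2.leaf_inj).2 (Or.inr ⟨_, _, hm, rfl, rfl⟩)
  have ua1 := (nb1 a1).2 (by simp)
  have ub1 := (nb1 b1).2 (by simp)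
  have ua2 := (nb2 a2).2 (by simp)
  have ub2 := (nb2 b2).2 (by simp)
  have m1 : ∀ m, T1.graph.Adj u1 m → m ≠ v1 → jl T1.leaf T2.leaf m ∈ DS T1 T2 u1 v1 u2 v2 ∧
      jl T1.leaf T2.leaf m ≠ jl T1.leaf T2.leaf u1 ∧ jl T1.leaf T2.leaf m ≠ jr T1.leaf T2.leaf u2 := by
    intro m hm hmv
    exact ⟨h.jl_mem.2 (not_sep_adj hm h.o1.1.ne' hmv.symm), fun hh => hm.ne (jl_inj.1 hh).symm,
      h.jl_ne_u2 _⟩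
  have m2 : ∀ m, T2.graph.Adj u2 m → m ≠ v2 → jr T1.leaf T2.leaf m ∈ DS T1 T2 u1 v1 u2 v2 ∧
      jr T1.leaf T2.leaf m ≠ jl T1.leaf T2.leaf u1 ∧ jr T1.leaf T2.leaf m ≠ jr T1.leaf T2.leaf u2 := by
    intro m hm hmv
    exact ⟨h.jr_mem.2 (not_sep_adj hm h.o2.1.ne' hmv.symm), h.jr_ne_u1 _,
      fun hh => hm.ne ((jr_inj T1.leaf_inj T2.leaf_inj).1 hh).symm⟩
  have A1 := m1 a1 ua1 av1
  have B1 := m1 b1 ub1 bv1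
  have A2 := m2 a2 ua2 av2
  have B2 := m2 b2 ub2 bv2
  have EA1 := e1 a1 ua1
  have EB1 := e1 b1 ub1
  have EA2 := e2 a2 ua2
  have EB2 := e2 b2 ub2
  have n12 := h.jl_ne_u2 u1
  have hEX : ∀ x y, EX T1 T2 a1 b1 a2 b2 x y ↔
      (displayGraph T1.graph T1.leaf T2.graph T2.leaf).Adj x y ∨
    ((x = jl _ _ a1 ∧ y = jl _ _ b1) ∨ (x = jl _ _ b1 ∧ y = jl _ _ a1)) ∨
    ((x = jr _ _ a2 ∧ y = jr _ _ b2) ∨ (x = jr _ _ b2 ∧ y = jr _ _ a2)) := fun x y => Iff.rfl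
  set D := displayGraph T1.graph T1.leaf T2.graph T2.leaf with hD
  set S := DS T1 T2 u1 v1 u2 v2 with hS
  set α := jl T1.leaf T2.leaf u1
  set β := jr T1.leaf T2.leaf u2
  set γ := jl T1.leaf T2.leaf v1
  set δ := jr T1.leaf T2.leaf v2
  set p1 := jl T1.leaf T2.leaf a1
  set q1 := jl T1.leaf T2.leaf b1
  set p2 := jr T1.leaf T2.leaf a2
  set q2 := jr T1.leaf T2.leaf b2
  set E := EX T1 T2 a1 b1 a2 b2
  let S0 : Set (DisplayVertex T1.leaf T2.leaf) := {d | d ∈ S ∧ d ≠ α ∧ d ≠ β}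
  have hS0 : ∀ d, d ∈ S0 ↔ d ∈ S ∧ d ≠ α ∧ d ≠ β := fun d => Iff.rfl
  constructor
  · intro hk
    let f : splitComponent T1 T2 u1 v1 u2 v2 u1 → DisplayVertex T1.leaf T2.leaf :=
      fun d => if d.1 = α then p1 else if d.1 = β then p2 else d.1
    have f0 : ∀ d, d.1 ≠ α → d.1 ≠ β → f d = d.1 := by
      intro d h1 h2
      simp only [f]
      rw [if_neg h1, if_neg h2]
    have f1 : ∀ d, d.1 = α → f d = p1 := by
      intro d h1
      simp only [f]
      rw [if_pos h1]
    have f2 : ∀ d, d.1 = β → f d = p2 := by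
      intro d h1
      simp only [f]
      rw [if_neg (by rw [h1]; exact n12.symm), if_pos h1]
    have lift : ∀ d ∈ S, d ∈ splitComponent T1 T2 u1 v1 u2 v2 u1 := fun d hd => (h.mem_comp d).2 hd
    have hfm : ∀ d, f d ∈ S0 := by
      intro d
      by_cases h1 : d.1 = α
      · rw [f1 d h1]; exact A1
      · by_cases h2 : d.1 = β
        · rw [f2 d h2]; exact A2
        · rw [f0 d h1 h2]
          exact ⟨(h.mem_comp _).1 d.2, h1, h2⟩
    have hTD : TDOn S0 E k := by
      refine hk.map f (S := S0) ?_ _ ?_ ?_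
      · intro w
        constructor
        · intro hw
          exact ⟨⟨w, lift w hw.1⟩, f0 _ hw.2.1 hw.2.2⟩
        · rintro ⟨v, rfl⟩
          exact hfm v
      · intro w
        by_cases hw : w ∈ S0
        · have hfw : f ⟨w, lift w hw.1⟩ = w := f0 _ hw.2.1 hw.2.2
          have key : ∀ x : {x | f x = w},
              ((splitSide T1 T2 u1 v1 u2 v2 u1).induce {x | f x = w}).Reachable
                x ⟨⟨w, lift w hw.1⟩, hfw⟩ := by
            rintro ⟨x, hx⟩
            have hx' : f x = w := hx
            by_cases h1 : x.1 = α
            · apply Adj.reachable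
              change (splitSide T1 T2 u1 v1 u2 v2 u1).Adj x ⟨w, lift w hw.1⟩
              rw [h.side_adj]
              rw [f1 x h1] at hx'
              simp only
              rw [h1, ← hx']
              exact EA1
            · by_cases h2 : x.1 = β
              · apply Adj.reachable
                change (splitSide T1 T2 u1 v1 u2 v2 u1).Adj x ⟨w, lift w hw.1⟩
                rw [h.side_adj]
                rw [f2 x h2] at hx'
                simp only
                rw [h2, ← hx']
                exact EA2
              · rw [f0 x h1 h2] at hx'
                have : x = ⟨w, lift w hw.1⟩ := Subtype.ext hx'
                subst this
                exact Reachable.refl _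
          intro x y
          exact (key x).trans (key y).symm
        · rintro ⟨x, hx⟩
          have hx' : f x = w := hx
          exact absurd (hx' ▸ hfm x) hw
      · intro x hx y hy hxy
        rcases (hEX x y).1 hxy with hxy | (⟨rfl, rfl⟩ | ⟨rfl, rfl⟩) | (⟨rfl, rfl⟩ | ⟨rfl, rfl⟩)
        · exact Or.inr ⟨⟨x, lift x hx.1⟩, ⟨y, lift y hy.1⟩, f0 _ hx.2.1 hx.2.2, f0 _ hy.2.1 hy.2.2,
            h.side_adj.2 hxy⟩
        · exact Or.inr ⟨⟨α, lift _ hu1⟩, ⟨q1, lift _ B1.1⟩, f1 _ rfl, f0 _ B1.2.1 B1.2.2,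
            h.side_adj.2 EB1⟩
        · exact Or.inr ⟨⟨q1, lift _ B1.1⟩, ⟨α, lift _ hu1⟩, f0 _ B1.2.1 B1.2.2, f1 _ rfl,
            h.side_adj.2 EB1.symm⟩
        · exact Or.inr ⟨⟨β, lift _ hu2⟩, ⟨q2, lift _ B2.1⟩, f2 _ rfl, f0 _ B2.2.1 B2.2.2,
            h.side_adj.2 EB2⟩
        · exact Or.inr ⟨⟨q2, lift _ B2.1⟩, ⟨β, lift _ hu2⟩, f0 _ B2.2.1 B2.2.2, f2 _ rfl,
            h.side_adj.2 EB2.symm⟩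
    exact hTD.pull F Finj (fun d => (Fr _).1 ⟨d, rfl⟩) (fun a b hab => (Fadj a b).1 hab)
  · intro hk2 hk
    have t0 : TDOn S0 E k := by
      refine hk.map_inj F Finj (fun w => (Fr w).symm) E ?_
      intro x hx y hy hxy
      obtain ⟨d, rfl⟩ := (Fr x).2 hx
      obtain ⟨e, rfl⟩ := (Fr y).2 hy
      exact Or.inr ⟨d, e, rfl, rfl, (Fadj d e).2 hxy⟩
    have s1 : TDOn (({α, p1, q1} : Finset _) : Set (DisplayVertex T1.leaf T2.leaf)) E k :=
      TDOn.small E (Finset.card_le_three.trans (by omega))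
    have s2 : TDOn (({β, p2, q2} : Finset _) : Set (DisplayVertex T1.leaf T2.leaf)) E k :=
      TDOn.small E (Finset.card_le_three.trans (by omega))
    have hEα : ∀ y ∈ S, E α y ∨ E y α → y = p1 ∨ y = q1 := by
      intro y hy hh
      have : D.Adj α y := by
        rcases hh with hh | hh
        · rcases (hEX _ _).1 hh with hh | hh
          · exact hh
          · grind
        · rcases (hEX _ _).1 hh with hh | hh
          · exact hh.symm
          · grind
      rcases hc1 y this with rfl | h1
      · exact absurd hy hv1
      · exact h1
    have hEβ : ∀ y ∈ S, E β y ∨ E y β → y = p2 ∨ y = q2 := by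
      intro y hy hh
      have : D.Adj β y := by
        rcases hh with hh | hh
        · rcases (hEX _ _).1 hh with hh | hh
          · exact hh
          · grind
        · rcases (hEX _ _).1 hh with hh | hh
          · exact hh.symm
          · grind
      rcases hc2 y this with rfl | h1
      · exact absurd hy hv2
      · exact h1
    have c1 : TDOn (S0 ∪ (({α, p1, q1} : Finset _) : Set (DisplayVertex T1.leaf T2.leaf))) E k := by
      refine t0.glue s1 (a := p1) (b := q1) A1 (by simp) B1 (by simp)
        ((hEX _ _).2 (Or.inr (Or.inl (Or.inl ⟨rfl, rfl⟩)))) ?_ ?_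
      · intro x hx hx'
        rw [hS0] at hx
        simp only [Finset.coe_insert, Finset.coe_singleton, Set.mem_insert_iff, Set.mem_singleton_iff] at hx'
        grind
      · intro x hx y hy hxy
        simp only [Finset.coe_insert, Finset.coe_singleton, Set.mem_insert_iff, Set.mem_singleton_iff,
          Set.mem_union, hS0] at hx hy ⊢
        have a1 := hEα x
        have a2 := hEα y
        grind
    have c2 := c1.glue s2 (a := p2) (b := q2) (Or.inl A2) (by simp) (Or.inl B2) (by simp)
        ((hEX _ _).2 (Or.inr (Or.inr (Or.inl ⟨rfl, rfl⟩)))) (by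
        intro x hx hx'
        simp only [Finset.coe_insert, Finset.coe_singleton, Set.mem_insert_iff, Set.mem_singleton_iff,
          Set.mem_union, hS0] at hx hx'
        grind) (by
        intro x hx y hy hxy
        simp only [Finset.coe_insert, Finset.coe_singleton, Set.mem_insert_iff, Set.mem_singleton_iff,
          Set.mem_union, hS0] at hx hy ⊢
        have a1 := hEβ x
        have a2 := hEβ y
        grind)
    refine c2.pull Subtype.val Subtype.val_injective ?_ ?_
    · intro v
      have hv := (h.mem_comp _).1 v.2
      simp only [Finset.coe_insert, Finset.coe_singleton, Set.mem_insert_iff, Set.mem_singleton_iff,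
          Set.mem_union, hS0]
      grind
    · intro a b hab
      exact (hEX _ _).2 (Or.inl (h.side_adj.1 hab))

/-- a side with exactly two labels -/
lemma Side.plus_two (h : Side T1 T2 Xs u1 v1 u2 v2)
    {R1 : PhyloTree W1 {x : X // x ∈ Xs}} {R2 : PhyloTree W2 {x : X // x ∈ Xs}}
    (hR1 : IsRestriction T1 Xs R1) (hR2 : IsRestriction T2 Xs R2) {x y : {x : X // x ∈ Xs}}
    (hxy : ∀ z, z = x ∨ z = y) :
    HasTreeDecompWidthLE (splitSidePlus T1 T2 u1 v1 u2 v2 u1 u2) 2 := by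
  classical
  obtain ⟨g1, -, -, -, gr1, gl1, -⟩ := h.o1.exists_map h.nu1 hR1
  obtain ⟨g2, -, -, -, gr2, gl2, -⟩ := h.o2.exists_map h.nu2 hR2
  obtain ⟨z0, hz0⟩ := h.nec
  have hzx : z0 ≠ x.1 := fun hh => hz0 (hh ▸ x.2)
  have hzy : z0 ≠ y.1 := fun hh => hz0 (hh ▸ y.2)
  have hno : ¬ (displayGraph T1.graph T1.leaf T2.graph T2.leaf).Adj (jl _ _ (T1.leaf x.1))
      (jl _ _ (T1.leaf y.1)) := by
    intro hh
    rcases (display_adj T1.leaf_inj T2.leaf_inj).1 hh with ⟨a, b, hab, ha, hb⟩ | ⟨a, b, hab, ha, hb⟩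
    · rw [jl_inj] at ha hb
      subst ha hb
      exact T1.not_adj_leaf hzx hzy hab
    · rw [← jr_leaf T2.leaf_inj, jr_inj T1.leaf_inj T2.leaf_inj] at ha hb
      subst ha hb
      exact T2.not_adj_leaf hzx hzy hab
  have hall : ∀ d ∈ DS T1 T2 u1 v1 u2 v2, d = jl _ _ u1 ∨ d = jr _ _ u2 ∨
      d = jl _ _ (T1.leaf x.1) ∨ d = jl _ _ (T1.leaf y.1) := by
    have hl : ∀ z : {x : X // x ∈ Xs}, jl T1.leaf T2.leaf (T1.leaf z.1) = jl _ _ (T1.leaf x.1) ∨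
        jl T1.leaf T2.leaf (T1.leaf z.1) = jl _ _ (T1.leaf y.1) := by
      intro z
      rcases hxy z with rfl | rfl <;> simp
    rintro d (⟨a, rfl, ha⟩ | ⟨a, rfl, ha⟩)
    · by_cases hau : a = u1
      · exact Or.inl (by rw [hau])
      · obtain ⟨w, rfl⟩ := (gr1 a).2 ⟨ha, hau⟩
        obtain ⟨z, rfl⟩ := R1.leaf_of_two hxy w
        rw [gl1]
        exact Or.inr (Or.inr (hl z))
    · by_cases hau : a = u2
      · exact Or.inr (Or.inl (by rw [hau]))
      · obtain ⟨w, rfl⟩ := (gr2 a).2 ⟨ha, hau⟩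
        obtain ⟨z, rfl⟩ := R2.leaf_of_two hxy w
        rw [gl2, jr_leaf T2.leaf_inj]
        exact Or.inr (Or.inr (hl z))
  have hx1 : jl T1.leaf T2.leaf (T1.leaf x.1) ≠ jl _ _ u1 := fun hh => h.nu1 _ (jl_inj.1 hh)
  have hy1 : jl T1.leaf T2.leaf (T1.leaf y.1) ≠ jl _ _ u1 := fun hh => h.nu1 _ (jl_inj.1 hh)
  have hx2 := h.jl_ne_u2 (T1.leaf x.1)
  have hy2 := h.jl_ne_u2 (T1.leaf y.1)
  have hpl := fun {a b} => (@Side.plus_adj _ _ _ _ _ _ _ _ _ _ h a b).1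
  set D := displayGraph T1.graph T1.leaf T2.graph T2.leaf with hD
  set α := jl T1.leaf T2.leaf u1
  set β := jr T1.leaf T2.leaf u2
  set ξ := jl T1.leaf T2.leaf (T1.leaf x.1)
  set η := jl T1.leaf T2.leaf (T1.leaf y.1)
  by_cases hxe : ξ = η
  · have s1 : TDOn (({α, β, ξ} : Finset _) : Set (DisplayVertex T1.leaf T2.leaf))
        (fun _ _ => True) 2 := TDOn.small _ Finset.card_le_three
    refine s1.pull Subtype.val Subtype.val_injective ?_ (fun _ _ _ => trivial)
    intro v
    have hv := hall _ ((h.mem_comp _).1 v.2)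
    simp only [Finset.coe_insert, Finset.coe_singleton, Set.mem_insert_iff, Set.mem_singleton_iff]
    grind
  · let E : DisplayVertex T1.leaf T2.leaf → DisplayVertex T1.leaf T2.leaf → Prop := fun a b =>
      D.Adj a b ∨ (a = α ∧ b = β) ∨ (b = α ∧ a = β)
    have hE : ∀ a b, E a b ↔ D.Adj a b ∨ (a = α ∧ b = β) ∨ (b = α ∧ a = β) := fun _ _ => Iff.rfl
    have s1 : TDOn (({α, β, ξ} : Finset _) : Set (DisplayVertex T1.leaf T2.leaf)) E 2 :=
      TDOn.small _ Finset.card_le_three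
    have s2 : TDOn (({α, β, η} : Finset _) : Set (DisplayVertex T1.leaf T2.leaf)) E 2 :=
      TDOn.small _ Finset.card_le_three
    have hno' : ¬ D.Adj η ξ := fun hh => hno hh.symm
    have c := s1.glue s2 (a := α) (b := β) (by simp) (by simp) (by simp) (by simp)
      ((hE _ _).2 (by simp)) (by
        intro z hz hz'
        simp only [Finset.coe_insert, Finset.coe_singleton, Set.mem_insert_iff,
          Set.mem_singleton_iff] at hz hz'
        grind) (by
        intro z hz w hw hzw
        rw [hE] at hzw
        simp only [Finset.coe_insert, Finset.coe_singleton, Set.mem_insert_iff,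
          Set.mem_singleton_iff, Set.mem_union] at hz hw ⊢
        grind)
    refine c.pull Subtype.val Subtype.val_injective ?_ (fun a b hab => hpl hab)
    intro v
    have hv := hall _ ((h.mem_comp _).1 v.2)
    simp only [Finset.coe_insert, Finset.coe_singleton, Set.mem_insert_iff, Set.mem_singleton_iff,
      Set.mem_union]
    grind

end RestrLib

section Final

variable {V1 V2 X W1 W2 : Type*} {T1 : PhyloTree V1 X} {T2 : PhyloTree V2 X}
  {Xs : Set X} {u1 v1 : V1} {u2 v2 : V2}

lemma QD.excl {T : PhyloTree V1 X} {a b c d : X} (h1 : QD T.graph T.leaf a b c d)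
    (h2 : QD T.graph T.leaf a c b d) : False := by
  obtain ⟨m, m1, m2, m3⟩ := exists_median T.connected T.acyclic (T.leaf a) (T.leaf b) (T.leaf c)
  have h3 := h1 m m1
  have h4 := h2 m m3
  exact not_sep_trans h4 (fun h => h3 h.symm) m2

lemma QD.flip {T : PhyloTree V1 X} {a b c d : X} (h1 : QD T.graph T.leaf a b c d) :
    QD T.graph T.leaf a b d c := fun m hm hs => h1 m hm hs.symm

lemma OnSide.quartet_iff {T : PhyloTree V1 X} {u v : V1} (HH : OnSide T Xs u v)
    {a b c d : X}
    (h : (a ∈ Xs ∧ b ∈ Xs ∧ c ∉ Xs ∧ d ∉ Xs) ∨ (a ∉ Xs ∧ b ∉ Xs ∧ c ∈ Xs ∧ d ∈ Xs) ∨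
      (a ∈ Xs ∧ b ∉ Xs ∧ c ∈ Xs ∧ d ∉ Xs) ∨ (a ∉ Xs ∧ b ∈ Xs ∧ c ∉ Xs ∧ d ∈ Xs) ∨
      (a ∈ Xs ∧ b ∉ Xs ∧ c ∉ Xs ∧ d ∈ Xs) ∨ (a ∉ Xs ∧ b ∈ Xs ∧ c ∈ Xs ∧ d ∉ Xs)) :
    QD T.graph T.leaf a b c d ↔ (a ∈ Xs ↔ b ∈ Xs) := by
  rcases h with ⟨ha, hb, hc, hd⟩ | ⟨ha, hb, hc, hd⟩ | ⟨ha, hb, hc, hd⟩ | ⟨ha, hb, hc, hd⟩ |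
    ⟨ha, hb, hc, hd⟩ | ⟨ha, hb, hc, hd⟩
  · simp only [ha, hb, iff_true]; exact HH.quartet ha hb hc hd
  · simp only [ha, hb, iff_true]
    exact HH.swap.quartet ha hb (fun h => h hc) (fun h => h hd)
  · simp only [ha, hb, iff_false, iff_true, not_true_eq_false]
    exact fun h => h.excl (HH.quartet ha hc hb hd)
  · simp only [ha, hb, iff_false, iff_true, not_true_eq_false]
    exact fun h => h.excl (HH.swap.quartet ha hc (fun h => h hb) (fun h => h hd))
  · simp only [ha, hb, iff_false, iff_true, not_true_eq_false]
    exact fun h => h.flip.excl (HH.quartet ha hd hb hc)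
  · simp only [ha, hb, iff_false, iff_true, not_true_eq_false]
    exact fun h => h.flip.excl (HH.swap.quartet ha hd (fun h => h hb) (fun h => h hc))

lemma compatible_two_two (o1 : OnSide T1 Xs u1 v1) (o2 : OnSide T2 Xs u2 v2)
    {x y z w : X} (hxy : ∀ t, t ∈ Xs → t = x ∨ t = y) (hzw : ∀ t, t ∉ Xs → t = z ∨ t = w) :
    Compatible T1 T2 := by
  apply compatible_of_quartets
  intro a b c d hab hac had hbc hbd hcd
  have key : (a ∈ Xs ∧ b ∈ Xs ∧ c ∉ Xs ∧ d ∉ Xs) ∨ (a ∉ Xs ∧ b ∉ Xs ∧ c ∈ Xs ∧ d ∈ Xs) ∨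
      (a ∈ Xs ∧ b ∉ Xs ∧ c ∈ Xs ∧ d ∉ Xs) ∨ (a ∉ Xs ∧ b ∈ Xs ∧ c ∉ Xs ∧ d ∈ Xs) ∨
      (a ∈ Xs ∧ b ∉ Xs ∧ c ∉ Xs ∧ d ∈ Xs) ∨ (a ∉ Xs ∧ b ∈ Xs ∧ c ∈ Xs ∧ d ∉ Xs) := by
    have t1 : ∀ a b c, a ≠ b → a ≠ c → b ≠ c → a ∈ Xs → b ∈ Xs → c ∈ Xs → False := by
      intro a b c h1 h2 h3 ha hb hc
      rcases hxy a ha with rfl | rfl <;> rcases hxy b hb with rfl | rfl <;>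
        rcases hxy c hc with rfl | rfl <;> simp_all
    have t2 : ∀ a b c, a ≠ b → a ≠ c → b ≠ c → a ∉ Xs → b ∉ Xs → c ∉ Xs → False := by
      intro a b c h1 h2 h3 ha hb hc
      rcases hzw a ha with rfl | rfl <;> rcases hzw b hb with rfl | rfl <;>
        rcases hzw c hc with rfl | rfl <;> simp_all
    have a1 := t1 a b c hab hac hbc
    have a2 := t1 a b d hab had hbd
    have a3 := t1 a c d hac had hcd
    have a4 := t1 b c d hbc hbd hcd
    have b1 := t2 a b c hab hac hbc
    have b2 := t2 a b d hab had hbd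
    have b3 := t2 a c d hac had hcd
    have b4 := t2 b c d hbc hbd hcd
    clear t1 t2
    by_cases ha : a ∈ Xs <;> by_cases hb : b ∈ Xs <;> by_cases hc : c ∈ Xs <;>
      by_cases hd : d ∈ Xs <;> simp_all
  rw [o1.quartet_iff key, o2.quartet_iff key]

/-- all the numerical facts about one side of the split -/
lemma Side.facts (h : Side T1 T2 Xs u1 v1 u2 v2)
    {R1 : PhyloTree W1 {x : X // x ∈ Xs}} {R2 : PhyloTree W2 {x : X // x ∈ Xs}}
    (hR1 : IsRestriction T1 Xs R1) (hR2 : IsRestriction T2 Xs R2) :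
    treewidth (splitSide T1 T2 u1 v1 u2 v2 u1) ≤ treewidth (splitSidePlus T1 T2 u1 v1 u2 v2 u1 u2) ∧
    treewidth (splitSidePlus T1 T2 u1 v1 u2 v2 u1 u2) ≤
      treewidth (splitSide T1 T2 u1 v1 u2 v2 u1) + 1 ∧
    treewidth (splitSidePlus T1 T2 u1 v1 u2 v2 u1 u2) ≤
      treewidth (displayGraph T1.graph T1.leaf T2.graph T2.leaf) ∧
    ((treewidth (displayGraph R1.graph R1.leaf R2.graph R2.leaf) =
        treewidth (splitSide T1 T2 u1 v1 u2 v2 u1) ∧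
      2 ≤ treewidth (displayGraph R1.graph R1.leaf R2.graph R2.leaf)) ∨
     (treewidth (displayGraph R1.graph R1.leaf R2.graph R2.leaf) ≤ 1 ∧
      treewidth (splitSidePlus T1 T2 u1 v1 u2 v2 u1 u2) ≤ 2 ∧
      ∃ x y : X, ∀ t, t ∈ Xs → t = x ∨ t = y)) := by
  have := T1.finite
  have := T2.finite
  have := R1.finite
  have := R2.finite
  refine ⟨?_, ?_, ?_, ?_⟩
  · rw [treewidth_le_iff]
    exact h.side_of_plus ((treewidth_le_iff _ _).1 le_rfl)
  · rw [treewidth_le_iff]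
    refine HasTreeDecompWidthLE.add_vertex ((treewidth_le_iff _ _).1 le_rfl)
      ⟨jl _ _ u1, Reachable.refl _⟩ ?_
    intro a b hab
    rcases h.plus_adj.1 hab with h1 | ⟨h1, -⟩ | ⟨h1, -⟩
    · exact Or.inl (h.side_adj.2 h1)
    · exact Or.inr (Or.inl (Subtype.ext h1))
    · exact Or.inr (Or.inr (Subtype.ext h1))
  · rw [treewidth_le_iff]
    exact h.plus_of_display ((treewidth_le_iff _ _).1 le_rfl)
  · by_cases h3 : ∀ x y : {x : X // x ∈ Xs}, ∃ z, z ≠ x ∧ z ≠ y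
    · left
      have h2 : 2 ≤ treewidth (displayGraph R1.graph R1.leaf R2.graph R2.leaf) := by
        by_contra hlt
        exact display_not_td_one R1 R2 h3 ((treewidth_le_iff _ _).1 (by omega))
      refine ⟨le_antisymm ?_ ?_, h2⟩
      · rw [treewidth_le_iff]
        exact (h.side_iff_restr hR1 hR2 _).1 ((treewidth_le_iff _ _).1 le_rfl)
      · rw [treewidth_le_iff]
        exact (h.side_iff_restr hR1 hR2 _).2 h2 ((treewidth_le_iff _ _).1 le_rfl)
    · right
      push Not at h3
      obtain ⟨x, y, hxy⟩ := h3
      have hxy' : ∀ z, z = x ∨ z = y := fun z => or_iff_not_imp_left.2 (hxy z)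
      refine ⟨?_, ?_, x.1, y.1, ?_⟩
      · rw [treewidth_le_iff]
        exact display_td_two R1 R2 hxy'
      · rw [treewidth_le_iff]
        exact h.plus_two hR1 hR2 hxy'
      · intro t ht
        rcases hxy' ⟨t, ht⟩ with h1 | h1
        · exact Or.inl (congrArg Subtype.val h1)
        · exact Or.inr (congrArg Subtype.val h1)

end Final

/-- Necessary and sufficient conditions for the cluster-reduction lower bound to
be attained. With `p ≤ q` the treewidths of the display graphs of the
restrictions to the two sides `X*`, `X**` of a common split, we have
`tw(D(T1,T2)) = max(p,q)` iff (case `p < q`) `tw([G**]) = tw(G**)`, and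
(case `p = q`) both `tw([G**]) = tw(G**)` and `tw([G*]) = tw(G*)`. -/
theorem treewidth_cluster_reduction_iff {V1 V2 X W1 W2 W3 W4 : Type*}
    (T1 : PhyloTree V1 X) (T2 : PhyloTree V2 X)
    (hinc : ¬ Compatible T1 T2)
    (Xs Xss : Set X) (hne1 : Xs.Nonempty) (hne2 : Xss.Nonempty)
    (hcover : Xs ∪ Xss = Set.univ) (hdisj : Xs ∩ Xss = ∅)
    (u1 v1 : V1) (u2 v2 : V2)
    (hs1 : SplitAt T1 Xs Xss u1 v1) (hs2 : SplitAt T2 Xs Xss u2 v2)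
    (hu2 : toDisplay T1.leaf T2.leaf (Sum.inr u2) ∈ splitComponent T1 T2 u1 v1 u2 v2 u1)
    (hv2 : toDisplay T1.leaf T2.leaf (Sum.inr v2) ∈ splitComponent T1 T2 u1 v1 u2 v2 v1)
    (R1 : PhyloTree W1 {x : X // x ∈ Xs}) (R2 : PhyloTree W2 {x : X // x ∈ Xs})
    (hR1 : IsRestriction T1 Xs R1) (hR2 : IsRestriction T2 Xs R2)
    (S1 : PhyloTree W3 {x : X // x ∈ Xss}) (S2 : PhyloTree W4 {x : X // x ∈ Xss})
    (hS1 : IsRestriction T1 Xss S1) (hS2 : IsRestriction T2 Xss S2)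
    (p q : ℕ)
    (hp : p = treewidth (displayGraph R1.graph R1.leaf R2.graph R2.leaf))
    (hq : q = treewidth (displayGraph S1.graph S1.leaf S2.graph S2.leaf))
    (hpq : p ≤ q) :
    treewidth (displayGraph T1.graph T1.leaf T2.graph T2.leaf) = max p q ↔
      ((p < q →
          treewidth (splitSidePlus T1 T2 u1 v1 u2 v2 v1 v2) =
            treewidth (splitSide T1 T2 u1 v1 u2 v2 v1)) ∧
        (p = q →
          treewidth (splitSidePlus T1 T2 u1 v1 u2 v2 v1 v2) =
              treewidth (splitSide T1 T2 u1 v1 u2 v2 v1) ∧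
            treewidth (splitSidePlus T1 T2 u1 v1 u2 v2 u1 u2) =
              treewidth (splitSide T1 T2 u1 v1 u2 v2 u1))) := by
  have hX : Xss = Xsᶜ := by
    ext x
    have h1 : x ∈ Xs ∪ Xss := by rw [hcover]; trivial
    have h2 : x ∉ Xs ∩ Xss := by rw [hdisj]; exact fun h => h
    simp only [Set.mem_union, Set.mem_inter_iff, Set.mem_compl_iff] at *
    tauto
  subst hX
  have := T1.finite
  have := T2.finite
  have o1 := hs1.onSide hcover
  have o2 := hs2.onSide hcover
  obtain ⟨x, hx⟩ := hne1
  obtain ⟨z, hz⟩ := hne2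
  obtain ⟨⟨y, hy⟩, hyx⟩ := R1.exists_ne_label ⟨x, hx⟩
  obtain ⟨⟨w, hw⟩, hwz⟩ := S1.exists_ne_label ⟨z, hz⟩
  have hyx' : y ≠ x := fun h => hyx (Subtype.ext h)
  have hwz' : w ≠ z := fun h => hwz (Subtype.ext h)
  have hS : Side T1 T2 Xs u1 v1 u2 v2 :=
    ⟨o1, o2, o1.not_leaf hy hx hyx', o2.not_leaf hy hx hyx', o1.swap.not_leaf hw hz hwz',
      o2.swap.not_leaf hw hz hwz', ⟨x, hx⟩, ⟨z, hz⟩⟩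
  have f1 := hS.facts hR1 hR2
  have f2 := hS.swap.facts hS1 hS2
  have hd : treewidth (displayGraph T1.graph T1.leaf T2.graph T2.leaf) ≤
      max 2 (max (treewidth (splitSidePlus T1 T2 u1 v1 u2 v2 u1 u2))
        (treewidth (splitSidePlus T1 T2 v1 u1 v2 u2 v1 v2))) := by
    rw [treewidth_le_iff]
    exact hS.display_of_plus (le_max_left _ _)
      ((treewidth_le_iff _ _).1 (by omega)) ((treewidth_le_iff _ _).1 (by omega))
  have e1 : treewidth (splitSide T1 T2 v1 u1 v2 u2 v1) =
      treewidth (splitSide T1 T2 u1 v1 u2 v2 v1) := by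
    unfold splitSide splitComponent
    rw [splitDeletedDisplay_swap]
  have e2 : treewidth (splitSidePlus T1 T2 v1 u1 v2 u2 v1 v2) =
      treewidth (splitSidePlus T1 T2 u1 v1 u2 v2 v1 v2) := by
    unfold splitSidePlus splitComponent
    rw [splitDeletedDisplay_swap]
  rw [e1, e2, ← hq] at f2
  rw [e2] at hd
  rw [← hp] at f1
  have hnot : ¬ ((∃ x y : X, ∀ t, t ∈ Xs → t = x ∨ t = y) ∧
      (∃ x y : X, ∀ t, t ∈ Xsᶜ → t = x ∨ t = y)) := by
    rintro ⟨⟨x, y, h1⟩, ⟨z, w, h2⟩⟩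
    exact hinc (compatible_two_two o1 o2 h1 h2)
  obtain ⟨a1, a2, a3, a4⟩ := f1
  obtain ⟨b1, b2, b3, b4⟩ := f2
  rcases a4 with ⟨a4, a5⟩ | ⟨a4, a5, a6⟩
  · rcases b4 with ⟨b4, b5⟩ | ⟨b4, b5, b6⟩
    · omega
    · omega
  · rcases b4 with ⟨b4, b5⟩ | ⟨b4, b5, b6⟩
    · omega
    · exact absurd ⟨a6, b6⟩ hnot
end

section
/- Let G = (V,E) be an undirected (multi)graph with n vertices and maximum degree d ≥ 2. Then there exist two unrooted binary phylogenetic trees T1 and T2 on a common label set of at most (n+2) + nd taxa, each with at most n(d+1) internal vertices and at most 2n + 1 + 2nd edges, such that their display graph D(T1,T2) has at most 2n(d+1) + (n+2) + nd vertices and at most 4n + 2 + 4nd edges and G is a minor of D(T1,T2). -/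
open SimpleGraph

/-- The multigraph with vertex set `V`, edge set `E` and endpoint map `ends` is
a minor of the simple graph `D`: there are nonempty, pairwise disjoint,
connected branch sets for the vertices and an injective assignment of edges of
`D` to the edges of the multigraph joining the corresponding branch sets. -/
def MultigraphMinor {V E W : Type*} (ends : E → Sym2 V) (D : SimpleGraph W) : Prop :=
  ∃ br : V → Set W,
    (∀ v, (br v).Nonempty) ∧
    (∀ u v, u ≠ v → br u ∩ br v = ∅) ∧
    (∀ v, (D.induce (br v)).Connected) ∧
    ∃ ε : E → Sym2 W, Function.Injective ε ∧
      ∀ e : E, ε e ∈ D.edgeSet ∧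
        ∃ a b u v, ends e = s(u, v) ∧ ε e = s(a, b) ∧ a ∈ br u ∧ b ∈ br v

/-- The caterpillar graph with `N` internal vertices: a path on `N + 2` vertices, with one
pendant vertex at each of the `N` inner vertices of the path. -/
def catGraph (N : ℕ) : SimpleGraph (Fin (N + 2) ⊕ Fin N) where
  Adj a b := match a, b with
    | Sum.inl i, Sum.inl j => i.val + 1 = j.val ∨ j.val + 1 = i.val
    | Sum.inl i, Sum.inr j => i.val = j.val + 1
    | Sum.inr j, Sum.inl i => i.val = j.val + 1
    | Sum.inr _, Sum.inr _ => False
  symm := ⟨by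
    rintro (i | i) (j | j) h
    · exact Or.symm h
    · exact h
    · exact h
    · exact h⟩
  loopless := ⟨by
    rintro (i | i) h
    · rcases h with h | h <;> omega
    · exact h⟩

lemma catGraph_ll {N : ℕ} (i j : Fin (N + 2)) :
    (catGraph N).Adj (Sum.inl i) (Sum.inl j) ↔ (i.val + 1 = j.val ∨ j.val + 1 = i.val) := Iff.rfl
lemma catGraph_lr {N : ℕ} (i : Fin (N + 2)) (j : Fin N) :
    (catGraph N).Adj (Sum.inl i) (Sum.inr j) ↔ i.val = j.val + 1 := Iff.rfl
lemma catGraph_rl {N : ℕ} (i : Fin (N + 2)) (j : Fin N) :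
    (catGraph N).Adj (Sum.inr j) (Sum.inl i) ↔ i.val = j.val + 1 := Iff.rfl
lemma catGraph_rr {N : ℕ} (i : Fin N) (j : Fin N) :
    ¬ (catGraph N).Adj (Sum.inr j) (Sum.inr i) := fun h => h

lemma catGraph_connected (N : ℕ) : (catGraph N).Connected := by
  have h0 : ∀ k (hk : k < N + 2), (catGraph N).Reachable (Sum.inl ⟨k, hk⟩) (Sum.inl 0) := by
    intro k
    induction k with
    | zero => intro hk; exact SimpleGraph.Reachable.refl _
    | succ k ih =>
      intro hk
      have h1 : (catGraph N).Adj (Sum.inl ⟨k + 1, hk⟩) (Sum.inl ⟨k, by omega⟩) := by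
        rw [catGraph_ll]; simp
      exact h1.reachable.trans (ih _)
  have h1 : ∀ a, (catGraph N).Reachable a (Sum.inl 0) := by
    rintro (i | j)
    · exact h0 i.1 i.2
    · have h1 : (catGraph N).Adj (Sum.inr j) (Sum.inl ⟨j.val + 1, by omega⟩) := by
        rw [catGraph_rl]
      exact h1.reachable.trans (h0 _ _)
  have : Nonempty (Fin (N + 2) ⊕ Fin N) := ⟨Sum.inl 0⟩
  exact SimpleGraph.Connected.mk (fun a b => (h1 a).trans (h1 b).symm)

/-- The edges of the caterpillar, listed by their lower endpoints. -/
def catEdge (N : ℕ) : Fin (N + 1) ⊕ Fin N → Sym2 (Fin (N + 2) ⊕ Fin N)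
  | Sum.inl i => s(Sum.inl i.castSucc, Sum.inl i.succ)
  | Sum.inr j => s(Sum.inl j.castSucc.succ, Sum.inr j)

lemma catGraph_edge_sub (N : ℕ) : (catGraph N).edgeSet ⊆ Set.range (catEdge N) := by
  intro e
  induction e using Sym2.ind with
  | _ a b =>
    intro h
    rw [SimpleGraph.mem_edgeSet] at h
    rcases a with i | i <;> rcases b with j | j
    · rw [catGraph_ll] at h
      rcases h with h | h
      · refine ⟨Sum.inl ⟨i.val, by omega⟩, ?_⟩
        have h1 : j = Fin.succ ⟨i.val, by omega⟩ := by ext; simp; omega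
        exact congrArg (fun z => s(Sum.inl i, Sum.inl z)) h1.symm
      · refine ⟨Sum.inl ⟨j.val, by omega⟩, ?_⟩
        have h1 : i = Fin.succ ⟨j.val, by omega⟩ := by ext; simp; omega
        rw [Sym2.eq_swap]
        exact congrArg (fun z => s(Sum.inl j, Sum.inl z)) h1.symm
    · rw [catGraph_lr] at h
      refine ⟨Sum.inr j, ?_⟩
      have h1 : i = j.castSucc.succ := by ext; simp; omega
      rw [h1]; rfl
    · rw [catGraph_rl] at h
      refine ⟨Sum.inr i, ?_⟩
      have h1 : j = i.castSucc.succ := by ext; simp; omega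
      rw [h1, Sym2.eq_swap]; rfl
    · exact absurd h (catGraph_rr _ _)

lemma catGraph_edge_le (N : ℕ) : (catGraph N).edgeSet.ncard ≤ 2 * N + 1 := by
  refine (Set.ncard_le_ncard (catGraph_edge_sub N) (Set.toFinite _)).trans ?_
  have h := Finite.card_range_le (catEdge N)
  simp only [Nat.card_sum, Nat.card_fin] at h
  have h2 : (Set.range (catEdge N)).ncard = Nat.card (Set.range (catEdge N)) := rfl
  omega

lemma catGraph_isTree (N : ℕ) : (catGraph N).IsTree := by
  rw [SimpleGraph.isTree_iff_connected_and_card]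
  refine ⟨catGraph_connected N, ?_⟩
  have h1 := (catGraph_connected N).card_vert_le_card_edgeSet_add_one
  have h2 := catGraph_edge_le N
  have h3 : (catGraph N).edgeSet.ncard = Nat.card (catGraph N).edgeSet := rfl
  simp only [Nat.card_sum, Nat.card_fin] at h1 ⊢
  omega

/-- Leaves of the caterpillar. -/
def catLeaf (N : ℕ) (σ : Equiv.Perm (Fin N)) : Fin N ⊕ Bool → Fin (N + 2) ⊕ Fin N
  | Sum.inl j => Sum.inr (σ j)
  | Sum.inr false => Sum.inl 0
  | Sum.inr true => Sum.inl (Fin.last (N + 1))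

lemma catLeaf_inj (N : ℕ) (σ : Equiv.Perm (Fin N)) : Function.Injective (catLeaf N σ) := by
  rintro (i | _ | _) (j | _ | _) h <;> simp [catLeaf, Fin.ext_iff] at h ⊢
  exact h

lemma catLeaf_ne (N : ℕ) (σ : Equiv.Perm (Fin N)) (j : Fin N) (x : Fin N ⊕ Bool) :
    catLeaf N σ x ≠ Sum.inl j.castSucc.succ := by
  rcases x with i | _ | _ <;> simp [catLeaf, Fin.ext_iff]
  omega

lemma not_catLeaf (N : ℕ) (σ : Equiv.Perm (Fin N)) (v : Fin (N + 2) ⊕ Fin N)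
    (h : ∀ x, catLeaf N σ x ≠ v) : ∃ j : Fin N, v = Sum.inl j.castSucc.succ := by
  rcases v with i | j
  · have h1 := h (Sum.inr false)
    have h2 := h (Sum.inr true)
    simp [catLeaf, Fin.ext_iff] at h1 h2
    refine ⟨⟨i.val - 1, by omega⟩, ?_⟩
    congr 1
    ext; simp; omega
  · exact absurd (by simp [catLeaf]) (h (Sum.inl (σ.symm j)))

/-- The caterpillar tree with permuted labels. -/
def catTree (N : ℕ) (σ : Equiv.Perm (Fin N)) : PhyloTree (Fin (N + 2) ⊕ Fin N) (Fin N ⊕ Bool) where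
  graph := catGraph N
  finite := inferInstance
  connected := catGraph_connected N
  leaf := catLeaf N σ
  leaf_inj := catLeaf_inj N σ
  leaf_deg := by
    rintro (i | _ | _)
    · rw [Set.ncard_eq_one]
      refine ⟨Sum.inl (σ i).castSucc.succ, ?_⟩
      ext (j | j)
      · simp [catLeaf, catGraph_rl, Fin.ext_iff]
      · simp [catLeaf, catGraph_rr]
    · rw [Set.ncard_eq_one]
      refine ⟨Sum.inl ⟨1, by omega⟩, ?_⟩
      ext (j | j)
      · rw [SimpleGraph.mem_neighborSet, Set.mem_singleton_iff, Sum.inl.injEq, Fin.ext_iff]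
        change (catGraph N).Adj (Sum.inl 0) (Sum.inl j) ↔ _
        rw [catGraph_ll]
        have h0 : (0 : Fin (N + 2)).val = 0 := rfl
        change _ ↔ j.val = 1
        omega
      · simp [catLeaf, catGraph_lr]
    · rw [Set.ncard_eq_one]
      refine ⟨Sum.inl (Fin.last N).castSucc, ?_⟩
      ext (j | j)
      · simp [catLeaf, catGraph_ll, Fin.ext_iff]; omega
      · simp [catLeaf, catGraph_lr]; omega
  internal_deg := by
    intro v hv
    obtain ⟨j, rfl⟩ := not_catLeaf N σ v hv
    rw [Set.ncard_eq_three]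
    refine ⟨Sum.inl j.castSucc.castSucc, Sum.inl j.succ.succ, Sum.inr j, ?_, ?_, ?_, ?_⟩
    · simp [Fin.ext_iff]; omega
    · simp
    · simp
    · ext (i | i)
      · simp [catGraph_ll, Fin.ext_iff]; omega
      · simp [catGraph_lr, Fin.ext_iff]; omega
  acyclic := (catGraph_isTree N).isAcyclic

lemma card_not_catLeaf (N : ℕ) (σ : Equiv.Perm (Fin N)) :
    Nat.card {v // ∀ x, catLeaf N σ x ≠ v} ≤ N := by
  choose f hf using fun v : {v // ∀ x, catLeaf N σ x ≠ v} => not_catLeaf N σ v.1 v.2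
  have h := Nat.card_le_card_of_injective f (by
    intro a b hab
    apply Subtype.ext
    rw [hf a, hf b, hab])
  simpa using h

section display
variable {V1 V2 X : Type*} {l1 : X → V1} {l2 : X → V2}

lemma mergeMap_leaf (h2 : Function.Injective l2) (x : X) :
    mergeMap l1 l2 (Sum.inr (l2 x)) = Sum.inl (l1 x) := by
  have h : ∃ y, l2 y = l2 x := ⟨x, rfl⟩
  simp only [mergeMap, h, dif_pos]
  rw [h2 h.choose_spec]

lemma mergeMap_nonleaf {w : V2} (h : ∀ x, l2 x ≠ w) :
    mergeMap l1 l2 (Sum.inr w) = Sum.inr w := by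
  simp [mergeMap, h]

lemma toDisplay_leaf (h2 : Function.Injective l2) (x : X) :
    toDisplay l1 l2 (Sum.inr (l2 x)) = toDisplay l1 l2 (Sum.inl (l1 x)) :=
  Subtype.ext (mergeMap_leaf h2 x)

lemma toDisplay_inl_inj {u v : V1} (h : toDisplay l1 l2 (Sum.inl u) = toDisplay l1 l2 (Sum.inl v)) :
    u = v := Sum.inl.inj (congrArg Subtype.val h)

lemma toDisplay_inr_inj (h1 : Function.Injective l1) (h2 : Function.Injective l2) {u v : V2}
    (h : toDisplay l1 l2 (Sum.inr u) = toDisplay l1 l2 (Sum.inr v)) : u = v := by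
  have h' : mergeMap l1 l2 (Sum.inr u) = mergeMap l1 l2 (Sum.inr v) := congrArg Subtype.val h
  by_cases hu : ∃ x, l2 x = u <;> by_cases hv : ∃ x, l2 x = v
  · obtain ⟨x, rfl⟩ := hu
    obtain ⟨y, rfl⟩ := hv
    rw [mergeMap_leaf h2, mergeMap_leaf h2] at h'
    rw [h1 (Sum.inl.inj h')]
  · obtain ⟨x, rfl⟩ := hu
    rw [mergeMap_leaf h2, mergeMap_nonleaf (not_exists.1 hv)] at h'
    simp at h'
  · obtain ⟨x, rfl⟩ := hv
    rw [mergeMap_leaf h2, mergeMap_nonleaf (not_exists.1 hu)] at h'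
    simp at h'
  · rw [mergeMap_nonleaf (not_exists.1 hu), mergeMap_nonleaf (not_exists.1 hv)] at h'
    exact Sum.inr.inj h'

lemma toDisplay_inl_ne_inr {u : V1} {v : V2} (hv : ∀ x, l2 x ≠ v) :
    toDisplay l1 l2 (Sum.inl u) ≠ toDisplay l1 l2 (Sum.inr v) := by
  intro h
  have h' : mergeMap l1 l2 (Sum.inl u) = mergeMap l1 l2 (Sum.inr v) := congrArg Subtype.val h
  rw [mergeMap_nonleaf hv] at h'
  simp [mergeMap] at h'

lemma display_adj_left {G1 : SimpleGraph V1} {G2 : SimpleGraph V2} {u v : V1} (h : G1.Adj u v) :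
    (displayGraph G1 l1 G2 l2).Adj (toDisplay l1 l2 (Sum.inl u)) (toDisplay l1 l2 (Sum.inl v)) := by
  rw [displayGraph, SimpleGraph.fromRel_adj]
  exact ⟨fun h' => h.ne (toDisplay_inl_inj h'), Or.inl (Or.inl ⟨u, v, h, rfl, rfl⟩)⟩

lemma display_adj_right (h1 : Function.Injective l1) (h2 : Function.Injective l2)
    {G1 : SimpleGraph V1} {G2 : SimpleGraph V2} {u v : V2} (h : G2.Adj u v) :
    (displayGraph G1 l1 G2 l2).Adj (toDisplay l1 l2 (Sum.inr u)) (toDisplay l1 l2 (Sum.inr v)) := by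
  rw [displayGraph, SimpleGraph.fromRel_adj]
  exact ⟨fun h' => h.ne (toDisplay_inr_inj h1 h2 h'), Or.inl (Or.inr ⟨u, v, h, rfl, rfl⟩)⟩

lemma display_card [Finite V1] [Finite V2] (h2 : Function.Injective l2) :
    Nat.card (DisplayVertex l1 l2) ≤ Nat.card V1 + Nat.card {v // ∀ x, l2 x ≠ v} := by
  rw [← Nat.card_sum]
  have h : ∀ u : DisplayVertex l1 l2, ∃ w : V1 ⊕ {v // ∀ x, l2 x ≠ v},
      Sum.map id Subtype.val w = u.1 := by
    rintro ⟨u | u, hu⟩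
    · exact ⟨Sum.inl u, rfl⟩
    · refine ⟨Sum.inr ⟨u, ?_⟩, rfl⟩
      rintro x rfl
      rw [mergeMap_leaf h2] at hu
      simp at hu
  choose f hf using h
  refine Nat.card_le_card_of_injective f ?_
  intro a b hab
  apply Subtype.ext
  rw [← hf a, ← hf b, hab]

lemma display_edges [Finite V1] [Finite V2] (G1 : SimpleGraph V1) (G2 : SimpleGraph V2) :
    (displayGraph G1 l1 G2 l2).edgeSet.ncard ≤ G1.edgeSet.ncard + G2.edgeSet.ncard := by
  have hsub : (displayGraph G1 l1 G2 l2).edgeSet ⊆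
      (Sym2.map (fun u => toDisplay l1 l2 (Sum.inl u))) '' G1.edgeSet ∪
      (Sym2.map (fun u => toDisplay l1 l2 (Sum.inr u))) '' G2.edgeSet := by
    intro e
    induction e using Sym2.ind with
    | _ a b =>
      intro h
      rw [SimpleGraph.mem_edgeSet, displayGraph, SimpleGraph.fromRel_adj] at h
      obtain ⟨-, (⟨u, v, h, rfl, rfl⟩ | ⟨u, v, h, rfl, rfl⟩) |
        (⟨u, v, h, rfl, rfl⟩ | ⟨u, v, h, rfl, rfl⟩)⟩ := h
      · exact Or.inl ⟨s(u, v), h, rfl⟩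
      · exact Or.inr ⟨s(u, v), h, rfl⟩
      · exact Or.inl ⟨s(v, u), h.symm, rfl⟩
      · exact Or.inr ⟨s(v, u), h.symm, rfl⟩
  refine (Set.ncard_le_ncard hsub (Set.toFinite _)).trans ((Set.ncard_union_le _ _).trans ?_)
  exact Nat.add_le_add (Set.ncard_image_le (Set.toFinite _)) (Set.ncard_image_le (Set.toFinite _))

end display

lemma exists_perm_extend {A : Type*} {N : ℕ} (h g : A → Fin N) (hh : Function.Injective h)
    (hg : Function.Injective g) : ∃ σ : Equiv.Perm (Fin N), ∀ a, σ (h a) = g a := by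
  classical
  let e : {x // x ∈ Set.range h} ≃ {x // x ∈ Set.range g} :=
    (Equiv.ofInjective h hh).symm.trans (Equiv.ofInjective g hg)
  refine ⟨e.extendSubtype, fun a => ?_⟩
  rw [Equiv.extendSubtype_apply_of_mem e (h a) ⟨a, rfl⟩]
  have h1 : (⟨h a, ⟨a, rfl⟩⟩ : {x // x ∈ Set.range h}) = Equiv.ofInjective h hh a := rfl
  simp only [e, h1, Equiv.trans_apply, Equiv.symm_apply_apply]
  rfl

lemma minor_aux {V E W : Type*} (ends : E → Sym2 V) (D : SimpleGraph W) (d : ℕ)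
    (s1 lf s2 : V × Fin (d + 1) → W)
    (i1 : Function.Injective s1) (il : Function.Injective lf) (i2 : Function.Injective s2)
    (n1l : ∀ x y, s1 x ≠ lf y) (n12 : ∀ x y, s1 x ≠ s2 y) (nl2 : ∀ x y, lf x ≠ s2 y)
    (a1l : ∀ x, D.Adj (s1 x) (lf x)) (al2 : ∀ x, D.Adj (lf x) (s2 x))
    (a11 : ∀ v (i j : Fin (d + 1)), i.val + 1 = j.val → D.Adj (s1 (v, i)) (s1 (v, j)))
    (p q : E → V × Fin (d + 1))
    (hends : ∀ e, ends e = s((p e).1, (q e).1))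
    (hloop : ∀ e, (ends e).IsDiag → p e = q e)
    (hinj : ∀ e e', (p e = p e' ∨ p e = q e' ∨ q e = q e') → e = e')
    (a22 : ∀ e, ¬ (ends e).IsDiag → D.Adj (s2 (p e)) (s2 (q e))) :
    MultigraphMinor ends D := by
  classical
  refine ⟨fun v => {w | ∃ i, w = s1 (v, i) ∨ w = lf (v, i) ∨ w = s2 (v, i)}, ?_, ?_, ?_, ?_⟩
  · intro v
    exact ⟨s1 (v, 0), 0, Or.inl rfl⟩
  · intro u v huv
    rw [Set.eq_empty_iff_forall_notMem]
    rintro w ⟨⟨i, rfl | rfl | rfl⟩, ⟨j, h | h | h⟩⟩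
    · exact huv (congrArg Prod.fst (i1 h))
    · exact n1l _ _ h
    · exact n12 _ _ h
    · exact n1l _ _ h.symm
    · exact huv (congrArg Prod.fst (il h))
    · exact nl2 _ _ h
    · exact n12 _ _ h.symm
    · exact nl2 _ _ h.symm
    · exact huv (congrArg Prod.fst (i2 h))
  · intro v
    set S : Set W := {w | ∃ i, w = s1 (v, i) ∨ w = lf (v, i) ∨ w = s2 (v, i)} with hS
    have m1 : ∀ i, s1 (v, i) ∈ S := fun i => ⟨i, Or.inl rfl⟩
    have ml : ∀ i, lf (v, i) ∈ S := fun i => ⟨i, Or.inr (Or.inl rfl)⟩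
    have m2 : ∀ i, s2 (v, i) ∈ S := fun i => ⟨i, Or.inr (Or.inr rfl)⟩
    have adj : ∀ {a b : W} (ha : a ∈ S) (hb : b ∈ S), D.Adj a b →
        (D.induce S).Reachable ⟨a, ha⟩ ⟨b, hb⟩ := by
      intro a b ha hb h
      exact SimpleGraph.Adj.reachable (by simpa using h)
    have r1 : ∀ k (hk : k < d + 1),
        (D.induce S).Reachable ⟨s1 (v, ⟨k, hk⟩), m1 _⟩ ⟨s1 (v, 0), m1 _⟩ := by
      intro k
      induction k with
      | zero => intro hk; exact SimpleGraph.Reachable.refl _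
      | succ k ih =>
        intro hk
        exact (adj (m1 _) (m1 _) (a11 v ⟨k, by omega⟩ ⟨k + 1, hk⟩ rfl).symm).trans (ih (by omega))
    have rl : ∀ i, (D.induce S).Reachable ⟨lf (v, i), ml i⟩ ⟨s1 (v, 0), m1 _⟩ := fun i =>
      (adj (ml i) (m1 i) (a1l _).symm).trans (r1 i.1 i.2)
    have r2 : ∀ i, (D.induce S).Reachable ⟨s2 (v, i), m2 i⟩ ⟨s1 (v, 0), m1 _⟩ := fun i =>
      (adj (m2 i) (ml i) (al2 _).symm).trans (rl i)
    have r : ∀ a, (D.induce S).Reachable a ⟨s1 (v, 0), m1 _⟩ := by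
      rintro ⟨w, i, rfl | rfl | rfl⟩
      · exact r1 i.1 i.2
      · exact rl i
      · exact r2 i
    have : Nonempty S := ⟨⟨s1 (v, 0), m1 _⟩⟩
    exact SimpleGraph.Connected.mk (fun a b => (r a).trans (r b).symm)
  · refine ⟨fun e => if (ends e).IsDiag then s(s1 (p e), lf (p e)) else s(s2 (p e), s2 (q e)),
      ?_, ?_⟩
    · intro e e' h
      apply hinj
      dsimp only at h
      split_ifs at h with h1 h2 h2
      · rw [Sym2.eq_iff] at h
        rcases h with h | h
        · exact Or.inl (i1 h.1)
        · exact absurd h.1 (n1l _ _)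
      · rw [Sym2.eq_iff] at h
        rcases h with h | h
        · exact absurd h.1 (n12 _ _)
        · exact absurd h.1 (n12 _ _)
      · rw [Sym2.eq_iff] at h
        rcases h with h | h
        · exact absurd h.1.symm (n12 _ _)
        · exact absurd h.2.symm (n12 _ _)
      · rw [Sym2.eq_iff] at h
        rcases h with h | h
        · exact Or.inl (i2 h.1)
        · exact Or.inr (Or.inl (i2 h.1))
    · intro e
      dsimp only
      split_ifs with h1
      · refine ⟨a1l _, s1 (p e), lf (p e), (p e).1, (q e).1, hends e, rfl, ⟨(p e).2, Or.inl rfl⟩,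
          ⟨(p e).2, Or.inr (Or.inl ?_)⟩⟩
        rw [← hloop e h1]
      · exact ⟨a22 e h1, s2 (p e), s2 (q e), (p e).1, (q e).1, hends e, rfl,
          ⟨(p e).2, Or.inr (Or.inr rfl)⟩, ⟨(q e).2, Or.inr (Or.inr rfl)⟩⟩

lemma exists_slots {V E : Type} [Fintype V] [Fintype E] (ends : E → Sym2 V) (d : ℕ)
    (hdeg : ∀ v : V, {e : E | v ∈ ends e}.ncard ≤ d) :
    ∃ p q : E → V × Fin (d + 1), (∀ e, ends e = s((p e).1, (q e).1)) ∧
      (∀ e, (ends e).IsDiag → p e = q e) ∧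
      (∀ e e', (p e = p e' ∨ p e = q e' ∨ q e = q e') → e = e') := by
  classical
  have h : ∀ v, ∃ f : E → Fin (d + 1), Set.InjOn f {e : E | v ∈ ends e} := by
    intro v
    have hc : Fintype.card {e : E | v ∈ ends e} ≤ Fintype.card (Fin (d + 1)) := by
      have := hdeg v
      rw [← Nat.card_coe_set_eq, Nat.card_eq_fintype_card] at this
      rw [Fintype.card_fin]
      omega
    obtain ⟨g⟩ := Function.Embedding.nonempty_of_card_le hc
    refine ⟨fun e => if h : e ∈ {e : E | v ∈ ends e} then g ⟨e, h⟩ else 0, ?_⟩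
    intro a ha b hb hab
    simp only [dif_pos ha, dif_pos hb] at hab
    exact congrArg Subtype.val (g.injective hab)
  choose f hf using h
  have h2 : ∀ e, ∃ uv : V × V, ends e = s(uv.1, uv.2) := by
    intro e
    induction ends e using Sym2.ind with
    | _ a b => exact ⟨(a, b), rfl⟩
  choose uv huv using h2
  have key : ∀ v w e e', v ∈ ends e → w ∈ ends e' → (v, f v e) = (w, f w e') → e = e' := by
    intro v w e e' hv hw h
    obtain ⟨rfl, h⟩ := Prod.mk.inj h
    exact hf v hv hw h
  have m1 : ∀ e, (uv e).1 ∈ ends e := fun e => by rw [huv e]; simp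
  have m2 : ∀ e, (uv e).2 ∈ ends e := fun e => by rw [huv e]; simp
  refine ⟨fun e => ((uv e).1, f (uv e).1 e), fun e => ((uv e).2, f (uv e).2 e), huv, ?_, ?_⟩
  · intro e he
    rw [huv e, Sym2.mk_isDiag_iff] at he
    simp only [he]
  · rintro e e' (h | h | h)
    · exact key _ _ _ _ (m1 _) (m1 _) h
    · exact key _ _ _ _ (m1 _) (m2 _) h
    · exact key _ _ _ _ (m2 _) (m2 _) h

lemma exists_perm_pairs {E : Type} [Fintype E] {N : ℕ} (P : E → Prop) (p q : E → Fin N)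
    (hpq : ∀ e, P e → p e ≠ q e)
    (hinj : ∀ e e', (p e = p e' ∨ p e = q e' ∨ q e = q e') → e = e') :
    ∃ σ : Equiv.Perm (Fin N), ∀ e, P e → (σ (p e)).val + 1 = (σ (q e)).val := by
  classical
  let h : {e // P e} × Bool → Fin N := fun x => if x.2 then q x.1 else p x.1
  have hh : Function.Injective h := by
    rintro ⟨⟨e, he⟩, _ | _⟩ ⟨⟨e', he'⟩, _ | _⟩ H <;> simp only [h, if_true, if_false,
      Bool.false_eq_true] at H
    · obtain rfl := hinj e e' (Or.inl H); rfl
    · obtain rfl := hinj e e' (Or.inr (Or.inl H)); exact absurd H (hpq e he)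
    · obtain rfl := hinj e' e (Or.inr (Or.inl H.symm)); exact absurd H.symm (hpq _ he)
    · obtain rfl := hinj e e' (Or.inr (Or.inr H)); rfl
  have hc := Fintype.card_le_of_injective h hh
  simp only [Fintype.card_prod, Fintype.card_bool, Fintype.card_fin] at hc
  let k := Fintype.equivFin {e // P e}
  let g : {e // P e} × Bool → Fin N := fun x => ⟨2 * (k x.1).val + x.2.toNat, by
    have := (k x.1).2
    have := Bool.toNat_le x.2
    omega⟩
  have hg : Function.Injective g := by
    rintro ⟨e, b⟩ ⟨e', b'⟩ H
    simp only [g, Fin.mk.injEq] at H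
    have hk : (k e).val = (k e').val := by
      have := Bool.toNat_le b
      have := Bool.toNat_le b'
      omega
    have hb : b = b' := by
      rw [hk] at H
      cases b <;> cases b' <;> simp at H ⊢
    rw [hb, k.injective (Fin.ext hk)]
  obtain ⟨σ, hσ⟩ := exists_perm_extend h g hh hg
  refine ⟨σ, fun e he => ?_⟩
  have h1 := hσ (⟨e, he⟩, false)
  have h2 := hσ (⟨e, he⟩, true)
  simp only [h, if_true, if_false, Bool.false_eq_true] at h1 h2
  rw [h1, h2]
  simp [g]

/-- Every (multi)graph `G` with `n` vertices and maximum degree `d ≥ 2` is a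
minor of the display graph of two unrooted binary phylogenetic trees with at
most `(n+2) + nd` taxa, at most `n(d+1)` internal vertices and at most
`2n + 1 + 2nd` edges each, whose display graph therefore has at most
`2n(d+1) + (n+2) + nd` vertices and at most `4n + 2 + 4nd` edges. -/
theorem graph_minor_of_display_graph {V E : Type} [Fintype V] [Fintype E]
    (ends : E → Sym2 V) (n d : ℕ) (hn : Nat.card V = n) (hd : 2 ≤ d)
    (hdeg : ∀ v : V, {e : E | v ∈ ends e}.ncard ≤ d) :
    ∃ (X W1 W2 : Type) (T1 : PhyloTree W1 X) (T2 : PhyloTree W2 X),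
      Nat.card X ≤ (n + 2) + n * d ∧
      Nat.card {v : W1 // ∀ x : X, T1.leaf x ≠ v} ≤ n * (d + 1) ∧
      Nat.card {v : W2 // ∀ x : X, T2.leaf x ≠ v} ≤ n * (d + 1) ∧
      T1.graph.edgeSet.ncard ≤ 2 * n + 1 + 2 * n * d ∧
      T2.graph.edgeSet.ncard ≤ 2 * n + 1 + 2 * n * d ∧
      Nat.card (DisplayVertex T1.leaf T2.leaf) ≤ 2 * n * (d + 1) + (n + 2) + n * d ∧
      (displayGraph T1.graph T1.leaf T2.graph T2.leaf).edgeSet.ncard ≤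
        4 * n + 2 + 4 * n * d ∧
      MultigraphMinor ends (displayGraph T1.graph T1.leaf T2.graph T2.leaf) := by
  classical
  obtain ⟨p, q, hends, hloop, hinj⟩ := exists_slots ends d hdeg
  rw [Nat.card_eq_fintype_card] at hn
  obtain ⟨N, hN⟩ : ∃ N, N = n * (d + 1) := ⟨_, rfl⟩
  let φ : V × Fin (d + 1) ≃ Fin N :=
    ((Fintype.equivFinOfCardEq hn).prodCongr (Equiv.refl _)).trans
      (finProdFinEquiv.trans (finCongr hN.symm))
  have hφ : ∀ v (i j : Fin (d + 1)), i.val + 1 = j.val → (φ (v, i)).val + 1 = (φ (v, j)).val := by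
    intro v i j h
    simp only [φ, Equiv.trans_apply, Equiv.prodCongr_apply, Prod.map, finProdFinEquiv_apply_val,
      Equiv.refl_apply, finCongr_apply, Fin.val_cast]
    omega
  obtain ⟨σ, hσ⟩ := exists_perm_pairs (fun e => ¬ (ends e).IsDiag) (fun e => φ (p e))
    (fun e => φ (q e)) (by
      intro e he h
      apply he
      rw [hends e, φ.injective h]
      simp) (by
      intro e e' h
      apply hinj
      simpa using h)
  have hN' : N = n * d + n := by rw [hN]; ring
  have hnd : 2 * n * d = 2 * (n * d) := by ring
  have hnd4 : 4 * n * d = 4 * (n * d) := by ring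
  have hnd2 : 2 * n * (d + 1) = 2 * N := by rw [hN]; ring
  rw [← hN]
  have c1 := card_not_catLeaf N (Equiv.refl _)
  have c2 := card_not_catLeaf N σ
  have e1 := catGraph_edge_le N
  have j1 := catLeaf_inj N (Equiv.refl _)
  have j2 := catLeaf_inj N σ
  refine ⟨Fin N ⊕ Bool, _, _, catTree N (Equiv.refl _), catTree N σ, ?_, c1, c2, ?_, ?_, ?_, ?_, ?_⟩
  · simp; omega
  · change (catGraph N).edgeSet.ncard ≤ _; omega
  · change (catGraph N).edgeSet.ncard ≤ _; omega
  · refine (display_card (l1 := catLeaf N (Equiv.refl _)) (l2 := catLeaf N σ) j2).trans ?_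
    simp only [Nat.card_sum, Nat.card_fin]
    omega
  · refine (display_edges (l1 := catLeaf N (Equiv.refl _)) (l2 := catLeaf N σ)
      (catGraph N) (catGraph N)).trans ?_
    omega
  · change MultigraphMinor ends (displayGraph (catGraph N) (catLeaf N (Equiv.refl _))
      (catGraph N) (catLeaf N σ))
    set t := toDisplay (catLeaf N (Equiv.refl _)) (catLeaf N σ) with ht
    have tl : ∀ x, t (Sum.inl (Sum.inr x)) = t (Sum.inr (Sum.inr (σ x))) := fun x =>
      (toDisplay_leaf (l1 := catLeaf N (Equiv.refl _)) j2 (Sum.inl x)).symm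
    refine minor_aux ends _ d (fun x => t (Sum.inl (Sum.inl (φ x).castSucc.succ)))
      (fun x => t (Sum.inl (Sum.inr (φ x))))
      (fun x => t (Sum.inr (Sum.inl (σ (φ x)).castSucc.succ)))
      ?_ ?_ ?_ ?_ ?_ ?_ ?_ ?_ ?_ p q hends hloop hinj ?_
    · intro x y h
      have := toDisplay_inl_inj h
      simpa using this
    · intro x y h
      have := toDisplay_inl_inj h
      simpa using this
    · intro x y h
      have := toDisplay_inr_inj j1 j2 h
      simpa using this
    · intro x y h
      have := toDisplay_inl_inj h
      simp at this
    · intro x y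
      exact toDisplay_inl_ne_inr (catLeaf_ne N σ _)
    · intro x y
      exact toDisplay_inl_ne_inr (catLeaf_ne N σ _)
    · intro x
      apply display_adj_left
      simp [catGraph_lr]
    · intro x
      rw [tl]
      apply display_adj_right j1 j2
      simp [catGraph_rl]
    · intro v i j h
      apply display_adj_left
      have := hφ v i j h
      rw [catGraph_ll]
      left
      simpa using this
    · intro e he
      apply display_adj_right j1 j2
      have := hσ e he
      rw [catGraph_ll]
      left
      simpa using this
end
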